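/- arXiv:0711.2817 — 2 statements merged into one kernel-verified Lean document; each statement's English description precedes it below -/
import Mathlib

section
/- Let q ≥ 4 be a prime power and G = SL(2,q). Then for every field F and every finite-dimensional FG-module M, dim H^2(G,M) ≤ dim M. -/
namespace CohomologyBound

open CategoryTheory Module

section General

variable {F G : Type} [Field F] [Group G]
  {M M₁ M₂ M₃ : Type} [AddCommGroup M] [Module F M]
  [AddCommGroup M₁] [Module F M₁] [AddCommGroup M₂] [Module F M₂] [AddCommGroup M₃] [Module F M₃]

/-- The `n`-th cohomology of a representation, as a type. -/
abbrev H (ρ : Representation F G M) (n : ℕ) : Type := groupCohomology (Rep.of ρ) n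

/-- The dimension of the `n`-th cohomology of a representation. -/
noncomputable abbrev hd (ρ : Representation F G M) (n : ℕ) : ℕ := finrank F (H ρ n)

instance finite_H [Finite G] [FiniteDimensional F M] (ρ : Representation F G M) (n : ℕ) :
    FiniteDimensional F (H ρ n) := by
  have h1 : Function.Injective (groupCohomology.iCocycles (Rep.of ρ) n) :=
    (ModuleCat.mono_iff_injective _).1 inferInstance
  have h2 : Function.Surjective (groupCohomology.π (Rep.of ρ) n) :=
    fun x => groupCohomology_induction_on (C := fun y => ∃ a, groupCohomology.π (Rep.of ρ) n a = y)
      x fun y => ⟨y, rfl⟩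
  have : FiniteDimensional F ((groupCohomology.inhomogeneousCochains (Rep.of ρ)).X n) :=
    inferInstanceAs (FiniteDimensional F ((Fin n → G) → M))
  have : FiniteDimensional F (groupCohomology.cocycles (Rep.of ρ) n) :=
    FiniteDimensional.of_injective (groupCohomology.iCocycles (Rep.of ρ) n).hom h1
  exact FiniteDimensional.of_surjective (groupCohomology.π (Rep.of ρ) n).hom h2

variable {ρ : Representation F G M} {ρ₁ : Representation F G M₁} {ρ₂ : Representation F G M₂}
  {ρ₃ : Representation F G M₃}

/-- The map induced on cohomology by an equivariant map. -/
noncomputable def Hmap (f : ρ₁.IntertwiningMap ρ₂) (n : ℕ) : H ρ₁ n →ₗ[F] H ρ₂ n :=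
  (groupCohomology.map (MonoidHom.id G) (Rep.ofHom f) n).hom

lemma Hmap_id (n : ℕ) : Hmap (.id ρ) n = LinearMap.id := by
  have := groupCohomology.map_id (k := F) (B := Rep.of ρ) (n := n)
  exact congrArg ModuleCat.Hom.hom this

lemma Hmap_comp (f : ρ₁.IntertwiningMap ρ₂) (g : ρ₂.IntertwiningMap ρ₃) (n : ℕ) :
    Hmap (g.comp f) n = Hmap g n ∘ₗ Hmap f n := by
  have := groupCohomology.map_id_comp (Rep.ofHom f) (Rep.ofHom g) n
  exact congrArg ModuleCat.Hom.hom this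

lemma exists_connecting (f : ρ₁.IntertwiningMap ρ₂) (g : ρ₂.IntertwiningMap ρ₃)
    (hf : Function.Injective f) (hfg : Function.Exact f g) (hg : Function.Surjective g) (n : ℕ) :
    Function.Exact (Hmap f n) (Hmap g n) ∧ ∃ δ : H ρ₃ n →ₗ[F] H ρ₁ (n + 1),
      Function.Exact (Hmap g n) δ ∧ Function.Exact δ (Hmap f (n + 1)) := by
  let X : ShortComplex (Rep F G) := ShortComplex.mk (Rep.ofHom f) (Rep.ofHom g) (by
    ext x
    exact (hfg (f x)).2 ⟨x, rfl⟩)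
  have hX : X.ShortExact := by
    have : Mono X.f := (Rep.mono_iff_injective _).2 hf
    have : Epi X.g := (Rep.epi_iff_surjective _).2 hg
    refine ShortComplex.ShortExact.mk ?_
    have : (X.map (forget₂ (Rep F G) (ModuleCat F))).Exact := by
      rw [ShortComplex.moduleCat_exact_iff]
      intro x hx
      exact (hfg x).1 hx
    exact (ShortComplex.exact_map_iff_of_faithful X (forget₂ (Rep F G) (ModuleCat F))).1 this
  refine ⟨?_, (groupCohomology.δ hX n (n + 1) rfl).hom, ?_, ?_⟩
  · exact (ShortComplex.ShortExact.moduleCat_exact_iff_function_exact _).1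
      (groupCohomology.mapShortComplex₂_exact hX n)
  · exact (ShortComplex.ShortExact.moduleCat_exact_iff_function_exact _).1
      (groupCohomology.mapShortComplex₃_exact hX (i := n) rfl)
  · exact (ShortComplex.ShortExact.moduleCat_exact_iff_function_exact _).1
      (groupCohomology.mapShortComplex₁_exact hX (i := n) rfl)

lemma Hmap_zero_injective (f : ρ₁.IntertwiningMap ρ₂) (hf : Function.Injective f) :
    Function.Injective (Hmap f 0) := by
  have : Mono (Rep.ofHom f) := (Rep.mono_iff_injective _).2 hf
  have h0 := groupCohomology.mono_map_0_of_mono (Rep.ofHom f)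
  exact (ModuleCat.mono_iff_injective _).1 h0

/-- Degree zero cohomology is the space of invariants. -/
noncomputable def H0Equiv (ρ : Representation F G M) : H ρ 0 ≃ₗ[F] ρ.invariants :=
  (groupCohomology.H0Iso (Rep.of ρ)).toLinearEquiv

lemma hd_le_of_injective [Finite G] [FiniteDimensional F M₂] (f : ρ₁.IntertwiningMap ρ₂) (n : ℕ)
    (hf : Function.Injective (Hmap f n)) : hd ρ₁ n ≤ hd ρ₂ n :=
  LinearMap.finrank_le_finrank_of_injective hf

lemma Hmap_leftInverse {f : ρ₁.IntertwiningMap ρ₂} {g : ρ₂.IntertwiningMap ρ₁}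
    (hgf : ∀ x, g (f x) = x) (n : ℕ) : Function.LeftInverse (Hmap g n) (Hmap f n) := by
  intro x
  have h1 : g.comp f = .id ρ₁ := by
    ext y
    exact hgf y
  rw [← LinearMap.comp_apply, ← Hmap_comp, h1, Hmap_id, LinearMap.id_apply]

/-- An equivariant bijection induces an isomorphism on cohomology. -/
noncomputable def HEquivOfBijective (f : ρ₁.IntertwiningMap ρ₂) (hf : Function.Bijective f)
    (n : ℕ) : H ρ₁ n ≃ₗ[F] H ρ₂ n :=
  let g : ρ₂.IntertwiningMap ρ₁ :=
    { (LinearEquiv.ofBijective f.toLinearMap hf).symm.toLinearMap with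
      isIntertwining' := fun a => by
        ext y
        obtain ⟨x, rfl⟩ := (LinearEquiv.ofBijective f.toLinearMap hf).surjective y
        apply (LinearEquiv.ofBijective f.toLinearMap hf).injective
        have h1 : ∀ z, (LinearEquiv.ofBijective f.toLinearMap hf).symm (f z) = z :=
          (LinearEquiv.ofBijective f.toLinearMap hf).symm_apply_apply
        simpa [h1] using! (Representation.IntertwiningMap.isIntertwining _ _ f a x).symm }
  LinearEquiv.ofLinearMap (Hmap f n) (Hmap g n)
    (LinearMap.ext <| Hmap_leftInverse (fun x =>
      (LinearEquiv.ofBijective f.toLinearMap hf).apply_symm_apply x) n)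
    (LinearMap.ext <| Hmap_leftInverse (fun x =>
      (LinearEquiv.ofBijective f.toLinearMap hf).symm_apply_apply x) n)

lemma hd_eq_of_bijective (f : ρ₁.IntertwiningMap ρ₂) (hf : Function.Bijective f) (n : ℕ) :
    hd ρ₁ n = hd ρ₂ n :=
  (HEquivOfBijective f hf n).finrank_eq

section ShortExact

variable [Finite G] [FiniteDimensional F M₁] [FiniteDimensional F M₂] [FiniteDimensional F M₃]
  (f : ρ₁.IntertwiningMap ρ₂) (g : ρ₂.IntertwiningMap ρ₃)
  (hf : Function.Injective f) (hfg : Function.Exact f g) (hg : Function.Surjective g) (n : ℕ)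

include hf hfg hg

lemma hd_middle_le : hd ρ₂ n ≤ hd ρ₁ n + hd ρ₃ n := by
  have h1 := (exists_connecting f g hf hfg hg n).1
  have h2 := (Hmap g n).finrank_range_add_finrank_ker
  rw [LinearMap.exact_iff.1 h1] at h2
  have h3 := (Hmap f n).finrank_range_le
  have h4 := Submodule.finrank_le (LinearMap.range (Hmap g n))
  unfold hd
  omega

lemma hd_succ_le : hd ρ₁ (n + 1) + finrank F (LinearMap.range (Hmap g n)) ≤
    hd ρ₃ n + hd ρ₂ (n + 1) := by
  obtain ⟨-, δ, h1, h2⟩ := exists_connecting f g hf hfg hg n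
  have h3 := δ.finrank_range_add_finrank_ker
  have h4 := (Hmap f (n + 1)).finrank_range_add_finrank_ker
  rw [LinearMap.exact_iff.1 h1] at h3
  rw [LinearMap.exact_iff.1 h2] at h4
  have h5 := Submodule.finrank_le (LinearMap.range (Hmap f (n + 1)))
  unfold hd
  omega

omit [FiniteDimensional F M₃] in
lemma hd_range_add_le : hd ρ₂ n ≤ hd ρ₁ n + finrank F (LinearMap.range (Hmap g n)) := by
  have h1 := (exists_connecting f g hf hfg hg n).1
  have h2 := (Hmap g n).finrank_range_add_finrank_ker
  rw [LinearMap.exact_iff.1 h1] at h2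
  have h3 := (Hmap f n).finrank_range_le
  unfold hd
  omega

end ShortExact

section FunRep

variable (X : Type) [MulAction G X] (ρ)

/-- The representation of `G` on functions from a `G`-set to a representation. -/
def funRep : Representation F G (X → M) where
  toFun g :=
    { toFun := fun φ x => ρ g (φ (g⁻¹ • x))
      map_add' := fun _ _ => by ext; simp
      map_smul' := fun _ _ => by ext; simp }
  map_one' := by ext; simp
  map_mul' _ _ := by ext; simp [mul_smul]

variable {X}

@[simp]
lemma funRep_apply (g : G) (φ : X → M) (x : X) : funRep ρ X g φ x = ρ g (φ (g⁻¹ • x)) := rfl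

/-- Restriction of a representation to a subgroup. -/
abbrev res (S : Subgroup G) : Representation F S M := ρ.comp S.subtype

lemma hd_funRep (S : Subgroup G) (x₀ : X) (hS : ∀ g, g ∈ S ↔ g • x₀ = x₀)
    [MulAction.IsPretransitive G X] (n : ℕ) : hd (funRep ρ X) n = hd (res ρ S) n := by
  have h1 : hd (Representation.coind S.subtype (res ρ S)) n = hd (res ρ S) n :=
    (groupCohomology.coindIso (Rep.of (res ρ S)) n).toLinearEquiv.finrank_eq
  rw [← h1]
  let f : (funRep ρ X).IntertwiningMap (Representation.coind S.subtype (res ρ S)) :=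
    { toFun := fun φ => ⟨fun g => ρ g (φ (g⁻¹ • x₀)), fun s g => by
        have : (s : G)⁻¹ • x₀ = x₀ := (hS _).1 (S.inv_mem s.2)
        simp [mul_smul, this]⟩
      map_add' := fun _ _ => by ext; simp
      map_smul' := fun _ _ => by ext; simp
      isIntertwining' := fun g => by
        ext φ t
        change ρ t (ρ g (φ (g⁻¹ • t⁻¹ • x₀))) = ρ (t * g) (φ ((t * g)⁻¹ • x₀))
        simp [mul_smul] }
  have hfa : ∀ φ g, (f φ).1 g = ρ g (φ (g⁻¹ • x₀)) := fun _ _ => rfl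
  refine hd_eq_of_bijective f ⟨fun φ ψ hφ => ?_, fun a => ?_⟩ n
  · funext x
    obtain ⟨g, rfl⟩ := MulAction.exists_smul_eq G x₀ x
    have := congrFun (congrArg Subtype.val hφ) g⁻¹
    rw [hfa, hfa] at this
    simpa using congrArg (ρ g) this
  · choose r hr using fun x : X => MulAction.exists_smul_eq G x₀ x
    refine ⟨fun x => ρ (r x) (a.1 (r x)⁻¹), ?_⟩
    ext g
    rw [hfa]
    have hs : g * r (g⁻¹ • x₀) ∈ S := by rw [hS, mul_smul, hr, smul_inv_smul]
    have := a.2 ⟨_, hs⟩ (r (g⁻¹ • x₀))⁻¹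
    simp at this
    simpa using this.symm

variable (X) in
/-- The embedding of a representation into functions as constants. -/
def constMap : ρ.IntertwiningMap (funRep ρ X) where
  toFun m := fun _ => m
  map_add' _ _ := rfl
  map_smul' _ _ := rfl
  isIntertwining' _ := rfl

lemma constMap_apply (m : M) (x : X) : constMap ρ X m x = m := rfl

/-- Summation over a finite `G`-set. -/
def sumMap [Fintype X] : (funRep ρ X).IntertwiningMap ρ where
  toFun φ := ∑ x, φ x
  map_add' _ _ := by simp [Finset.sum_add_distrib]
  map_smul' _ _ := by simp [Finset.smul_sum]
  isIntertwining' g := by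
    ext φ
    simp only [LinearMap.comp_apply, LinearMap.coe_mk, AddHom.coe_mk, funRep_apply, map_sum]
    exact Fintype.sum_equiv (MulAction.toPerm g⁻¹) _ _ fun x => rfl

lemma sumMap_apply [Fintype X] (φ : X → M) : sumMap ρ φ = ∑ x, φ x := rfl

lemma Hmap_constMap_injective [Finite X] (hX : (Nat.card X : F) ≠ 0) (n : ℕ) :
    Function.Injective (Hmap (constMap ρ X) n) := by
  have := Fintype.ofFinite X
  refine (Hmap_leftInverse (g := (Nat.card X : F)⁻¹ • sumMap ρ) (fun m => ?_) n).injective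
  have h1 : sumMap ρ (constMap ρ X m) = (Nat.card X : F) • m := by
    rw [sumMap_apply]
    simp [constMap_apply, Nat.cast_smul_eq_nsmul]
  change (Nat.card X : F)⁻¹ • sumMap ρ (constMap ρ X m) = m
  rw [h1, inv_smul_smul₀ hX]

lemma hd_le_of_stabilizer [Finite G] [FiniteDimensional F M] [Finite X] (S : Subgroup G) (x₀ : X)
    (hS : ∀ g, g ∈ S ↔ g • x₀ = x₀) [MulAction.IsPretransitive G X] (hX : (Nat.card X : F) ≠ 0)
    (n : ℕ) : hd ρ n ≤ hd (res ρ S) n := by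
  rw [← hd_funRep ρ S x₀ hS n]
  have := Fintype.ofFinite X
  exact hd_le_of_injective _ _ (Hmap_constMap_injective ρ hX n)

lemma hd_le_of_index [Finite G] [FiniteDimensional F M] (S : Subgroup G)
    (hS : (S.index : F) ≠ 0) (n : ℕ) : hd ρ n ≤ hd (res ρ S) n :=
  hd_le_of_stabilizer ρ (X := G ⧸ S) S (QuotientGroup.mk 1)
    (fun g => by
      rw [MulAction.Quotient.smul_mk, eq_comm, QuotientGroup.eq]
      simp) hS n

end FunRep

end General

section Cyclic

variable {F G : Type} [Field F] [Group G] [Finite G] {M : Type} [AddCommGroup M] [Module F M]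
  [FiniteDimensional F M] (ρ : Representation F G M)

omit [Finite G] [FiniteDimensional F M] in
lemma hd_zero : hd ρ 0 = finrank F ρ.invariants := (H0Equiv ρ).finrank_eq

variable (g : G) (hg : ∀ x, x ∈ Subgroup.zpowers g)
include hg

lemma hd_two_le_of_cyclic : hd ρ 2 ≤ finrank F M := by
  have := Fintype.ofFinite G
  have hcomm : ∀ a b : G, a * b = b * a := fun a b => by
    obtain ⟨m, rfl⟩ := hg a
    obtain ⟨n, rfl⟩ := hg b
    exact (zpow_mul_comm g m n)
  let : CommGroup G := { ‹Group G› with mul_comm := hcomm }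
  let π := Rep.FiniteCyclicGroup.groupCohomologyπEven (Rep.of ρ) g hg 2 even_two
  have hπ : Function.Surjective π.hom := (ModuleCat.epi_iff_surjective π).1 <| by
    have h1 : Epi (ShortComplex.homologyπ (Rep.FiniteCyclicGroup.normHomCompSub (Rep.of ρ) g)) :=
      inferInstance
    have h2 : ∀ {A B : ModuleCat F} (e : A ≅ B), Epi e.inv := fun e => inferInstance
    exact @epi_comp _ _ _ _ _ _ (h2 _) _ (@epi_comp _ _ _ _ _ _ h1 _ (h2 _))
  exact (LinearMap.finrank_le_finrank_of_surjective hπ).trans (Submodule.finrank_le _)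

lemma hd_one_le_of_cyclic : hd ρ 1 ≤ finrank F ρ.invariants := by
  have := Fintype.ofFinite G
  have hcomm : ∀ a b : G, a * b = b * a := fun a b => by
    obtain ⟨m, rfl⟩ := hg a
    obtain ⟨n, rfl⟩ := hg b
    exact (zpow_mul_comm g m n)
  let : CommGroup G := { ‹Group G› with mul_comm := hcomm }
  let π := Rep.FiniteCyclicGroup.groupCohomologyπOdd (Rep.of ρ) g hg 1 odd_one
  have hπ : Function.Surjective π.hom := (ModuleCat.epi_iff_surjective π).1 <| by
    have h1 : Epi (ShortComplex.homologyπ (Rep.FiniteCyclicGroup.subCompNormHom (Rep.of ρ) g)) :=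
      inferInstance
    have h2 : ∀ {A B : ModuleCat F} (e : A ≅ B), Epi e.inv := fun e => inferInstance
    exact @epi_comp _ _ _ _ _ _ (h2 _) _ (@epi_comp _ _ _ _ _ _ h1 _ (h2 _))
  let D : M →ₗ[F] M := ρ g - LinearMap.id
  have hD : LinearMap.ker D = ρ.invariants := by
    ext x
    rw [Representation.mem_invariants_iff_of_forall_mem_zpowers ρ g hg]
    simp [D, sub_eq_zero]
  let N : M →ₗ[F] M := (Rep.of ρ).norm.hom.toLinearMap
  have hNe : ∀ x : M, N x = ∑ a, ρ a x := fun x => by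
    change ρ.norm x = _
    simp [Representation.norm]
  have hN : LinearMap.range D ≤ LinearMap.ker N := by
    rintro _ ⟨x, rfl⟩
    rw [LinearMap.mem_ker, LinearMap.sub_apply, map_sub, hNe, hNe, sub_eq_zero]
    exact Fintype.sum_equiv (Equiv.mulRight g) _ _ fun a => by simp
  have hk : LinearMap.ker π.hom = Submodule.comap (LinearMap.ker N).subtype (LinearMap.range D) := by
    ext x
    exact (Rep.FiniteCyclicGroup.groupCohomologyπOdd_eq_zero_iff (Rep.of ρ) g hg 1 odd_one x)
  have h1 := π.hom.finrank_range_add_finrank_ker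
  rw [hk, (Submodule.comapSubtypeEquivOfLe hN).finrank_eq, LinearMap.range_eq_top.2 hπ,
    finrank_top] at h1
  have h2 := D.finrank_range_add_finrank_ker
  rw [hD] at h2
  have h3 := Submodule.finrank_le (LinearMap.ker N)
  have h1' : hd ρ 1 + finrank F (LinearMap.range D) = finrank F (LinearMap.ker N) := h1
  omega

end Cyclic

section Sub

variable {F G : Type} [Field F] [Group G] {M : Type} [AddCommGroup M] [Module F M]
  (ρ : Representation F G M)

/-- The inclusion of a subrepresentation. -/
def subMap (W : Submodule F M) (hW : ∀ g, W ≤ W.comap (ρ g)) :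
    (ρ.subrepresentation W hW).IntertwiningMap ρ :=
  { W.subtype with isIntertwining' := fun _ => rfl }

/-- The projection onto a quotient representation. -/
def mkMap (W : Submodule F M) (hW : ∀ g, W ≤ W.comap (ρ g)) :
    ρ.IntertwiningMap (ρ.quotient W hW) :=
  { W.mkQ with isIntertwining' := fun _ => rfl }

variable (W : Submodule F M) (hW : ∀ g, W ≤ W.comap (ρ g))

@[simp] lemma mkMap_apply (x : M) : mkMap ρ W hW x = W.mkQ x := rfl

lemma subMap_injective : Function.Injective (subMap ρ W hW) := Subtype.val_injective

lemma mkMap_surjective : Function.Surjective (mkMap ρ W hW) := W.mkQ_surjective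

lemma subMap_mkMap_exact : Function.Exact (subMap ρ W hW) (mkMap ρ W hW) := fun x => by
  rw [mkMap_apply, ← LinearMap.mem_ker, Submodule.ker_mkQ]
  exact ⟨fun h => ⟨⟨x, h⟩, rfl⟩, by rintro ⟨y, rfl⟩; exact y.2⟩

variable [Finite G] [FiniteDimensional F M]

lemma hd_le_sub_add_quotient (n : ℕ) :
    hd ρ n ≤ hd (ρ.subrepresentation W hW) n + hd (ρ.quotient W hW) n :=
  hd_middle_le _ _ (subMap_injective ρ W hW) (subMap_mkMap_exact ρ W hW)
    (mkMap_surjective ρ W hW) n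

end Sub

/-- To bound the second cohomology it suffices to consider irreducible representations. -/
theorem hd_two_le_of_irreducible {F G : Type} [Field F] [Group G] [Finite G]
    (hirred : ∀ (M : Type) [AddCommGroup M] [Module F M] [FiniteDimensional F M] [Nontrivial M]
      (ρ : Representation F G M),
      (∀ W : Submodule F M, (∀ g, W ≤ W.comap (ρ g)) → W = ⊥ ∨ W = ⊤) → hd ρ 2 ≤ finrank F M)
    {M : Type} [AddCommGroup M] [Module F M] [FiniteDimensional F M]
    (ρ : Representation F G M) : hd ρ 2 ≤ finrank F M := by
  induction hd : finrank F M using Nat.strong_induction_on generalizing M with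
  | _ d ih =>
    subst hd
    by_cases hirr : ∀ W : Submodule F M, (∀ g, W ≤ W.comap (ρ g)) → W = ⊥ ∨ W = ⊤
    · rcases subsingleton_or_nontrivial M with hM | hM
      · have hs : Subsingleton (H ρ 2) := by
          have h2 : Function.Surjective (groupCohomology.H2π (Rep.of ρ)) :=
            (ModuleCat.epi_iff_surjective _).1 inferInstance
          have h3 : Subsingleton (groupCohomology.cocycles₂ (Rep.of ρ)) :=
            inferInstanceAs (Subsingleton (Subtype _))
          exact h2.subsingleton
        exact (finrank_zero_of_subsingleton (R := F) (M := H ρ 2)).le.trans (Nat.zero_le _)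
      · exact hirred M ρ hirr
    · push Not at hirr
      obtain ⟨W, hW, hb, ht⟩ := hirr
      have h1 := ih _ (Submodule.finrank_lt ht) (ρ.subrepresentation W hW) rfl
      have h0 : 0 < finrank F W := by
        have := (Submodule.nontrivial_iff_ne_bot (p := W)).2 hb
        exact finrank_pos
      have h3 := W.finrank_quotient_add_finrank
      have h2 := ih (finrank F (M ⧸ W)) (by omega) (ρ.quotient W hW) rfl
      have h4 := hd_le_sub_add_quotient ρ W hW 2
      omega

section NormalSubgroup

variable {F G : Type} [Field F] [Group G] [Finite G] (N : Subgroup G) [N.Normal] [Fintype N]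
  {M : Type} [AddCommGroup M] [Module F M] (ρ : Representation F G M)

/-- Summation over a normal subgroup, as an equivariant map. -/
def normMap : ρ.IntertwiningMap ρ where
  toLinearMap := ∑ a : N, ρ a
  isIntertwining' g := by
    ext m
    simp only [LinearMap.comp_apply, LinearMap.sum_apply, map_sum]
    refine (Fintype.sum_equiv (MulAut.conjNormal g : MulAut N).toEquiv _ _ fun a => ?_).symm
    rw [← Module.End.mul_apply, ← Module.End.mul_apply, ← map_mul, ← map_mul]
    simp [MulAut.conjNormal_apply]

omit [Finite G] in
lemma normMap_apply (m : M) : normMap N ρ m = ∑ a : N, ρ a m := by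
  change (∑ a : N, ρ a) m = _
  simp

omit [Finite G] in
lemma normMap_mem (m : M) (a : G) (ha : a ∈ N) : ρ a (normMap N ρ m) = normMap N ρ m := by
  rw [normMap_apply, map_sum]
  exact Fintype.sum_equiv (Equiv.mulLeft (⟨a, ha⟩ : N)) _ _ fun b => by simp

omit [Finite G] in
lemma normMap_of_fixed (m : M) (hm : ∀ a ∈ N, ρ a m = m) :
    normMap N ρ m = (Nat.card N : F) • m := by
  rw [normMap_apply, Finset.sum_congr rfl fun (a : N) _ => hm a a.2]
  simp [Nat.cast_smul_eq_nsmul]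

/-- If a normal subgroup of invertible order has vanishing norm, the cohomology vanishes. -/
theorem hd_eq_zero_of_norm [FiniteDimensional F M] (hN : (Nat.card N : F) ≠ 0)
    (hM : ∀ m, normMap N ρ m = 0) (n : ℕ) : hd ρ n = 0 := by
  induction n generalizing M with
  | zero =>
    rw [hd_zero, Submodule.finrank_eq_zero, Submodule.eq_bot_iff]
    intro x hx
    have := normMap_of_fixed N ρ x fun a _ => hx a
    rw [hM] at this
    exact (smul_eq_zero.1 this.symm).resolve_left hN
  | succ n ih =>
    let E := funRep ρ G
    have hE : hd E (n + 1) = 0 := by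
      rw [hd_funRep ρ (⊥ : Subgroup G) (1 : G) (by simp) (n + 1)]
      have h1 := isZero_groupCohomology_succ_of_subsingleton (Rep.of (res ρ (⊥ : Subgroup G))) n
      have := ModuleCat.subsingleton_of_isZero h1
      exact finrank_zero_of_subsingleton
    have := Fintype.ofFinite G
    let W : Submodule F (G → M) := LinearMap.ker (normMap N E).toLinearMap
    have hWm : ∀ x, x ∈ W ↔ normMap N E x = 0 := fun x => Iff.rfl
    have hW : ∀ g, W ≤ W.comap (E g) := fun g x hx => by
      rw [Submodule.mem_comap, hWm,
        Representation.IntertwiningMap.isIntertwining, (hWm x).1 hx, map_zero]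
    let E' := E.subrepresentation W hW
    let c : F := (Nat.card N : F)⁻¹
    have hidem : ∀ x, normMap N E (x - c • normMap N E x) = 0 := fun x => by
      rw [map_sub, map_smul, normMap_of_fixed N E (normMap N E x) fun a ha => normMap_mem N E x a ha,
        inv_smul_smul₀ hN, sub_self]
    let r : E.IntertwiningMap E' :=
      { toFun := fun x => ⟨x - c • normMap N E x, hidem x⟩
        map_add' := fun x y => by ext1; simp only [map_add, Submodule.coe_add]; module
        map_smul' := fun a x => by
          ext1; simp only [map_smul, Submodule.coe_smul, RingHom.id_apply]; module
        isIntertwining' := fun g => by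
          ext1 x
          apply Subtype.ext
          change E g x - c • normMap N E (E g x) = E g (x - c • normMap N E x)
          rw [map_sub, map_smul, Representation.IntertwiningMap.isIntertwining] }
    have hE' : hd E' (n + 1) = 0 := by
      refine Nat.le_zero.1 (hE ▸ hd_le_of_injective (subMap E W hW) (n + 1)
        (Hmap_leftInverse (g := r) (fun x => ?_) (n + 1)).injective)
      apply Subtype.ext
      change (x : G → M) - c • normMap N E x = x
      rw [(hWm _).1 x.2, smul_zero, sub_zero]
    let f : ρ.IntertwiningMap E' :=
      { toFun := fun m => ⟨constMap ρ G m, by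
          rw [hWm, normMap_apply]
          funext x
          rw [Finset.sum_apply]
          exact (normMap_apply N ρ m).symm.trans (hM m)⟩
        map_add' := fun _ _ => rfl
        map_smul' := fun _ _ => rfl
        isIntertwining' := fun _ => rfl }
    have hf : Function.Injective f := fun x y hxy => congrFun (congrArg Subtype.val hxy) 1
    let R : Submodule F W := LinearMap.range f.toLinearMap
    have hR : ∀ g, R ≤ R.comap (E' g) := by
      rintro g _ ⟨m, rfl⟩
      exact ⟨ρ g m, Representation.IntertwiningMap.isIntertwining _ _ f g m⟩
    have hQ := ih (E'.quotient R hR) (fun y => by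
      obtain ⟨x, rfl⟩ := mkMap_surjective E' R hR y
      rw [normMap_apply]
      have h1 : ∑ a : N, E' a x = 0 := by
        apply Subtype.ext
        rw [Submodule.coe_sum]
        exact (normMap_apply N E x).symm.trans ((hWm _).1 x.2)
      rw [← map_zero (mkMap E' R hR), ← h1, map_sum]
      exact Finset.sum_congr rfl fun a _ =>
        (Representation.IntertwiningMap.isIntertwining _ _ (mkMap E' R hR) a x).symm)
    have h3 := hd_succ_le f (mkMap E' R hR) hf (fun x => by
      rw [subMap_mkMap_exact E' R hR x]
      exact ⟨by rintro ⟨⟨_, m, rfl⟩, rfl⟩; exact ⟨m, rfl⟩,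
        by rintro ⟨m, rfl⟩; exact ⟨⟨_, m, rfl⟩, rfl⟩⟩) (mkMap_surjective E' R hR) n
    omega

end NormalSubgroup

section SpecialLinear

open Matrix OnePoint

/-- The group `SL(2, K)`. -/
abbrev SL2 (K : Type) [Field K] : Type := Matrix.SpecialLinearGroup (Fin 2) K

variable {K : Type} [Field K]

/-- Upper unitriangular matrices. -/
def uni (x : K) : SL2 K := ⟨!![1, x; 0, 1], by simp⟩

/-- Diagonal matrices of determinant one. -/
def tor : Kˣ →* SL2 K where
  toFun a := ⟨!![(a : K), 0; 0, ((a⁻¹ : Kˣ) : K)], by simp⟩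
  map_one' := by ext i j; fin_cases i <;> fin_cases j <;> simp
  map_mul' a b := by
    apply Subtype.ext
    change !![((a * b : Kˣ) : K), 0; 0, (((a * b)⁻¹ : Kˣ) : K)] =
      !![(a : K), 0; 0, ((a⁻¹ : Kˣ) : K)] * !![(b : K), 0; 0, ((b⁻¹ : Kˣ) : K)]
    simp [mul_comm]

/-- The Weyl element. -/
def wey : SL2 K := ⟨!![0, 1; -1, 0], by simp⟩

lemma coe_uni (x : K) : ((uni x : SL2 K) : Matrix (Fin 2) (Fin 2) K) = !![1, x; 0, 1] := rfl

lemma coe_tor (a : Kˣ) : ((tor a : SL2 K) : Matrix (Fin 2) (Fin 2) K) =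
    !![(a : K), 0; 0, ((a⁻¹ : Kˣ) : K)] := rfl

lemma coe_wey : ((wey : SL2 K) : Matrix (Fin 2) (Fin 2) K) = !![0, 1; -1, 0] := rfl

lemma uni_add (x y : K) : uni (x + y) = uni x * uni y := by
  ext i j
  fin_cases i <;> fin_cases j <;> simp [coe_uni, add_comm]

lemma uni_zero : uni (0 : K) = 1 := by
  ext i j
  fin_cases i <;> fin_cases j <;> simp [coe_uni]

lemma uni_injective : Function.Injective (uni : K → SL2 K) := fun x y h => by
  have := congrArg (fun g : SL2 K => g.1 0 1) h
  simpa [coe_uni] using this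

lemma tor_injective : Function.Injective (tor : Kˣ →* SL2 K) := fun a b h => by
  have := congrArg (fun g : SL2 K => g.1 0 0) h
  exact Units.ext (by simpa [coe_tor] using this)

lemma tor_mul_uni (a : Kˣ) (x : K) : tor a * uni x = uni ((a : K) ^ 2 * x) * tor a := by
  ext i j
  fin_cases i <;> fin_cases j <;> simp [coe_uni, coe_tor]
  field_simp

lemma wey_mul_tor (a : Kˣ) : wey * tor a = tor a⁻¹ * wey := by
  ext i j
  fin_cases i <;> fin_cases j <;> simp [coe_wey, coe_tor]

lemma wey_mul_wey : (wey : SL2 K) * wey = tor (-1) := by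
  ext i j
  fin_cases i <;> fin_cases j <;> simp [coe_wey, coe_tor]

section Action

variable [DecidableEq K]

/-- `SL(2, K)` acts on the projective line. -/
instance : MulAction (SL2 K) (OnePoint K) :=
  MulAction.compHom (OnePoint K) (Matrix.SpecialLinearGroup.toGL (n := Fin 2) (R := K))

lemma smul_infty (g : SL2 K) :
    g • (∞ : OnePoint K) = if g.1 1 0 = 0 then ∞ else ((g.1 0 0 / g.1 1 0 : K) : OnePoint K) :=
  smul_infty_eq_ite _

lemma smul_coe (g : SL2 K) (k : K) :
    g • (k : OnePoint K) = if g.1 1 0 * k + g.1 1 1 = 0 then ∞ else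
      (((g.1 0 0 * k + g.1 0 1) / (g.1 1 0 * k + g.1 1 1) : K) : OnePoint K) :=
  smul_some_eq_ite

@[simp] lemma uni_smul_infty (x : K) : uni x • (∞ : OnePoint K) = ∞ := by
  simp [smul_infty, coe_uni]

@[simp] lemma uni_smul_coe (x y : K) : uni x • (y : OnePoint K) = ((y + x : K) : OnePoint K) := by
  simp [smul_coe, coe_uni]

@[simp] lemma tor_smul_infty (a : Kˣ) : tor a • (∞ : OnePoint K) = ∞ := by
  simp [smul_infty, coe_tor]

@[simp] lemma tor_smul_coe (a : Kˣ) (y : K) :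
    tor a • (y : OnePoint K) = (((a : K) ^ 2 * y : K) : OnePoint K) := by
  simp [smul_coe, coe_tor]
  ring

@[simp] lemma wey_smul_infty : (wey : SL2 K) • (∞ : OnePoint K) = ((0 : K) : OnePoint K) := by
  simp [smul_infty, coe_wey]

lemma wey_smul_coe (y : K) (hy : y ≠ 0) :
    (wey : SL2 K) • (y : OnePoint K) = ((-y⁻¹ : K) : OnePoint K) := by
  simp [smul_coe, coe_wey, hy, div_neg]

@[simp] lemma wey_smul_zero : (wey : SL2 K) • ((0 : K) : OnePoint K) = ∞ := by
  simp [smul_coe, coe_wey]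

instance : MulAction.IsPretransitive (SL2 K) (OnePoint K) := by
  have h : ∀ x : OnePoint K, ∃ g : SL2 K, g • (∞ : OnePoint K) = x := fun x => by
    cases x with
    | infty => exact ⟨1, one_smul _ _⟩
    | coe y => exact ⟨uni y * wey, by simp [mul_smul]⟩
  refine ⟨fun x y => ?_⟩
  obtain ⟨g, rfl⟩ := h x
  obtain ⟨k, rfl⟩ := h y
  exact ⟨k * g⁻¹, by simp [mul_smul]⟩

variable (K) in
/-- The Borel subgroup. -/
def Bor : Subgroup (SL2 K) := MulAction.stabilizer (SL2 K) (∞ : OnePoint K)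

lemma mem_Bor {g : SL2 K} : g ∈ Bor K ↔ g • (∞ : OnePoint K) = ∞ := Iff.rfl

lemma uni_mem_Bor (x : K) : uni x ∈ Bor K := uni_smul_infty x

lemma tor_mem_Bor (a : Kˣ) : tor a ∈ Bor K := tor_smul_infty a

lemma exists_eq_of_mem_Bor {g : SL2 K} (hg : g ∈ Bor K) : ∃ x a, g = uni x * tor a := by
  rw [mem_Bor, smul_infty] at hg
  have h0 : g.1 1 0 = 0 := by
    by_contra h
    simp [h] at hg
  have h1 := g.2
  rw [Matrix.det_fin_two, h0, mul_zero, sub_zero] at h1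
  refine ⟨g.1 0 1 * g.1 0 0, ⟨g.1 0 0, g.1 1 1, h1, by rwa [mul_comm] at h1⟩, ?_⟩
  ext i j
  fin_cases i <;> fin_cases j <;> simp [coe_uni, coe_tor, h0]
  rw [mul_assoc, h1, mul_one]

omit [DecidableEq K] in
lemma uni_mul_tor_injective :
    Function.Injective (fun z : K × Kˣ => (uni z.1 * tor z.2 : SL2 K)) := by
  rintro ⟨x, a⟩ ⟨y, b⟩ h
  have h1 := congrArg (fun g : SL2 K => g.1 0 0) h
  have h2 := congrArg (fun g : SL2 K => g.1 0 1) h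
  simp only [coe_uni, coe_tor, Matrix.SpecialLinearGroup.coe_mul] at h1 h2
  simp at h1 h2
  obtain rfl : a = b := Units.ext h1
  simpa using h2

/-- The parametrization of the Borel subgroup. -/
noncomputable def BorEquiv : K × Kˣ ≃ Bor K :=
  Equiv.ofBijective (fun z => ⟨uni z.1 * tor z.2, mul_mem (uni_mem_Bor _) (tor_mem_Bor _)⟩)
    ⟨fun _ _ h => uni_mul_tor_injective (congrArg Subtype.val h), fun g => by
      obtain ⟨x, a, h⟩ := exists_eq_of_mem_Bor g.2
      exact ⟨⟨x, a⟩, Subtype.ext h.symm⟩⟩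

instance [Fintype K] : Fintype (OnePoint K) := inferInstanceAs (Fintype (Option K))

omit [Field K] [DecidableEq K] in
lemma card_onePoint [Fintype K] : Nat.card (OnePoint K) = Fintype.card K + 1 := by
  rw [Nat.card_eq_fintype_card]
  exact Fintype.card_option

variable [Fintype K]

lemma card_Bor : Nat.card (Bor K) = Fintype.card K * (Fintype.card K - 1) := by
  rw [← Nat.card_congr BorEquiv, Nat.card_prod, Nat.card_eq_fintype_card, Nat.card_units,
    Nat.card_eq_fintype_card]

lemma card_SL2 : Nat.card (SL2 K) =
    Fintype.card K * (Fintype.card K - 1) * (Fintype.card K + 1) := by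
  rw [← card_Bor, ← card_onePoint, ← Subgroup.card_mul_index (Bor K)]
  congr 1
  rw [Bor, MulAction.index_stabilizer, MulAction.orbit_eq_univ, Set.ncard_univ]

end Action

lemma card_tor [Fintype K] : Nat.card (tor (K := K)).range = Fintype.card K - 1 := by
  rw [← Nat.card_congr (MonoidHom.ofInjective tor_injective).toEquiv, Nat.card_units,
    Nat.card_eq_fintype_card]

lemma two_le_card [Fintype K] : 2 ≤ Fintype.card K := Fintype.one_lt_card

lemma index_tor [Fintype K] : (tor (K := K)).range.index =
    Fintype.card K * (Fintype.card K + 1) := by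
  classical
  have h := Subgroup.card_mul_index (tor (K := K)).range
  rw [card_SL2, card_tor] at h
  have : 0 < Fintype.card K - 1 := by have := two_le_card (K := K); omega
  apply Nat.eq_of_mul_eq_mul_left this
  rw [h]; ring

/-- There is a cyclic subgroup of order `q + 1` in `SL(2,q)`. -/
lemma exists_nonsplit [Fintype K] : ∃ S : Subgroup (SL2 K), IsCyclic S ∧
    Nat.card S = Fintype.card K + 1 := by
  obtain ⟨p, hp⟩ := CharP.exists K
  have : Fact p.Prime := ⟨CharP.char_is_prime K p⟩
  let L := FiniteField.Extension K p 2
  have hfr : finrank K L = 2 := FiniteField.finrank_extension K p 2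
  have hcL : Nat.card L = Nat.card K ^ 2 := FiniteField.natCard_extension K p 2
  let b : Basis (Fin 2) K L := finBasisOfFinrankEq K L hfr
  let N : Lˣ →* Kˣ := Units.map (Algebra.norm K (S := L))
  have hN : Function.Surjective N := FiniteField.unitsMap_norm_surjective K L
  let f : N.ker →* SL2 K :=
    { toFun := fun x => ⟨Algebra.leftMulMatrix b (x.1 : L), by
        rw [← Algebra.norm_eq_matrix_det]
        exact congrArg Units.val (MonoidHom.mem_ker.1 x.2)⟩
      map_one' := Subtype.ext (by simp)
      map_mul' := fun x y => Subtype.ext (map_mul (Algebra.leftMulMatrix b) (x.1 : L) (y.1 : L)) }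
  have hf : Function.Injective f := fun x y h =>
    Subtype.ext (Units.ext (Algebra.leftMulMatrix_injective b (congrArg Subtype.val h)))
  refine ⟨f.range, ?_, ?_⟩
  · exact isCyclic_of_surjective f.rangeRestrict f.rangeRestrict_surjective
  · rw [← Nat.card_congr (MonoidHom.ofInjective hf).toEquiv]
    have h1 := Subgroup.card_mul_index N.ker
    rw [Subgroup.index_ker, MonoidHom.range_eq_top.2 hN, Subgroup.card_top, Nat.card_units,
      Nat.card_units, hcL, Nat.card_eq_fintype_card (α := K)] at h1
    have h2 := two_le_card (K := K)
    obtain ⟨r, hr⟩ := Nat.exists_eq_add_of_le h2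
    rw [hr] at h1 ⊢
    apply Nat.eq_of_mul_eq_mul_right (show 0 < 2 + r - 1 by omega)
    rw [h1, show 2 + r - 1 = 1 + r by omega]
    apply Nat.sub_eq_of_eq_add
    ring

end SpecialLinear

section CrossCharacteristic

variable {K : Type} [Field K] [Fintype K] {F : Type} [Field F] {M : Type} [AddCommGroup M]
  [Module F M] [FiniteDimensional F M] (ρ : Representation F (SL2 K) M)

lemma hd_two_le_of_cyclic_subgroup (S : Subgroup (SL2 K)) [hS : IsCyclic S]
    (hi : (S.index : F) ≠ 0) : hd ρ 2 ≤ finrank F M := by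
  obtain ⟨g, hg⟩ := hS.exists_generator
  exact (hd_le_of_index ρ S hi 2).trans (hd_two_le_of_cyclic (res ρ S) g hg)

lemma hd_two_le_of_ne_zero (hq : (Fintype.card K : F) ≠ 0) (h2 : (2 : F) ≠ 0) :
    hd ρ 2 ≤ finrank F M := by
  classical
  by_cases h : (Fintype.card K : F) + 1 = 0
  · obtain ⟨S, hS, hc⟩ := exists_nonsplit (K := K)
    refine hd_two_le_of_cyclic_subgroup ρ S ?_
    have h1 := Subgroup.card_mul_index S
    rw [card_SL2, hc] at h1
    have h3 : S.index = Fintype.card K * (Fintype.card K - 1) := by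
      apply Nat.eq_of_mul_eq_mul_left (show 0 < Fintype.card K + 1 by omega)
      rw [h1]; ring
    have h4 := two_le_card (K := K)
    rw [h3, Nat.cast_mul, Nat.cast_sub (by omega), Nat.cast_one]
    refine mul_ne_zero hq fun h5 => h2 ?_
    linear_combination h - h5
  · have : IsCyclic (tor (K := K)).range :=
      isCyclic_of_surjective tor.rangeRestrict tor.rangeRestrict_surjective
    refine hd_two_le_of_cyclic_subgroup ρ (tor (K := K)).range ?_
    rw [index_tor, Nat.cast_mul, Nat.cast_add, Nat.cast_one]
    exact mul_ne_zero hq h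

end CrossCharacteristic

section Generic

variable {F G : Type} [Field F] [Group G] {M : Type} [AddCommGroup M] [Module F M]
  (ρ : Representation F G M)

/-- The vectors fixed by a normal subgroup. -/
def fixedSub (N : Subgroup G) : Submodule F M where
  carrier := {m | ∀ a ∈ N, ρ a m = m}
  add_mem' hx hy a ha := by rw [map_add, hx a ha, hy a ha]
  zero_mem' a _ := map_zero _
  smul_mem' c x hx a ha := by rw [map_smul, hx a ha]

lemma fixedSub_le_comap (N : Subgroup G) [hN : N.Normal] (g : G) :
    fixedSub ρ N ≤ (fixedSub ρ N).comap (ρ g) := fun m hm a ha => by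
  have h1 := hm _ (hN.conj_mem' a ha g)
  rw [map_mul, map_mul, Module.End.mul_apply, Module.End.mul_apply] at h1
  have h2 := congrArg (ρ g) h1
  rwa [← Module.End.mul_apply, ← map_mul, mul_inv_cancel, map_one] at h2

variable [Finite G] [FiniteDimensional F M]

lemma hd_le_fixedSub (N : Subgroup G) [N.Normal] (hN : (Nat.card N : F) ≠ 0) (n : ℕ) :
    hd ρ n ≤ hd (ρ.subrepresentation (fixedSub ρ N) (fixedSub_le_comap ρ N)) n := by
  have := Fintype.ofFinite N
  have h1 := hd_le_sub_add_quotient ρ (fixedSub ρ N) (fixedSub_le_comap ρ N) n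
  rwa [hd_eq_zero_of_norm N (ρ.quotient (fixedSub ρ N) (fixedSub_le_comap ρ N)) hN (fun y => by
    obtain ⟨x, rfl⟩ := mkMap_surjective ρ _ (fixedSub_le_comap ρ N) y
    rw [normMap_apply]
    have h2 : mkMap ρ _ (fixedSub_le_comap ρ N) (normMap N ρ x) = 0 := by
      rw [mkMap_apply, Submodule.mkQ_apply, Submodule.Quotient.mk_eq_zero]
      exact fun a ha => normMap_mem N ρ x a ha
    rw [← h2, normMap_apply, map_sum]
    exact Finset.sum_congr rfl fun a _ =>
      (Representation.IntertwiningMap.isIntertwining _ _ (mkMap ρ _ (fixedSub_le_comap ρ N)) a x).symm),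
    add_zero] at h1

lemma hd_eq_zero_of_fixed (N : Subgroup G) [N.Normal] (hN : (Nat.card N : F) ≠ 0)
    (h : ∀ m, (∀ a ∈ N, ρ a m = m) → m = 0) (n : ℕ) : hd ρ n = 0 := by
  have := Fintype.ofFinite N
  exact hd_eq_zero_of_norm N ρ hN (fun m => h _ fun a ha => normMap_mem N ρ m a ha) n

end Generic

section ShortExact

variable {F G : Type} [Field F] [Group G] [Finite G]
  {M₁ M₂ M₃ : Type} [AddCommGroup M₁] [Module F M₁] [AddCommGroup M₂] [Module F M₂]
  [AddCommGroup M₃] [Module F M₃]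
  [FiniteDimensional F M₁] [FiniteDimensional F M₂] [FiniteDimensional F M₃]
  {ρ₁ : Representation F G M₁} {ρ₂ : Representation F G M₂} {ρ₃ : Representation F G M₃}
  (f : ρ₁.IntertwiningMap ρ₂) (g : ρ₂.IntertwiningMap ρ₃)
  (hf : Function.Injective f) (hfg : Function.Exact f g) (hg : Function.Surjective g) (n : ℕ)

include hf hfg hg

lemma hd_add_hd_succ_le : hd ρ₃ n + hd ρ₂ (n + 1) ≤
    hd ρ₂ n + hd ρ₁ (n + 1) + hd ρ₃ (n + 1) := by
  obtain ⟨-, δ, h1, h2⟩ := exists_connecting f g hf hfg hg n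
  have h3 := δ.finrank_range_add_finrank_ker
  have h4 := (Hmap f (n + 1)).finrank_range_add_finrank_ker
  rw [LinearMap.exact_iff.1 h1] at h3
  rw [LinearMap.exact_iff.1 h2] at h4
  have h5 := hd_range_add_le f g hf hfg hg (n + 1)
  have h6 := (Hmap g n).finrank_range_le
  have h7 := (exists_connecting f g hf hfg hg (n + 1)).1
  have h8 := (Hmap g (n + 1)).finrank_range_add_finrank_ker
  rw [LinearMap.exact_iff.1 h7] at h8
  have h9 := Submodule.finrank_le (LinearMap.range (Hmap g (n + 1)))
  unfold hd
  omega

lemma hd_zero_add_le : hd ρ₁ 0 + hd ρ₃ 0 ≤ hd ρ₂ 0 + hd ρ₁ 1 := by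
  obtain ⟨h0, δ, h1, -⟩ := exists_connecting f g hf hfg hg 0
  have h3 := δ.finrank_range_add_finrank_ker
  rw [LinearMap.exact_iff.1 h1] at h3
  have h5 := Submodule.finrank_le (LinearMap.range δ)
  have h8 := (Hmap g 0).finrank_range_add_finrank_ker
  rw [LinearMap.exact_iff.1 h0, LinearMap.finrank_range_of_inj (Hmap_zero_injective f hf)] at h8
  have h6 : finrank F (LinearMap.range δ) ≤ hd ρ₁ 1 := h5
  unfold hd at *
  omega

end ShortExact

section Iterate

lemma exists_fixed_of_pow {F M : Type} [Field F] [AddCommGroup M] [Module F M]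
    (p : ℕ) [Fact p.Prime] (hp : (p : F) = 0) (f : Module.End F M) (k : ℕ) (W : Submodule F M) (hW : W ≤ W.comap f)
    (hf : ∀ v ∈ W, (f ^ p ^ k) v = v) (hne : W ≠ ⊥) :
    ∃ v ∈ W, v ≠ 0 ∧ f v = v := by
  obtain ⟨v, hv, hv0⟩ := Submodule.exists_mem_ne_zero_of_ne_bot hne
  have : CharP F p := (CharP.charP_iff_prime_eq_zero Fact.out).2 hp
  have : CharP (Module.End F M) p := by
    have : Nontrivial M := ⟨⟨v, 0, hv0⟩⟩
    exact charP_of_injective_algebraMap (algebraMap F (Module.End F M)).injective p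
  have h1 : ((f - 1 : Module.End F M) ^ p ^ k) v = 0 := by
    rw [sub_pow_char_pow_of_commute p k (Commute.one_right f), one_pow, LinearMap.sub_apply, hf v hv]
    exact sub_self v
  have hmem : ∀ j, ((f - 1 : Module.End F M) ^ j) v ∈ W := fun j => by
    induction j with
    | zero => simpa using hv
    | succ j ih =>
      rw [pow_succ', Module.End.mul_apply, LinearMap.sub_apply]
      exact W.sub_mem (hW ih) ih
  classical
  have hex : ∃ j, ((f - 1 : Module.End F M) ^ j) v = 0 := ⟨_, h1⟩
  obtain ⟨j, hj⟩ : ∃ j, Nat.find hex = j + 1 := Nat.exists_eq_succ_of_ne_zero fun h => by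
    have := Nat.find_spec hex
    rw [h] at this
    exact hv0 (by simpa using this)
  refine ⟨((f - 1 : Module.End F M) ^ j) v, hmem j, Nat.find_min hex (by omega), ?_⟩
  have := Nat.find_spec hex
  rw [hj, pow_succ', Module.End.mul_apply, LinearMap.sub_apply, sub_eq_zero] at this
  exact this

end Iterate

open OnePoint

section Borel

variable {K : Type} [Field K] [Fintype K] [DecidableEq K] {F : Type} [Field F] {M : Type}
  [AddCommGroup M] [Module F M] (ρ : Representation F (SL2 K) M)

omit [Field K] [DecidableEq K] in
lemma sum_onePoint (φ : OnePoint K → M) : ∑ x, φ x = φ ∞ + ∑ t : K, φ t := Fintype.sum_option φ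

omit [Fintype K] in
/-- A vector fixed by the Borel subgroup defines an equivariant map from the projective line. -/
lemma exists_equivariant (v : M) (hv : ∀ g ∈ Bor K, ρ g v = v) :
    ∃ φ : OnePoint K → M, φ ∞ = v ∧ ∀ g x, φ (g • x) = ρ g (φ x) := by
  choose r hr using fun x : OnePoint K => MulAction.exists_smul_eq (SL2 K) (∞ : OnePoint K) x
  have key : ∀ g h : SL2 K, g • (∞ : OnePoint K) = h • (∞ : OnePoint K) → ρ g v = ρ h v := by
    intro g h hgh
    have h1 := hv (h⁻¹ * g) (by rw [mem_Bor, mul_smul, hgh, inv_smul_smul])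
    rw [map_mul, Module.End.mul_apply] at h1
    have h3 := congrArg (ρ h) h1
    rwa [← Module.End.mul_apply, ← map_mul, mul_inv_cancel, map_one] at h3
  refine ⟨fun x => ρ (r x) v, ?_, fun g x => ?_⟩
  · have := key (r ∞) 1 (by rw [hr, one_smul])
    simpa using this
  · rw [← Module.End.mul_apply, ← map_mul]
    exact key _ _ (by rw [hr, mul_smul, hr])

variable (h2 : (2 : F) = 0) (hq : Odd (Fintype.card K))

include h2 in
lemma add_self_eq_zero_of_two (m : M) : m + m = 0 := by rw [← two_smul F, h2, zero_smul]

include h2 in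
lemma neg_eq_of_two (m : M) : -m = m := neg_eq_of_add_eq_zero_left (add_self_eq_zero_of_two h2 m)

include h2 hq in
omit [Field K] [DecidableEq K] in
lemma card_cast_eq_one : (Fintype.card K : F) = 1 := by
  obtain ⟨k, hk⟩ := hq
  rw [hk, Nat.cast_add, Nat.cast_mul, Nat.cast_two, h2, zero_mul, zero_add, Nat.cast_one]

variable (hirr : ∀ W : Submodule F M, (∀ g, W ≤ W.comap (ρ g)) → W = ⊥ ∨ W = ⊤)
  (hnt : ∃ g m, ρ g m ≠ m)

include hirr hnt in
omit [Fintype K] [DecidableEq K] in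
lemma invariant_eq_zero (m : M) (hm : ∀ g, ρ g m = m) : m = 0 := by
  rcases hirr ρ.invariants (fun g x hx => by rw [Submodule.mem_comap, hx g]; exact hx) with h | h
  · have : m ∈ ρ.invariants := hm
    rw [h] at this
    exact this
  · obtain ⟨g, m, hgm⟩ := hnt
    have : m ∈ ρ.invariants := h ▸ Submodule.mem_top
    exact (hgm (this g)).elim

include h2 hq hirr hnt

lemma Bor_invariant_eq_zero (v : M) (hv : ∀ g ∈ Bor K, ρ g v = v) : v = 0 := by
  obtain ⟨φ, hφ, hφg⟩ := exists_equivariant ρ v hv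
  have hsum : ∑ x, φ x = 0 := invariant_eq_zero ρ hirr hnt _ fun g => by
    rw [map_sum]
    simp_rw [← hφg]
    exact Fintype.sum_equiv (MulAction.toPerm g) _ _ fun x => rfl
  rw [sum_onePoint, hφ] at hsum
  let e : Module.End F M := ∑ t : K, ρ (uni t)
  have he : ∀ m, e m = ∑ t : K, ρ (uni t) m := fun m => by simp [e]
  have he1 : ∀ x, e (φ x) = v := fun x => by
    rw [he]
    simp_rw [← hφg]
    cases x with
    | infty =>
      simp only [uni_smul_infty, hφ, Finset.sum_const, Finset.card_univ]
      rw [← Nat.cast_smul_eq_nsmul F, card_cast_eq_one h2 hq, one_smul]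
    | coe y =>
      simp only [uni_smul_coe]
      rw [Fintype.sum_equiv (Equiv.addLeft y) (fun t : K => φ ((y + t : K) : OnePoint K))
        (fun t : K => φ t) fun t => rfl, ← neg_eq_of_two h2 v]
      exact eq_neg_of_add_eq_zero_right hsum
  let D : Submodule F M := Submodule.span F (Set.range fun z : OnePoint K × OnePoint K =>
    φ z.1 - φ z.2)
  have hD : ∀ g, D ≤ D.comap (ρ g) := fun g => by
    rw [Submodule.span_le]
    rintro _ ⟨z, rfl⟩
    refine Submodule.subset_span ⟨⟨g • z.1, g • z.2⟩, ?_⟩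
    simp only [hφg, map_sub]
  have hDe : D ≤ LinearMap.ker e := by
    rw [Submodule.span_le]
    rintro _ ⟨z, rfl⟩
    simp [map_sub, he1]
  rcases hirr D hD with h | h
  · refine invariant_eq_zero ρ hirr hnt v fun g => ?_
    have : φ (g • ∞) - φ ∞ ∈ D := Submodule.subset_span ⟨⟨_, _⟩, rfl⟩
    rw [h, Submodule.mem_bot, hφg, hφ, sub_eq_zero] at this
    exact this
  · have : v ∈ LinearMap.ker e := hDe (h ▸ Submodule.mem_top)
    rw [LinearMap.mem_ker, ← hφ, he1, ← hφ] at this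
    rw [← hφ, this]

omit h2 hq hirr hnt
variable (K) in
/-- The diagonal part of an upper triangular matrix. -/
def BorChar : Bor K →* Kˣ where
  toFun g := ⟨g.1.1 0 0, g.1.1 1 1, by
      obtain ⟨x, a, h⟩ := exists_eq_of_mem_Bor g.2
      rw [h]; simp [coe_uni, coe_tor], by
      obtain ⟨x, a, h⟩ := exists_eq_of_mem_Bor g.2
      rw [h]; simp [coe_uni, coe_tor]⟩
  map_one' := Units.ext (by simp)
  map_mul' g h := Units.ext (by
    obtain ⟨x, a, h1⟩ := exists_eq_of_mem_Bor g.2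
    obtain ⟨y, b, h2⟩ := exists_eq_of_mem_Bor h.2
    simp [h1, h2, coe_uni, coe_tor, Matrix.mul_apply, Fin.sum_univ_two])

omit [Fintype K] in
lemma BorChar_apply (x : K) (a : Kˣ) (h : uni x * tor a ∈ Bor K) :
    BorChar K ⟨uni x * tor a, h⟩ = a := Units.ext (by simp [BorChar, coe_uni, coe_tor])

include hq in
lemma odd_ker_BorChar_pow (r : ℕ) (hr : Odd r) :
    Odd (Nat.card ((powMonoidHom r).comp (BorChar K)).ker) := by
  rw [← Nat.not_even_iff_odd]
  intro h
  have : Fact (Nat.Prime 2) := ⟨Nat.prime_two⟩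
  obtain ⟨g, hg⟩ := exists_prime_orderOf_dvd_card' 2 (even_iff_two_dvd.1 h)
  have hg2 : g ^ 2 = 1 := orderOf_dvd_iff_pow_eq_one.1 (dvd_of_eq hg)
  obtain ⟨⟨g, hgB⟩, hgk⟩ := g
  obtain ⟨x, a, rfl⟩ := exists_eq_of_mem_Bor hgB
  rw [MonoidHom.mem_ker, MonoidHom.comp_apply, BorChar_apply, powMonoidHom_apply] at hgk
  have h3 : (⟨uni x * tor a, hgB⟩ : Bor K) ^ 2 = 1 := congrArg Subtype.val hg2
  have h4 := congrArg (BorChar K) h3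
  rw [map_pow, BorChar_apply, map_one] at h4
  have ha : a = 1 := by
    have h5 : orderOf a ∣ Nat.gcd 2 r :=
      Nat.dvd_gcd (orderOf_dvd_of_pow_eq_one h4) (orderOf_dvd_of_pow_eq_one hgk)
    rw [(Nat.coprime_two_left).2 hr] at h5
    exact orderOf_eq_one_iff.1 (Nat.dvd_one.1 h5)
  subst ha
  have h6 : uni x * uni x = (1 : SL2 K) := by
    have := congrArg Subtype.val h3
    simpa [pow_two] using this
  rw [← uni_add, ← uni_zero] at h6
  have h7 : x = 0 := by
    have h8 := uni_injective h6
    rw [← two_mul] at h8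
    refine (mul_eq_zero.1 h8).resolve_left fun h9 => ?_
    rw [← Nat.not_even_iff_odd] at hq
    apply hq
    have h10 := FiniteField.even_card_iff_char_two (F := K)
    rw [Nat.even_iff, ← h10]
    have : CharP K 2 := CharTwo.of_one_ne_zero_of_two_eq_zero one_ne_zero h9
    exact ringChar.eq_iff.2 this
  subst h7
  have h11 : orderOf (⟨⟨uni 0 * tor 1, hgB⟩, hgk⟩ :
      ((powMonoidHom r).comp (BorChar K)).ker) = 1 := orderOf_eq_one_iff.2 (by
    apply Subtype.ext; apply Subtype.ext; simp [uni_zero])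
  omega

include h2 in
lemma cast_ne_zero_of_odd {n : ℕ} (hn : Odd n) : (n : F) ≠ 0 := by
  obtain ⟨k, rfl⟩ := hn
  simp [h2]

include h2 hq hirr hnt in
lemma hd_Bor_eq_zero [FiniteDimensional F M] (n : ℕ) : hd (res ρ (Bor K)) n = 0 := by
  obtain ⟨k, r, hr, hkr⟩ := Nat.exists_eq_two_pow_mul_odd (n := Fintype.card K - 1)
    (by have := two_le_card (K := K); omega)
  let N := ((powMonoidHom r).comp (BorChar K)).ker
  have hNm : ∀ g, g ∈ N ↔ BorChar K g ^ r = 1 := fun g => MonoidHom.mem_ker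
  refine hd_eq_zero_of_fixed (res ρ (Bor K)) N
    (cast_ne_zero_of_odd h2 (odd_ker_BorChar_pow hq r hr)) (fun m hm => ?_) n
  by_contra hm0
  let W := fixedSub (res ρ (Bor K)) N
  have hmW : m ∈ W := hm
  obtain ⟨a, ha⟩ := IsCyclic.exists_generator (α := Kˣ)
  let t : Bor K := ⟨tor a, tor_mem_Bor a⟩
  have hchar : ∀ (x : K) (h : uni x ∈ Bor K), BorChar K ⟨uni x, h⟩ = 1 := fun x h => by
    have := BorChar_apply x 1 (by simpa using h)
    simpa using this
  have ht : BorChar K t = a := by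
    have := BorChar_apply 0 a (by simpa [uni_zero] using tor_mem_Bor a)
    simpa [uni_zero] using this
  obtain ⟨v, hvW, hv0, hv⟩ := exists_fixed_of_pow 2 (by exact_mod_cast h2) (ρ (tor a)) k W
    (fixedSub_le_comap (res ρ (Bor K)) N t) (fun v hv => by
      rw [← map_pow]
      refine hv (t ^ 2 ^ k) ((hNm _).2 ?_)
      rw [map_pow, ht, ← pow_mul, ← hkr, ← Fintype.card_units]
      exact pow_card_eq_one) (fun h => hm0 (by rw [h] at hmW; exact hmW))
  refine hv0 (Bor_invariant_eq_zero ρ h2 hq hirr hnt v fun g hg => ?_)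
  obtain ⟨x, b, rfl⟩ := exists_eq_of_mem_Bor hg
  have h3 : ρ (tor b) v = v := by
    obtain ⟨i, rfl⟩ := mem_powers_iff_mem_zpowers.2 (ha b)
    simp only [map_pow]
    rw [Module.End.pow_apply]
    exact Function.iterate_fixed hv i
  rw [map_mul, Module.End.mul_apply, h3]
  exact hvW ⟨uni x, uni_mem_Bor x⟩ ((hNm _).2 (by rw [hchar, one_pow]))

end Borel
section Pairs

variable {G P : Type} [Group G] [MulAction G P]

/-- Ordered pairs of distinct points. -/
abbrev OPair (P : Type) : Type := {z : P × P // z.1 ≠ z.2}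

instance : MulAction G (OPair P) where
  smul g z := ⟨(g • z.1.1, g • z.1.2), fun h => z.2 (MulAction.injective g h)⟩
  one_smul z := Subtype.ext (Prod.ext (one_smul G z.1.1) (one_smul G z.1.2))
  mul_smul a b z := Subtype.ext (Prod.ext (mul_smul a b z.1.1) (mul_smul a b z.1.2))

lemma OPair.smul_def (g : G) (z : OPair P) :
    (g • z).1 = (g • z.1.1, g • z.1.2) := rfl

instance [Finite P] : Finite (OPair P) := inferInstanceAs (Finite (Subtype _))

/-- Exchanging the two points of a pair. -/
def OPair.swap (z : OPair P) : OPair P := ⟨(z.1.2, z.1.1), fun h => z.2 h.symm⟩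

lemma OPair.smul_swap (g : G) (z : OPair P) : (g • z).swap = g • z.swap := rfl

lemma OPair.swap_swap (z : OPair P) : z.swap.swap = z := rfl

lemma OPair.swap_ne (z : OPair P) : z.swap ≠ z := fun h =>
  z.2 (congrArg (fun y : OPair P => y.1.2) h)

variable [DecidableEq P]

/-- Unordered pairs of distinct points. -/
abbrev UPair (P : Type) : Type := Set.powersetCard P 2

/-- The unordered pair underlying an ordered pair. -/
def OPair.toU (z : OPair P) : UPair P := Set.powersetCard.ofCard (Finset.card_pair z.2)

lemma OPair.coe_toU (z : OPair P) : (z.toU : Finset P) = {z.1.1, z.1.2} := rfl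

lemma OPair.toU_smul (g : G) (z : OPair P) : (g • z).toU = g • z.toU := by
  apply Subtype.ext
  rw [Set.powersetCard.coe_smul, OPair.coe_toU, OPair.coe_toU]
  simp [OPair.smul_def, Finset.smul_finset_insert]

lemma OPair.toU_swap (z : OPair P) : z.swap.toU = z.toU :=
  Subtype.ext (Finset.pair_comm _ _)

lemma OPair.toU_surjective : Function.Surjective (OPair.toU : OPair P → UPair P) := fun s => by
  obtain ⟨x, y, hxy, h⟩ := Finset.card_eq_two.1 (Set.powersetCard.card_eq s)
  exact ⟨⟨(x, y), hxy⟩, Subtype.ext h.symm⟩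

lemma OPair.toU_eq {z z' : OPair P} (h : z.toU = z'.toU) : z = z' ∨ z = z'.swap := by
  obtain ⟨⟨x, y⟩, hz⟩ := z
  obtain ⟨⟨x', y'⟩, hz'⟩ := z'
  have h1 : ({x, y} : Finset P) = {x', y'} := congrArg Subtype.val h
  have hx : x = x' ∨ x = y' := by
    have : x ∈ ({x', y'} : Finset P) := h1 ▸ (by simp)
    simpa using this
  have hy : y = x' ∨ y = y' := by
    have : y ∈ ({x', y'} : Finset P) := h1 ▸ (by simp)
    simpa using this
  change x ≠ y at hz
  rcases hx with rfl | rfl <;> rcases hy with rfl | rfl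
  · exact (hz rfl).elim
  · exact Or.inl rfl
  · exact Or.inr rfl
  · exact (hz rfl).elim

end Pairs

section Maps

variable {G : Type} [Group G] {F M : Type} [Field F] [AddCommGroup M] [Module F M]
  (ρ : Representation F G M)

/-- Pullback of functions along an equivariant map. -/
def pullMap {X Y : Type} [MulAction G X] [MulAction G Y] (π : X → Y)
    (hπ : ∀ (g : G) x, π (g • x) = g • π x) : (funRep ρ Y).IntertwiningMap (funRep ρ X) where
  toFun φ := φ ∘ π
  map_add' _ _ := rfl
  map_smul' _ _ := rfl
  isIntertwining' g := by
    ext φ x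
    simp [hπ]

variable {P : Type} [MulAction G P] [DecidableEq P]

/-- Summation over the two orderings of an unordered pair. -/
noncomputable def pairSum : (funRep ρ (OPair P)).IntertwiningMap (funRep ρ (UPair P)) where
  toFun φ s := φ (Function.surjInv OPair.toU_surjective s) +
    φ (Function.surjInv OPair.toU_surjective s).swap
  map_add' φ ψ := by
    funext s
    simp only [Pi.add_apply]
    abel
  map_smul' c φ := by
    funext s
    simp
  isIntertwining' g := by
    ext φ s
    have key : ∀ (ψ : OPair P → M) (z : OPair P),
        ψ (Function.surjInv OPair.toU_surjective z.toU) +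
          ψ (Function.surjInv OPair.toU_surjective z.toU).swap = ψ z + ψ z.swap := fun ψ z => by
      rcases OPair.toU_eq (Function.surjInv_eq OPair.toU_surjective z.toU) with h | h
      · rw [h]
      · rw [h, OPair.swap_swap, add_comm]
    obtain ⟨z, rfl⟩ := OPair.toU_surjective s
    simp only [LinearMap.comp_apply, LinearMap.coe_mk, AddHom.coe_mk, funRep_apply]
    rw [← OPair.toU_smul, key φ]
    have := key (funRep ρ (OPair P) g φ) z
    simp only [funRep_apply] at this
    rw [this, OPair.smul_swap, map_add]

lemma pairSum_apply (φ : OPair P → M) (z : OPair P) :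
    pairSum ρ φ z.toU = φ z + φ z.swap := by
  change φ (Function.surjInv OPair.toU_surjective z.toU) +
          φ (Function.surjInv OPair.toU_surjective z.toU).swap = _
  rcases OPair.toU_eq (Function.surjInv_eq OPair.toU_surjective z.toU) with h | h
  · rw [h]
  · rw [h, OPair.swap_swap, add_comm]

lemma pairSum_surjective : Function.Surjective (pairSum (P := P) ρ) := fun ψ => by
  classical
  refine ⟨fun z => if z = Function.surjInv OPair.toU_surjective z.toU then ψ z.toU else 0, ?_⟩
  funext s
  obtain ⟨z, rfl⟩ := OPair.toU_surjective s
  rw [pairSum_apply, OPair.toU_swap]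
  rcases OPair.toU_eq (Function.surjInv_eq OPair.toU_surjective z.toU) with h | h
  · rw [if_pos h.symm, if_neg (by rw [h]; exact z.swap_ne), add_zero]
  · rw [if_neg (by rw [h]; exact z.swap_ne.symm), if_pos h.symm, zero_add]

lemma pull_toU_injective :
    Function.Injective (pullMap ρ (OPair.toU (P := P)) OPair.toU_smul) := fun φ ψ h => by
  funext s
  obtain ⟨z, rfl⟩ := OPair.toU_surjective s
  exact congrFun h z

lemma pull_toU_exact (h2 : (2 : F) = 0) : Function.Exact
    (pullMap ρ (OPair.toU (P := P)) OPair.toU_smul) (pairSum ρ) := fun φ => by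
  constructor
  · intro h
    have h1 : ∀ z : OPair P, φ z = φ z.swap := fun z => by
      have := congrFun h z.toU
      rw [pairSum_apply] at this
      rw [← neg_eq_of_two h2 (φ z.swap)]
      exact eq_neg_of_add_eq_zero_left this
    refine ⟨fun s => φ (Function.surjInv OPair.toU_surjective s), ?_⟩
    funext z
    change φ (Function.surjInv OPair.toU_surjective z.toU) = φ z
    rcases OPair.toU_eq (Function.surjInv_eq OPair.toU_surjective z.toU) with h | h
    · rw [h]
    · rw [h, ← h1]
  · rintro ⟨ψ, rfl⟩
    funext s
    obtain ⟨z, rfl⟩ := OPair.toU_surjective s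
    rw [pairSum_apply]
    change ψ z.toU + ψ z.swap.toU = 0
    rw [OPair.toU_swap, add_self_eq_zero_of_two h2]

/-- If the number of unordered pairs is odd, the second cohomology in characteristic two is
controlled by functions on ordered pairs. -/
lemma hd_two_le_of_odd_pairs [Finite G] [FiniteDimensional F M] [Finite P] (h2 : (2 : F) = 0)
    (hodd : Odd (Nat.card (UPair P))) (hP : hd (funRep ρ P) 2 = 0) :
    hd ρ 2 ≤ hd (funRep ρ (OPair P)) 0 + hd (funRep ρ (OPair P)) 1 := by
  have := Fintype.ofFinite P
  have := Fintype.ofFinite (OPair P)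
  have hinj := pull_toU_injective (P := P) ρ
  have hex := pull_toU_exact (P := P) ρ h2
  have hsur := pairSum_surjective (P := P) ρ
  obtain ⟨-, δ, -, h1⟩ := exists_connecting _ _ hinj hex hsur 1
  have h3 := Hmap_constMap_injective (X := UPair P) ρ (cast_ne_zero_of_odd h2 hodd) 2
  have h4 : LinearMap.range (Hmap (constMap ρ (UPair P)) 2) ≤ LinearMap.range δ := by
    rintro _ ⟨x, rfl⟩
    refine (h1 _).1 ?_
    rw [← LinearMap.comp_apply, ← Hmap_comp]
    have h5 : (pullMap ρ (OPair.toU (P := P)) OPair.toU_smul).comp (constMap ρ (UPair P)) =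
        (pullMap ρ (fun z : OPair P => z.1.1) fun _ _ => rfl).comp (constMap ρ P) := rfl
    rw [h5, Hmap_comp, LinearMap.comp_apply]
    have h6 : Subsingleton (H (funRep ρ P) 2) := finrank_zero_iff.1 hP
    rw [Subsingleton.elim (Hmap (constMap ρ P) 2 x) 0, map_zero]
  have h7 := Submodule.finrank_mono h4
  rw [LinearMap.finrank_range_of_inj h3] at h7
  have h8 := δ.finrank_range_le
  have h9 := hd_succ_le _ _ hinj hex hsur 0
  have h10 : hd (funRep ρ (UPair P)) 0 ≤ hd (funRep ρ (OPair P)) 0 :=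
    hd_le_of_injective _ 0 (Hmap_zero_injective _ hinj)
  have h11 : hd ρ 2 ≤ hd (funRep ρ (UPair P)) 1 := h7.trans h8
  have h12 : hd (funRep ρ (UPair P)) 1 ≤
    hd (funRep ρ (UPair P)) 0 + hd (funRep ρ (OPair P)) 1 := le_trans (Nat.le_add_right _ _) h9
  omega

end Maps

section Borel

variable {K : Type} [Field K] [Fintype K] [DecidableEq K] {F : Type} [Field F] {M : Type}
  [AddCommGroup M] [Module F M] (ρ : Representation F (SL2 K) M)

instance {K : Type} [DecidableEq K] : DecidableEq (OnePoint K) :=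
  inferInstanceAs (DecidableEq (Option K))

/-- The pair of fixed points of the diagonal torus. -/
def basePair : OPair (OnePoint K) := ⟨(∞, ((0 : K) : OnePoint K)), infty_ne_coe 0⟩

omit [Fintype K] in
lemma exists_smul_basePair (z : OPair (OnePoint K)) : ∃ g : SL2 K, g • basePair = z := by
  obtain ⟨⟨x, y⟩, hz⟩ := z
  change x ≠ y at hz
  obtain ⟨g, hg⟩ := MulAction.exists_smul_eq (SL2 K) (∞ : OnePoint K) x
  have hy : g⁻¹ • y ≠ ∞ := fun h => hz (by rw [← hg, ← h, smul_inv_smul])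
  obtain ⟨t, ht⟩ := ne_infty_iff_exists.1 hy
  refine ⟨g * uni t, Subtype.ext (Prod.ext ?_ ?_)⟩
  · change (g * uni t) • (∞ : OnePoint K) = x
    rw [mul_smul, uni_smul_infty, hg]
  · change (g * uni t) • ((0 : K) : OnePoint K) = y
    rw [mul_smul, uni_smul_coe, zero_add, ht, smul_inv_smul]

instance : MulAction.IsPretransitive (SL2 K) (OPair (OnePoint K)) := ⟨fun x y => by
  obtain ⟨g, rfl⟩ := exists_smul_basePair x
  obtain ⟨k, rfl⟩ := exists_smul_basePair y
  exact ⟨k * g⁻¹, by simp [mul_smul]⟩⟩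

omit [Fintype K] in
lemma mem_tor_range_iff (g : SL2 K) : g ∈ (tor (K := K)).range ↔ g • basePair (K := K) = basePair := by
  constructor
  · rintro ⟨a, rfl⟩
    refine Subtype.ext (Prod.ext ?_ ?_)
    · change tor a • (∞ : OnePoint K) = ∞
      simp
    · change tor a • ((0 : K) : OnePoint K) = (0 : K)
      simp
  · intro h
    have h1 : g • (∞ : OnePoint K) = ∞ := congrArg (fun z : OPair (OnePoint K) => z.1.1) h
    have h2 : g • ((0 : K) : OnePoint K) = (0 : K) :=
      congrArg (fun z : OPair (OnePoint K) => z.1.2) h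
    obtain ⟨x, a, rfl⟩ := exists_eq_of_mem_Bor h1
    simp [mul_smul] at h2
    refine ⟨a, ?_⟩
    rw [h2, uni_zero, one_mul]

omit [Fintype K] [DecidableEq K] in
lemma exists_generator_tor [Finite K] :
    ∃ g : (tor (K := K)).range, ∀ x, x ∈ Subgroup.zpowers g :=
  (isCyclic_of_surjective tor.rangeRestrict tor.rangeRestrict_surjective).exists_generator

omit [Fintype K] in
lemma hd_OPair (n : ℕ) : hd (funRep ρ (OPair (OnePoint K))) n = hd (res ρ (tor (K := K)).range) n :=
  hd_funRep ρ _ basePair mem_tor_range_iff n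

omit [Fintype K] in
lemma hd_onePoint (n : ℕ) : hd (funRep ρ (OnePoint K)) n = hd (res ρ (Bor K)) n :=
  hd_funRep ρ _ ∞ (fun _ => mem_Bor) n

lemma two_ne_zero_of_odd {K : Type} [Field K] [Fintype K] (hq : Odd (Fintype.card K)) :
    (2 : K) ≠ 0 := by
  refine Ring.two_ne_zero fun h => ?_
  have := FiniteField.even_card_of_char_two h
  rcases hq with ⟨k, hk⟩
  omega

omit [Fintype K] [DecidableEq K] in
/-- A vector fixed by the torus and one nontrivial unipotent element is fixed by all unipotents. -/
lemma uni_fixed_of_tor_fixed (hK2 : (2 : K) ≠ 0) (v : M) (h1 : ∀ a, ρ (tor a) v = v) (c : K)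
    (hc : c ≠ 0) (h3 : ρ (uni c) v = v) (x : K) : ρ (uni x) v = v := by
  have hsq : ∀ b : K, ρ (uni (b ^ 2 * c)) v = v := fun b => by
    rcases eq_or_ne b 0 with rfl | hb
    · simp [uni_zero]
    · have h4 := congrArg (fun g => ρ g v) (tor_mul_uni (Units.mk0 b hb) c)
      simp only [map_mul, Module.End.mul_apply, h3, h1, Units.val_mk0] at h4
      exact h4.symm
  have hx : uni x * uni (((x / c - 1) / 2) ^ 2 * c) = uni (((x / c + 1) / 2) ^ 2 * c) := by
    rw [← uni_add]
    congr 1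
    field_simp
    ring
  have h5 := congrArg (fun g => ρ g v) hx
  simpa only [map_mul, Module.End.mul_apply, hsq] using h5

variable [FiniteDimensional F M] (h2 : (2 : F) = 0) (hq : Odd (Fintype.card K))
  (hirr : ∀ W : Submodule F M, (∀ g, W ≤ W.comap (ρ g)) → W = ⊥ ∨ W = ⊤)
  (hnt : ∃ g m, ρ g m ≠ m)

include h2 hq hirr hnt

omit [FiniteDimensional F M] in
lemma tor_invariants_disjoint (hq1 : Fintype.card K % 4 = 1) : Disjoint (res ρ (tor (K := K)).range).invariants
    ((res ρ (tor (K := K)).range).invariants.map (ρ (uni 1))) := by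
  rw [Submodule.disjoint_def]
  rintro v hv ⟨w, hw, rfl⟩
  have hK2 : (2 : K) ≠ 0 := two_ne_zero_of_odd hq
  obtain ⟨i, hi⟩ := FiniteField.isSquare_neg_one_iff.2 (by omega : Fintype.card K % 4 ≠ 3)
  have hi0 : i ≠ 0 := fun h => by simp [h] at hi
  set v := ρ (uni 1) w with hvw
  have h1 : ∀ a, ρ (tor a) v = v := fun a => hv ⟨tor a, a, rfl⟩
  have h3 : ρ (uni 2) v = v := by
    have h4 : ρ (tor (Units.mk0 i hi0)) w = w := hw ⟨_, _, rfl⟩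
    have h5 : uni 1 * tor (Units.mk0 i hi0) = uni 2 * tor (Units.mk0 i hi0) * uni 1 := by
      rw [mul_assoc, tor_mul_uni, ← mul_assoc, ← uni_add]
      congr 2
      simp only [Units.val_mk0]
      linear_combination hi
    have h6 : ρ (uni 1 * tor (Units.mk0 i hi0)) w =
      ρ (uni 2 * tor (Units.mk0 i hi0) * uni 1) w := by rw [h5]
    rw [map_mul, Module.End.mul_apply, h4, map_mul, Module.End.mul_apply, ← hvw, map_mul,
      Module.End.mul_apply, h1] at h6
    exact h6.symm
  have h4 : ∀ x, ρ (uni x) v = v := uni_fixed_of_tor_fixed ρ hK2 v h1 2 hK2 h3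
  refine Bor_invariant_eq_zero ρ h2 hq hirr hnt _ fun g hg => ?_
  obtain ⟨x, a, rfl⟩ := exists_eq_of_mem_Bor hg
  rw [map_mul, Module.End.mul_apply, h1, h4]

lemma hd_two_le_of_card_mod_four_eq_one (hq1 : Fintype.card K % 4 = 1) :
    hd ρ 2 ≤ finrank F M := by
  have hodd : Odd (Nat.card (UPair (OnePoint K))) := by
    rw [Set.powersetCard.card, card_onePoint, Nat.choose_two_right]
    obtain ⟨k, hk⟩ : ∃ k, Fintype.card K = 4 * k + 1 := ⟨Fintype.card K / 4, by omega⟩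
    rw [hk]
    have : (4 * k + 1 + 1) * (4 * k + 1 + 1 - 1) / 2 = (2 * k + 1) * (4 * k + 1) := by
      rw [Nat.add_sub_cancel]
      exact Nat.div_eq_of_eq_mul_left two_pos (by ring)
    rw [this]
    exact Odd.mul ⟨k, rfl⟩ ⟨2 * k, by ring⟩
  have h1 := hd_two_le_of_odd_pairs ρ h2 hodd
    ((hd_onePoint ρ 2).trans (hd_Bor_eq_zero ρ h2 hq hirr hnt 2))
  rw [hd_OPair, hd_OPair, hd_zero] at h1
  obtain ⟨t, ht⟩ := exists_generator_tor (K := K)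
  have h3 := hd_one_le_of_cyclic (res ρ (tor (K := K)).range) t ht
  have h4 := Submodule.finrank_add_finrank_le_of_disjoint
    (tor_invariants_disjoint ρ h2 hq hirr hnt hq1)
  have h5 : Function.Injective (ρ (uni 1)) := (ρ.apply_bijective _).injective
  rw [(Submodule.equivMapOfInjective _ h5 _).finrank_eq.symm] at h4
  omega

end Borel
section Range

variable {F G : Type} [Field F] [Group G] {M₁ M₂ : Type} [AddCommGroup M₁] [Module F M₁]
  [AddCommGroup M₂] [Module F M₂] {ρ₁ : Representation F G M₁} {ρ₂ : Representation F G M₂}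
  (f : ρ₁.IntertwiningMap ρ₂)

lemma range_le_comap (g : G) :
    LinearMap.range f.toLinearMap ≤ (LinearMap.range f.toLinearMap).comap (ρ₂ g) := by
  rintro _ ⟨x, rfl⟩
  exact ⟨ρ₁ g x, Representation.IntertwiningMap.isIntertwining _ _ f g x⟩

/-- The image of an intertwining map. -/
def rangeRep : Representation F G (LinearMap.range f.toLinearMap) :=
  ρ₂.subrepresentation _ (range_le_comap f)

/-- The corestriction of an intertwining map to its image. -/
def rangeMap : ρ₁.IntertwiningMap (rangeRep f) :=
  { f.toLinearMap.rangeRestrict with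
    isIntertwining' := fun g => LinearMap.ext fun x => Subtype.ext
      (Representation.IntertwiningMap.isIntertwining _ _ f g x) }

/-- The inclusion of the image of an intertwining map. -/
def rangeIncl : (rangeRep f).IntertwiningMap ρ₂ := subMap ρ₂ _ (range_le_comap f)

lemma rangeMap_surjective : Function.Surjective (rangeMap f) :=
  f.toLinearMap.surjective_rangeRestrict

lemma rangeIncl_injective : Function.Injective (rangeIncl f) := Subtype.val_injective

lemma coe_rangeMap (x : M₁) : ((rangeMap f x : LinearMap.range f.toLinearMap) : M₂) = f x := rfl

lemma rangeMap_eq_zero {x : M₁} : rangeMap f x = 0 ↔ f x = 0 := by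
  rw [← coe_rangeMap]
  exact (Submodule.coe_eq_zero).symm

end Range

section Graph

variable {G P : Type} [Group G] [MulAction G P]

/-- Ordered triples of distinct points. -/
abbrev OTri (P : Type) : Type := {z : P × P × P // z.1 ≠ z.2.1 ∧ z.2.1 ≠ z.2.2 ∧ z.1 ≠ z.2.2}

instance : MulAction G (OTri P) where
  smul g z := ⟨(g • z.1.1, g • z.1.2.1, g • z.1.2.2),
    fun h => z.2.1 (MulAction.injective g h), fun h => z.2.2.1 (MulAction.injective g h),
    fun h => z.2.2.2 (MulAction.injective g h)⟩
  one_smul z := Subtype.ext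
    (Prod.ext (one_smul G z.1.1) (Prod.ext (one_smul G z.1.2.1) (one_smul G z.1.2.2)))
  mul_smul a b z := Subtype.ext
    (Prod.ext (mul_smul a b z.1.1) (Prod.ext (mul_smul a b z.1.2.1) (mul_smul a b z.1.2.2)))

/-- A triple of distinct points. -/
def OTri.mk (x y z : P) (hxy : x ≠ y) (hyz : y ≠ z) (hxz : x ≠ z) : OTri P :=
  ⟨(x, y, z), hxy, hyz, hxz⟩

variable [DecidableEq P]

/-- The pair of the first two points. -/
def OTri.fst (z : OTri P) : UPair P := OPair.toU ⟨(z.1.1, z.1.2.1), z.2.1⟩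

/-- The pair of the last two points. -/
def OTri.snd (z : OTri P) : UPair P := OPair.toU ⟨(z.1.2.1, z.1.2.2), z.2.2.1⟩

/-- The pair of the first and the last point. -/
def OTri.thd (z : OTri P) : UPair P := OPair.toU ⟨(z.1.1, z.1.2.2), z.2.2.2⟩

lemma OTri.fst_smul (g : G) (z : OTri P) : (g • z).fst = g • z.fst :=
  OPair.toU_smul g ⟨(z.1.1, z.1.2.1), z.2.1⟩

lemma OTri.snd_smul (g : G) (z : OTri P) : (g • z).snd = g • z.snd :=
  OPair.toU_smul g ⟨(z.1.2.1, z.1.2.2), z.2.2.1⟩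

lemma OTri.thd_smul (g : G) (z : OTri P) : (g • z).thd = g • z.thd :=
  OPair.toU_smul g ⟨(z.1.1, z.1.2.2), z.2.2.2⟩

variable {F M : Type} [Field F] [AddCommGroup M] [Module F M] (ρ : Representation F G M)

/-- The coboundary from points to edges of the complete graph, in characteristic two. -/
def edgeMap : (funRep ρ P).IntertwiningMap (funRep ρ (UPair P)) where
  toFun φ s := ∑ x ∈ (s : Finset P), φ x
  map_add' φ ψ := funext fun s => Finset.sum_add_distrib
  map_smul' c φ := by
    funext s
    simp [Finset.smul_sum]
  isIntertwining' g := by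
    ext φ s
    obtain ⟨z, rfl⟩ := OPair.toU_surjective s
    simp only [LinearMap.comp_apply, LinearMap.coe_mk, AddHom.coe_mk, funRep_apply]
    rw [← OPair.toU_smul, OPair.coe_toU, OPair.coe_toU, Finset.sum_pair z.2,
      Finset.sum_pair (g⁻¹ • z).2, map_add]
    rfl

lemma edgeMap_apply (φ : P → M) (z : OPair P) : edgeMap ρ φ z.toU = φ z.1.1 + φ z.1.2 := by
  change ∑ x ∈ ({z.1.1, z.1.2} : Finset P), φ x = _
  exact Finset.sum_pair z.2

/-- The coboundary from edges to triangles of the complete graph, in characteristic two. -/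
def triMap : (funRep ρ (UPair P)).IntertwiningMap (funRep ρ (OTri P)) where
  toFun φ z := φ z.fst + φ z.snd + φ z.thd
  map_add' φ ψ := by
    funext z
    simp only [Pi.add_apply]
    abel
  map_smul' c φ := by
    funext z
    simp
  isIntertwining' g := by
    ext φ z
    simp [OTri.fst_smul, OTri.snd_smul, OTri.thd_smul]

lemma triMap_apply (φ : UPair P → M) (z : OTri P) :
    triMap ρ φ z = φ z.fst + φ z.snd + φ z.thd := rfl

variable (h2 : (2 : F) = 0)

include h2

lemma eq_of_add_eq_zero_of_two {x y : M} (h : x + y = 0) : x = y := by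
  rw [← neg_eq_of_two h2 y]
  exact eq_neg_of_add_eq_zero_left h

lemma constMap_edgeMap_exact [Nonempty P] :
    Function.Exact (constMap ρ P) (rangeMap (edgeMap (P := P) ρ)) := fun φ => by
  rw [rangeMap_eq_zero]
  constructor
  · intro h
    obtain ⟨x⟩ := ‹Nonempty P›
    refine ⟨φ x, funext fun y => ?_⟩
    change φ x = φ y
    rcases eq_or_ne x y with rfl | hxy
    · rfl
    · refine eq_of_add_eq_zero_of_two h2 ?_
      have h1 := congrFun h (OPair.toU ⟨(x, y), hxy⟩)
      rwa [edgeMap_apply] at h1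
  · rintro ⟨m, rfl⟩
    funext s
    obtain ⟨z, rfl⟩ := OPair.toU_surjective s
    rw [edgeMap_apply]
    exact add_self_eq_zero_of_two h2 m

lemma triMap_edgeMap (φ : P → M) : triMap ρ (edgeMap ρ φ) = 0 := by
  funext z
  rw [triMap_apply, OTri.fst, OTri.snd, OTri.thd, edgeMap_apply, edgeMap_apply, edgeMap_apply]
  change φ z.1.1 + φ z.1.2.1 + (φ z.1.2.1 + φ z.1.2.2) + (φ z.1.1 + φ z.1.2.2) = 0
  rw [show φ z.1.1 + φ z.1.2.1 + (φ z.1.2.1 + φ z.1.2.2) + (φ z.1.1 + φ z.1.2.2) =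
    (φ z.1.1 + φ z.1.1) + (φ z.1.2.1 + φ z.1.2.1) + (φ z.1.2.2 + φ z.1.2.2) by abel]
  simp [add_self_eq_zero_of_two h2]

lemma edgeMap_triMap_exact [Nonempty P] :
    Function.Exact (rangeIncl (edgeMap (P := P) ρ)) (rangeMap (triMap (P := P) ρ)) := fun φ => by
  rw [rangeMap_eq_zero]
  constructor
  · intro h
    obtain ⟨p⟩ := ‹Nonempty P›
    refine ⟨⟨φ, fun x => if hx : p ≠ x then φ (OPair.toU ⟨(p, x), hx⟩) else 0, ?_⟩, rfl⟩
    funext s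
    obtain ⟨z, rfl⟩ := OPair.toU_surjective s
    refine (edgeMap_apply ρ _ z).trans ?_
    obtain ⟨⟨x, y⟩, hz⟩ := z
    change x ≠ y at hz
    change (if hx : p ≠ x then φ (OPair.toU ⟨(p, x), hx⟩) else 0) +
      (if hx : p ≠ y then φ (OPair.toU ⟨(p, y), hx⟩) else 0) = _
    rcases eq_or_ne p x with rfl | hx
    · rw [dif_neg (not_not.2 rfl), dif_pos hz, zero_add]
    · rcases eq_or_ne p y with rfl | hy
      · rw [dif_pos hx, dif_neg (not_not.2 rfl), add_zero]
        exact congrArg φ (OPair.toU_swap ⟨(x, p), hz⟩)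
      · rw [dif_pos hx, dif_pos hy]
        have h1 := congrFun h (OTri.mk p x y hx hz hy)
        rw [triMap_apply] at h1
        refine (eq_of_add_eq_zero_of_two h2 ?_).symm
        rw [← add_assoc]
        refine Eq.trans ?_ h1
        rw [add_comm (φ _) (φ _)]
        rfl
  · rintro ⟨⟨_, ψ, rfl⟩, rfl⟩
    exact triMap_edgeMap ρ h2 ψ

lemma hd_two_le_of_graph [Finite G] [FiniteDimensional F M] [Finite P] [Nonempty P]
    (hP : hd (funRep ρ P) 2 = 0)
    (hU : hd (funRep ρ (UPair P)) 1 ≤ hd (funRep ρ (UPair P)) 0) :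
    hd ρ 2 ≤ hd (rangeRep (edgeMap (P := P) ρ)) 0 + hd (rangeRep (triMap (P := P) ρ)) 0 := by
  have := Fintype.ofFinite P
  have h3 := hd_succ_le (constMap ρ P) (rangeMap (edgeMap (P := P) ρ))
    (fun x y h => congrFun h (Classical.arbitrary P)) (constMap_edgeMap_exact ρ h2)
    (rangeMap_surjective _) 1
  have h4 := hd_succ_le _ _ (rangeIncl_injective (edgeMap (P := P) ρ))
    (edgeMap_triMap_exact (P := P) ρ h2) (rangeMap_surjective _) 0
  have h5 := hd_range_add_le _ _ (rangeIncl_injective (edgeMap (P := P) ρ))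
    (edgeMap_triMap_exact (P := P) ρ h2) (rangeMap_surjective _) 0
  have h6 : hd ρ 2 ≤ hd (rangeRep (edgeMap (P := P) ρ)) 1 + hd (funRep ρ P) 2 :=
    le_trans (Nat.le_add_right _ _) h3
  simp only [zero_add] at h4
  omega

end Graph
lemma finrank_le_of_mem {F V M : Type} [Field F] [AddCommGroup V] [Module F V] [AddCommGroup M]
    [Module F M] [FiniteDimensional F M] (f : V →ₗ[F] M) (S : Submodule F M) (hS : ∀ v, f v ∈ S)
    (hf : ∀ v, f v = 0 → v = 0) : finrank F V ≤ finrank F S :=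
  LinearMap.finrank_le_finrank_of_injective (f := f.codRestrict S hS)
    ((injective_iff_map_eq_zero _).2 fun v hv => hf v (congrArg Subtype.val hv))

lemma odd_card_of_pow_eq_one {A : Type} [Group A] [Finite A] {k : ℕ} (hk : Odd k)
    (h : ∀ a : A, a ^ k = 1) : Odd (Nat.card A) := by
  rw [← Nat.not_even_iff_odd]
  intro he
  have : Fact (Nat.Prime 2) := ⟨Nat.prime_two⟩
  obtain ⟨g, hg⟩ := exists_prime_orderOf_dvd_card' 2 (even_iff_two_dvd.1 he)
  have := hg ▸ orderOf_dvd_of_pow_eq_one (h g)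
  exact Nat.not_even_iff_odd.2 hk (even_iff_two_dvd.2 this)

lemma funRep_fixed {F G M X : Type} [Field F] [Group G] [AddCommGroup M] [Module F M]
    [MulAction G X] {ρ : Representation F G M} {φ : X → M} (h : ∀ g, funRep ρ X g φ = φ) (g : G)
    (x : X) : φ (g • x) = ρ g (φ x) := by
  have := congrFun (h g) (g • x)
  rw [funRep_apply, inv_smul_smul] at this
  exact this.symm

section Symm

variable {G P F M : Type} [Group G] [MulAction G P] [DecidableEq P] [Field F] [AddCommGroup M]
  [Module F M] (ρ : Representation F G M) (ψ : UPair P → M) {z z' : OTri P}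

lemma triMap_eq_of_rotate (h : z'.1 = (z.1.2.1, z.1.2.2, z.1.1)) :
    triMap ρ ψ z' = triMap ρ ψ z := by
  obtain ⟨_, h'⟩ := z'
  subst h
  rw [triMap_apply, triMap_apply]
  have h1 : z.snd = OTri.fst ⟨_, h'⟩ := rfl
  have h2 : z.fst = OTri.thd ⟨_, h'⟩ := (OPair.toU_swap _).symm
  have h3 : z.thd = OTri.snd ⟨_, h'⟩ := (OPair.toU_swap _).symm
  rw [h1, h2, h3]
  abel

lemma triMap_eq_of_swap (h : z.1 = (z'.1.2.1, z'.1.1, z'.1.2.2)) :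
    triMap ρ ψ z = triMap ρ ψ z' := by
  obtain ⟨_, h'⟩ := z
  subst h
  rw [triMap_apply, triMap_apply]
  have h1 : z'.snd = OTri.thd ⟨_, h'⟩ := rfl
  have h2 : z'.fst = OTri.fst ⟨_, h'⟩ := (OPair.toU_swap _).symm
  have h3 : z'.thd = OTri.snd ⟨_, h'⟩ := rfl
  rw [h1, h2, h3]
  abel

end Symm

section Three

variable {K : Type} [Field K] [Fintype K] [DecidableEq K] {F : Type} [Field F] {M : Type}
  [AddCommGroup M] [Module F M] (ρ : Representation F (SL2 K) M)

omit [Fintype K] [DecidableEq K] in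
variable (K) in
/-- An element cyclically permuting the points `∞`, `0` and `1`. -/
def rot : SL2 K := wey * uni (-1)

omit [Fintype K] in
lemma rot_smul_infty : rot K • (∞ : OnePoint K) = ((0 : K) : OnePoint K) := by
  rw [rot, mul_smul, uni_smul_infty, wey_smul_infty]

omit [Fintype K] in
lemma rot_smul_zero : rot K • ((0 : K) : OnePoint K) = ((1 : K) : OnePoint K) := by
  rw [rot, mul_smul, uni_smul_coe, zero_add, wey_smul_coe _ (by simp)]
  simp

omit [Fintype K] in
lemma rot_smul_one : rot K • ((1 : K) : OnePoint K) = ∞ := by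
  rw [rot, mul_smul, uni_smul_coe, add_neg_cancel, wey_smul_zero]

/-- The operator `1 + r + r²`. -/
noncomputable def rotSum : M →ₗ[F] M :=
  LinearMap.id + ρ (rot K) + ρ (rot K) * ρ (rot K)

omit [Fintype K] [DecidableEq K] in
lemma rotSum_apply (m : M) :
    rotSum ρ m = m + ρ (rot K) m + ρ (rot K) (ρ (rot K) m) := rfl

omit [Field K] [Fintype K] [DecidableEq K] in
lemma coe_ne_coe {x y : K} (h : x ≠ y) : (x : OnePoint K) ≠ (y : OnePoint K) :=
  fun h1 => h (OnePoint.coe_injective h1)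

variable (K) in
/-- The triple `(∞, 0, 1)`. -/
def baseTri : OTri (OnePoint K) :=
  OTri.mk ∞ ((0 : K) : OnePoint K) ((1 : K) : OnePoint K) (infty_ne_coe 0)
    (coe_ne_coe zero_ne_one) (infty_ne_coe 1)

omit [Fintype K] in
lemma rot_smul_fst : rot K • (baseTri K).fst = (baseTri K).snd := by
  rw [← OTri.fst_smul]
  refine congrArg OPair.toU (Subtype.ext (Prod.ext ?_ ?_))
  · exact rot_smul_infty
  · exact rot_smul_zero

omit [Fintype K] in
lemma rot_smul_snd : rot K • (baseTri K).snd = (baseTri K).thd := by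
  rw [← OTri.snd_smul]
  refine (OPair.toU_swap _).symm.trans (congrArg OPair.toU (Subtype.ext (Prod.ext ?_ ?_)))
  · exact rot_smul_one
  · exact rot_smul_zero

variable [FiniteDimensional F M] (h2 : (2 : F) = 0)

include h2

omit [Fintype K] in
lemma hd_range_edgeMap_le :
    hd (rangeRep (edgeMap (P := OnePoint K) ρ)) 0 ≤ finrank F (LinearMap.ker (rotSum ρ)) := by
  rw [hd_zero]
  have key : ∀ x : (rangeRep (edgeMap (P := OnePoint K) ρ)).invariants,
      ∀ g, funRep ρ (UPair (OnePoint K)) g x.1.1 = x.1.1 := fun x g =>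
    congrArg Subtype.val (x.2 g)
  refine finrank_le_of_mem
    { toFun := fun x : (rangeRep (edgeMap (P := OnePoint K) ρ)).invariants =>
        x.1.1 (baseTri K).fst, map_add' := fun _ _ => rfl, map_smul' := fun _ _ => rfl }
    _ (fun x => ?_) fun x hx => ?_
  · rw [LinearMap.mem_ker]
    change rotSum ρ (x.1.1 (baseTri K).fst) = 0
    rw [rotSum_apply, ← funRep_fixed (key x), rot_smul_fst, ← funRep_fixed (key x), rot_smul_snd,
      ← triMap_apply ρ]
    obtain ⟨φ, hφ⟩ := x.1.2
    rw [← hφ]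
    exact congrFun (triMap_edgeMap ρ h2 φ) _
  · apply Subtype.ext
    apply Subtype.ext
    funext s
    obtain ⟨z, rfl⟩ := OPair.toU_surjective s
    obtain ⟨g, rfl⟩ := exists_smul_basePair z
    rw [OPair.toU_smul, funRep_fixed (key x)]
    change ρ g (x.1.1 (baseTri K).fst) = 0
    exact (congrArg (ρ g) hx).trans (map_zero _)

omit [FiniteDimensional F M] h2 in
lemma exists_smul_baseTri (hq3 : Fintype.card K % 4 = 3) (z : OTri (OnePoint K)) :
    ∃ g : SL2 K, z = g • baseTri K ∨ z.1 = ((g • baseTri K).1.2.1, (g • baseTri K).1.1,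
      (g • baseTri K).1.2.2) := by
  obtain ⟨⟨x, y, w⟩, hxy, hyw, hxw⟩ := z
  change x ≠ y at hxy
  change y ≠ w at hyw
  change x ≠ w at hxw
  obtain ⟨g, hg⟩ := exists_smul_basePair ⟨(x, y), hxy⟩
  have hgx : g • (∞ : OnePoint K) = x := congrArg (fun z : OPair (OnePoint K) => z.1.1) hg
  have hgy : g • ((0 : K) : OnePoint K) = y := congrArg (fun z : OPair (OnePoint K) => z.1.2) hg
  obtain ⟨c, hc⟩ := ne_infty_iff_exists.1
    (fun h => hxw (by rw [← hgx, ← h, smul_inv_smul]) : g⁻¹ • w ≠ ∞)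
  have hgc : g • (c : OnePoint K) = w := by rw [hc, smul_inv_smul]
  have hc0 : c ≠ 0 := fun h => hyw (by rw [← hgy, ← hgc, h])
  by_cases hsq : IsSquare c
  · obtain ⟨b, hb⟩ := hsq
    have hb0 : b ≠ 0 := fun h => hc0 (by rw [hb, h, zero_mul])
    refine ⟨g * tor (Units.mk0 b hb0), Or.inl ?_⟩
    refine Subtype.ext (Prod.ext ?_ (Prod.ext ?_ ?_))
    · change x = (g * tor (Units.mk0 b hb0)) • (∞ : OnePoint K)
      rw [mul_smul, tor_smul_infty, hgx]
    · change y = (g * tor (Units.mk0 b hb0)) • ((0 : K) : OnePoint K)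
      rw [mul_smul, tor_smul_coe, mul_zero, hgy]
    · change w = (g * tor (Units.mk0 b hb0)) • ((1 : K) : OnePoint K)
      rw [mul_smul, tor_smul_coe, mul_one, Units.val_mk0, pow_two, ← hb, hgc]
  · have hneg : IsSquare (-c) := by
      have hm : ¬ IsSquare (-1 : K) := fun h =>
        (FiniteField.isSquare_neg_one_iff.1 h) hq3
      refine (quadraticChar_one_iff_isSquare (neg_ne_zero.2 hc0)).1 ?_
      rw [neg_eq_neg_one_mul, map_mul, quadraticChar_neg_one_iff_not_isSquare.2 hm,
        quadraticChar_neg_one_iff_not_isSquare.2 hsq]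
      rfl
    obtain ⟨b, hb⟩ := hneg
    have hb0 : b ≠ 0 := fun h => hc0 (by rw [h, zero_mul, neg_eq_zero] at hb; exact hb)
    refine ⟨g * (tor (Units.mk0 b hb0) * wey), Or.inr ?_⟩
    refine Prod.ext ?_ (Prod.ext ?_ ?_)
    · change x = (g * (tor (Units.mk0 b hb0) * wey)) • ((0 : K) : OnePoint K)
      rw [mul_smul, mul_smul, wey_smul_zero, tor_smul_infty, hgx]
    · change y = (g * (tor (Units.mk0 b hb0) * wey)) • (∞ : OnePoint K)
      rw [mul_smul, mul_smul, wey_smul_infty, tor_smul_coe, mul_zero, hgy]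
    · change w = (g * (tor (Units.mk0 b hb0) * wey)) • ((1 : K) : OnePoint K)
      rw [mul_smul, mul_smul, wey_smul_coe _ one_ne_zero, tor_smul_coe, Units.val_mk0, pow_two,
        ← hb, inv_one, neg_mul_neg, mul_one, hgc]

lemma hd_range_triMap_le (hq3 : Fintype.card K % 4 = 3) :
    hd (rangeRep (triMap (P := OnePoint K) ρ)) 0 ≤ finrank F (LinearMap.range (rotSum ρ)) := by
  rw [hd_zero]
  have key : ∀ x : (rangeRep (triMap (P := OnePoint K) ρ)).invariants,
      ∀ g, funRep ρ (OTri (OnePoint K)) g x.1.1 = x.1.1 := fun x g =>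
    congrArg Subtype.val (x.2 g)
  refine finrank_le_of_mem
    { toFun := fun x : (rangeRep (triMap (P := OnePoint K) ρ)).invariants =>
        x.1.1 (baseTri K), map_add' := fun _ _ => rfl, map_smul' := fun _ _ => rfl }
    _ (fun x => ?_) fun x hx => ?_
  · obtain ⟨ψ, hψ⟩ := x.1.2
    have h3 : ρ (rot K) (x.1.1 (baseTri K)) = x.1.1 (baseTri K) := by
      rw [← funRep_fixed (key x), ← hψ]
      refine triMap_eq_of_rotate ρ ψ (Prod.ext ?_ (Prod.ext ?_ ?_))
      · exact rot_smul_infty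
      · exact rot_smul_zero
      · exact rot_smul_one
    refine ⟨x.1.1 (baseTri K), ?_⟩
    change rotSum ρ _ = x.1.1 (baseTri K)
    rw [rotSum_apply, h3, h3, add_self_eq_zero_of_two h2, zero_add]
  · obtain ⟨ψ, hψ⟩ := x.1.2
    have h0 : x.1.1 (baseTri K) = 0 := hx
    apply Subtype.ext
    apply Subtype.ext
    funext z
    obtain ⟨g, rfl | hg⟩ := exists_smul_baseTri hq3 z
    · rw [funRep_fixed (key x), h0, map_zero]
      rfl
    · have h3 : x.1.1 z = x.1.1 (g • baseTri K) := by
        rw [← hψ]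
        exact triMap_eq_of_swap ρ ψ hg
      rw [h3, funRep_fixed (key x), h0, map_zero]
      rfl

end Three
section Normalizer

variable {K : Type} [Field K] [DecidableEq K]

variable (K) in
/-- The stabilizer of the unordered pair `{∞, 0}`. -/
abbrev Nor : Subgroup (SL2 K) := MulAction.stabilizer (SL2 K) (basePair (K := K)).toU

lemma wey_smul_basePair : (wey : SL2 K) • basePair (K := K) = basePair.swap :=
  Subtype.ext (Prod.ext wey_smul_infty wey_smul_zero)

lemma wey_mem_Nor : (wey : SL2 K) ∈ Nor K := by
  rw [MulAction.mem_stabilizer_iff, ← OPair.toU_smul, wey_smul_basePair, OPair.toU_swap]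

lemma tor_mem_Nor (a : Kˣ) : tor a ∈ Nor K := by
  rw [MulAction.mem_stabilizer_iff, ← OPair.toU_smul, (mem_tor_range_iff _).1 ⟨a, rfl⟩]

lemma exists_eq_of_mem_Nor {g : SL2 K} (hg : g ∈ Nor K) :
    ∃ a, g = tor a ∨ g = wey * tor a := by
  rw [MulAction.mem_stabilizer_iff, ← OPair.toU_smul] at hg
  rcases OPair.toU_eq hg with h | h
  · obtain ⟨a, ha⟩ := (mem_tor_range_iff g).2 h
    exact ⟨a, Or.inl ha.symm⟩
  · rw [← wey_smul_basePair, ← inv_smul_eq_iff, ← mul_smul] at h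
    obtain ⟨a, ha⟩ := (mem_tor_range_iff _).2 h
    exact ⟨a, Or.inr (by rw [ha, mul_inv_cancel_left])⟩

instance : MulAction.IsPretransitive (SL2 K) (UPair (OnePoint K)) := ⟨fun x y => by
  obtain ⟨x, rfl⟩ := OPair.toU_surjective x
  obtain ⟨y, rfl⟩ := OPair.toU_surjective y
  obtain ⟨g, rfl⟩ := MulAction.exists_smul_eq (SL2 K) x y
  exact ⟨g, (OPair.toU_smul g x).symm⟩⟩

variable (K) in
/-- The subgroup of the torus of elements annihilated by `k`. -/
def torPow (k : ℕ) : Subgroup (Nor K) :=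
  ((powMonoidHom k : Kˣ →* Kˣ).ker.map tor).subgroupOf (Nor K)

lemma mem_torPow {k : ℕ} {n : Nor K} : n ∈ torPow K k ↔ ∃ a : Kˣ, a ^ k = 1 ∧ tor a = n.1 := by
  rw [torPow, Subgroup.mem_subgroupOf, Subgroup.mem_map]
  rfl

instance (k : ℕ) : (torPow K k).Normal := ⟨fun n hn g => by
  obtain ⟨a, ha, h⟩ := mem_torPow.1 hn
  obtain ⟨b, hb | hb⟩ := exists_eq_of_mem_Nor g.2
  · refine mem_torPow.2 ⟨a, ha, ?_⟩
    change _ = g.1 * n.1 * g.1⁻¹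
    rw [← h, hb, ← map_mul, mul_comm, map_mul, mul_inv_cancel_right]
  · refine mem_torPow.2 ⟨a⁻¹, by rw [inv_pow, ha, inv_one], ?_⟩
    change _ = g.1 * n.1 * g.1⁻¹
    rw [← h, hb, eq_mul_inv_iff_mul_eq, ← mul_assoc, ← wey_mul_tor, mul_assoc, mul_assoc, ← map_mul,
      ← map_mul, mul_comm]⟩

variable [Fintype K]

lemma odd_card_torPow {k : ℕ} (hk : Odd k) : Odd (Nat.card (torPow K k)) :=
  odd_card_of_pow_eq_one hk fun n => by
    obtain ⟨a, ha, h⟩ := mem_torPow.1 n.2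
    apply Subtype.ext
    apply Subtype.ext
    change n.1.1 ^ k = 1
    rw [← h, ← map_pow, ha, map_one]

omit [DecidableEq K] [Fintype K] in
lemma orderOf_wey (hK : (2 : K) ≠ 0) : orderOf (wey : SL2 K) = 4 := by
  have h1 : (wey : SL2 K) ^ 2 = tor (-1) := by rw [pow_two, wey_mul_wey]
  have : Fact (Nat.Prime 2) := ⟨Nat.prime_two⟩
  refine orderOf_eq_prime_pow (p := 2) (n := 1) (fun h => ?_) ?_
  · rw [pow_one, h1, ← map_one tor] at h
    have h3 := congrArg Units.val (tor_injective h)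
    rw [Units.val_neg, Units.val_one] at h3
    exact hK (by linear_combination -h3)
  · rw [show 2 ^ (1 + 1) = 2 * 2 by norm_num, pow_mul, h1, ← map_pow]
    simp

lemma card_Nor : Nat.card (Nor K) = 2 * (Fintype.card K - 1) := by
  have h1 := (Nor K).card_mul_index
  rw [MulAction.index_stabilizer_of_transitive, Set.powersetCard.card, card_onePoint, card_SL2,
    Nat.choose_two_right, Nat.add_sub_cancel] at h1
  have h3 := Nat.div_mul_cancel (Nat.even_mul_succ_self (Fintype.card K)).two_dvd
  rw [mul_comm (Fintype.card K + 1)] at h1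
  have h4 : 0 < Fintype.card K * (Fintype.card K + 1) / 2 :=
    Nat.pos_of_ne_zero fun h => by
      rw [h, zero_mul] at h3
      have : 0 < Fintype.card K := Fintype.card_pos
      exact (Nat.mul_pos this (Nat.succ_pos _)).ne h3
  refine Nat.eq_of_mul_eq_mul_right h4 (h1.trans ?_)
  generalize Fintype.card K * (Fintype.card K + 1) / 2 = c at h3
  rw [mul_right_comm, ← h3]
  ring

lemma odd_index_zpowers_wey (hq3 : Fintype.card K % 4 = 3) (hK : (2 : K) ≠ 0) :
    Odd (Subgroup.zpowers (⟨wey, wey_mem_Nor⟩ : Nor K)).index := by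
  have h1 := (Subgroup.zpowers (⟨wey, wey_mem_Nor⟩ : Nor K)).card_mul_index
  rw [Nat.card_zpowers, Subgroup.orderOf_mk, orderOf_wey hK, card_Nor] at h1
  rw [Nat.odd_iff]
  omega

variable {F : Type} [Field F] {M : Type} [AddCommGroup M] [Module F M] [FiniteDimensional F M]
  (ρ : Representation F (SL2 K) M) (h2 : (2 : F) = 0)

include h2

lemma hd_UPair_one_le (hq3 : Fintype.card K % 4 = 3) :
    hd (funRep ρ (UPair (OnePoint K))) 1 ≤ hd (funRep ρ (UPair (OnePoint K))) 0 := by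
  have hK : (2 : K) ≠ 0 := two_ne_zero_of_odd (by rw [Nat.odd_iff]; omega)
  obtain ⟨k, hk, hkq⟩ : ∃ k, Odd k ∧ Fintype.card K - 1 = k * 2 :=
    ⟨(Fintype.card K - 1) / 2, by rw [Nat.odd_iff]; omega, by omega⟩
  rw [hd_funRep ρ (Nor K) basePair.toU (fun g => MulAction.mem_stabilizer_iff),
    hd_funRep ρ (Nor K) basePair.toU (fun g => MulAction.mem_stabilizer_iff), hd_zero]
  set w : Nor K := ⟨wey, wey_mem_Nor⟩
  have h3 := hd_le_fixedSub (res ρ (Nor K)) (torPow K k)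
    (cast_ne_zero_of_odd h2 (odd_card_torPow hk)) 1
  refine h3.trans ?_
  set τ := (res ρ (Nor K)).subrepresentation (fixedSub (res ρ (Nor K)) (torPow K k))
    (fixedSub_le_comap (res ρ (Nor K)) (torPow K k))
  refine (hd_le_of_index τ (Subgroup.zpowers w)
    (cast_ne_zero_of_odd h2 (odd_index_zpowers_wey hq3 hK)) 1).trans ?_
  refine (hd_one_le_of_cyclic (res τ (Subgroup.zpowers w)) ⟨w, Subgroup.mem_zpowers w⟩ ?_).trans ?_
  · rintro ⟨_, n, rfl⟩
    exact ⟨n, rfl⟩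
  refine finrank_le_of_mem 
    { toFun := fun x : (res τ (Subgroup.zpowers w)).invariants => x.1.1
      map_add' := fun _ _ => rfl
      map_smul' := fun _ _ => rfl } _ (fun x => ?_)
    fun x hx => Subtype.ext (Subtype.ext hx)
  change x.1.1 ∈ _
  have hw : ρ wey x.1.1 = x.1.1 := congrArg Subtype.val (x.2 ⟨w, Subgroup.mem_zpowers w⟩)
  have ht : ∀ a : Kˣ, a ^ k = 1 → ρ (tor a) x.1.1 = x.1.1 := fun a ha =>
    x.1.2 ⟨tor a, tor_mem_Nor a⟩ (mem_torPow.2 ⟨a, ha, rfl⟩)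
  have hm1 : ρ (tor (-1)) x.1.1 = x.1.1 := by
    rw [← wey_mul_wey, map_mul, Module.End.mul_apply, hw, hw]
  have hta : ∀ a : Kˣ, ρ (tor a) x.1.1 = x.1.1 := fun a => by
    have h5 : (a ^ k) ^ 2 = 1 := by
      rw [← pow_mul, ← hkq, ← Fintype.card_units, pow_card_eq_one]
    have h6 : a ^ k = 1 ∨ a ^ k = -1 := by
      rcases sq_eq_one_iff.1 (congrArg Units.val h5 : (a ^ k : Kˣ).val ^ 2 = 1) with h | h
      · exact Or.inl (Units.ext h)
      · exact Or.inr (Units.ext h)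
    rcases h6 with h6 | h6
    · exact ht a h6
    · have h7 := ht (-a) (by rw [hk.neg_pow, h6, neg_neg])
      rw [← neg_neg a, ← neg_one_mul (-a), map_mul, map_mul, Module.End.mul_apply, h7, hm1]
  intro g
  obtain ⟨a, ha | ha⟩ := exists_eq_of_mem_Nor g.2
  · change ρ g.1 _ = _
    rw [ha, hta]
  · change ρ g.1 _ = _
    rw [ha, map_mul, Module.End.mul_apply, hta, hw]

lemma hd_two_le_of_card_mod_four_eq_three (hq3 : Fintype.card K % 4 = 3)
    (hirr : ∀ W : Submodule F M, (∀ g, W ≤ W.comap (ρ g)) → W = ⊥ ∨ W = ⊤)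
    (hnt : ∃ g m, ρ g m ≠ m) : hd ρ 2 ≤ finrank F M := by
  have hq : Odd (Fintype.card K) := by rw [Nat.odd_iff]; omega
  have h3 := hd_two_le_of_graph (P := OnePoint K) ρ h2
    ((hd_onePoint ρ 2).trans (hd_Bor_eq_zero ρ h2 hq hirr hnt 2)) (hd_UPair_one_le ρ h2 hq3)
  have h4 := hd_range_edgeMap_le ρ h2
  have h5 := hd_range_triMap_le ρ h2 hq3
  have h6 := (rotSum ρ).finrank_range_add_finrank_ker
  omega

end Normalizer
section TrivialAction

variable {F G : Type} [Field F] [Group G] {M : Type} [AddCommGroup M] [Module F M]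
  (ρ : Representation F G M) (htriv : ∀ g m, ρ g m = m)

include htriv

lemma hd_one_of_trivial : hd ρ 1 = finrank F (Additive G →+ M) := by
  have : ρ.IsTrivial := ⟨fun g => LinearMap.ext (htriv g)⟩
  exact (groupCohomology.H1IsoOfIsTrivial (Rep.of ρ)).toLinearEquiv.finrank_eq

lemma hd_zero_of_trivial : hd ρ 0 = finrank F M := by
  rw [hd_zero, (Submodule.eq_top_iff'.2 fun m g => htriv g m :
    ρ.invariants = ⊤), finrank_top]

lemma hd_one_of_trivial_of_perfect (hG : commutator G = ⊤) : hd ρ 1 = 0 := by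
  rw [hd_one_of_trivial ρ htriv]
  have : Subsingleton (Additive G →+ M) := ⟨fun f f' => by
    suffices h : ∀ f : Additive G →+ M, f = 0 by rw [h f, h f']
    intro f
    have h1 : commutator G ≤ (AddMonoidHom.toMultiplicativeRight f).ker :=
      Abelianization.commutator_subset_ker _
    ext g
    exact h1 (hG ▸ Subgroup.mem_top (Additive.toMul g))⟩
  exact finrank_zero_of_subsingleton

lemma le_hd_one_of_trivial [Finite G] [FiniteDimensional F M] (χ : Additive G →+ F) (hχ : χ ≠ 0) :
    finrank F M ≤ hd ρ 1 := by
  rw [hd_one_of_trivial ρ htriv]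
  have : ρ.IsTrivial := ⟨fun g => LinearMap.ext (htriv g)⟩
  have : Module.Finite F (Additive G →+ M) :=
    Module.Finite.equiv (M := H ρ 1) (groupCohomology.H1IsoOfIsTrivial (Rep.of ρ)).toLinearEquiv
  obtain ⟨g, hg⟩ := DFunLike.ne_iff.1 hχ
  exact LinearMap.finrank_le_finrank_of_injective
    (f := { toFun := fun m => (LinearMap.toSpanSingleton F M m).toAddMonoidHom.comp χ
            map_add' := fun x y => by ext; simp
            map_smul' := fun c x => AddMonoidHom.ext fun g => smul_comm (χ g) c x : M →ₗ[F] (Additive G →+ M) })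
    ((injective_iff_map_eq_zero _).2 fun m hm => by
      have h1 : χ g • m = 0 := DFunLike.congr_fun hm g
      exact (smul_eq_zero.1 h1).resolve_left hg)

end TrivialAction

section Diff

variable {F G P : Type} [Field F] [Group G] [MulAction G P] {M : Type} [AddCommGroup M]
  [Module F M] (ρ : Representation F G M)

/-- The differences of the values of a function. -/
def diffMap : (funRep ρ P).IntertwiningMap (funRep ρ (P × P)) where
  toFun φ z := φ z.1 - φ z.2
  map_add' φ ψ := by
    funext z
    simp only [Pi.add_apply]
    abel
  map_smul' c φ := by
    funext z
    simp [smul_sub]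
  isIntertwining' g := by
    ext φ z
    simp

lemma diffMap_apply (φ : P → M) (x y : P) : diffMap ρ φ (x, y) = φ x - φ y := rfl

lemma constMap_injective [Nonempty P] : Function.Injective (constMap ρ P) := fun _ _ h => by
  obtain ⟨x⟩ := ‹Nonempty P›
  exact congrFun h x

lemma constMap_diffMap_exact [Nonempty P] :
    Function.Exact (constMap ρ P) (rangeMap (diffMap (P := P) ρ)) := fun φ => by
  rw [rangeMap_eq_zero]
  constructor
  · intro h
    obtain ⟨x⟩ := ‹Nonempty P›
    exact ⟨φ x, funext fun y => sub_eq_zero.1 (congrFun h (x, y))⟩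
  · rintro ⟨m, rfl⟩
    funext z
    exact sub_self m

lemma range_diffMap_triangle {ψ : P × P → M} (hψ : ψ ∈ LinearMap.range (diffMap ρ).toLinearMap)
    (x y z : P) : ψ (x, y) = ψ (x, z) - ψ (y, z) := by
  obtain ⟨φ, rfl⟩ := hψ
  change φ x - φ y = (φ x - φ z) - (φ y - φ z)
  abel

variable [Fintype P]

/-- The sum of the values of a function with given differences, when the number of points
vanishes in the field. -/
def diffSum (p : P) (hP : (Fintype.card P : F) = 0) :
    (rangeRep (diffMap (P := P) ρ)).IntertwiningMap ρ where
  toFun ψ := ∑ x, ψ.1 (x, p)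
  map_add' _ _ := Finset.sum_add_distrib
  map_smul' c ψ := by
    rw [RingHom.id_apply, Finset.smul_sum]
    rfl
  isIntertwining' g := by
    ext ⟨ψ, φ, rfl⟩
    have key : ∀ φ : P → M, ∑ x, diffMap ρ φ (x, p) = ∑ x, φ x := fun φ => by
      simp only [diffMap_apply]
      rw [Finset.sum_sub_distrib, Finset.sum_const, Finset.card_univ, ← Nat.cast_smul_eq_nsmul F,
        hP, zero_smul, sub_zero]
    change ∑ x, funRep ρ (P × P) g (diffMap ρ φ) (x, p) = ρ g (∑ x, diffMap ρ φ (x, p))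
    rw [← Representation.IntertwiningMap.isIntertwining, key, key]
    exact (Representation.IntertwiningMap.isIntertwining _ _ (sumMap ρ) g φ)

lemma diffSum_surjective [Nontrivial P] (p : P) (hP : (Fintype.card P : F) = 0) :
    Function.Surjective (diffSum ρ p hP) := fun m => by
  classical
  obtain ⟨y, hy⟩ := exists_ne p
  refine ⟨⟨_, Pi.single y m, rfl⟩, ?_⟩
  change ∑ x, ((Pi.single y m : P → M) x - (Pi.single y m : P → M) p) = m
  simp [Pi.single_apply, hy.symm]

end Diff

section Kernel

variable {F G : Type} [Field F] [Group G] {M₁ M₂ : Type} [AddCommGroup M₁] [Module F M₁]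
  [AddCommGroup M₂] [Module F M₂] {ρ₁ : Representation F G M₁} {ρ₂ : Representation F G M₂}
  (f : ρ₁.IntertwiningMap ρ₂)

lemma ker_le_comap (g : G) :
    LinearMap.ker f.toLinearMap ≤ (LinearMap.ker f.toLinearMap).comap (ρ₁ g) := fun x hx => by
  change f (ρ₁ g x) = 0
  rw [Representation.IntertwiningMap.isIntertwining, (show f x = 0 from hx), map_zero]

/-- The kernel of an intertwining map. -/
def kerRep : Representation F G (LinearMap.ker f.toLinearMap) :=
  ρ₁.subrepresentation _ (ker_le_comap f)

/-- The inclusion of the kernel of an intertwining map. -/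
def kerIncl : (kerRep f).IntertwiningMap ρ₁ := subMap ρ₁ _ (ker_le_comap f)

lemma kerIncl_injective : Function.Injective (kerIncl f) := Subtype.val_injective

lemma kerIncl_exact : Function.Exact (kerIncl f) f := fun x =>
  ⟨fun h => ⟨⟨x, h⟩, rfl⟩, by rintro ⟨y, rfl⟩; exact y.2⟩

end Kernel

section Line

variable {K : Type} [Field K] [Fintype K] [DecidableEq K] {F : Type} [Field F] {M : Type}
  [AddCommGroup M] [Module F M] [FiniteDimensional F M] (ρ : Representation F (SL2 K) M)
  (h2 : (2 : F) = 0) (hq : Odd (Fintype.card K))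

include hq h2

lemma hd_Bor_two_le {V : Type} [AddCommGroup V] [Module F V] [FiniteDimensional F V]
    (τ : Representation F (Bor K) V) : hd τ 2 ≤ finrank F V := by
  obtain ⟨a, ha⟩ := IsCyclic.exists_generator (α := Kˣ)
  let t : Bor K := ⟨tor a, tor_mem_Bor a⟩
  have hindex : (Subgroup.zpowers t).index = Fintype.card K := by
    have h1 := (Subgroup.zpowers t).card_mul_index
    rw [Nat.card_zpowers, Subgroup.orderOf_mk, orderOf_injective _ tor_injective,
      orderOf_eq_card_of_forall_mem_zpowers ha, Nat.card_units, Nat.card_eq_fintype_card, card_Bor,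
      mul_comm (Fintype.card K)] at h1
    have := two_le_card (K := K)
    exact Nat.eq_of_mul_eq_mul_left (by omega) h1
  refine (hd_le_of_index τ (Subgroup.zpowers t) (by
    rw [hindex]; exact cast_ne_zero_of_odd h2 hq) 2).trans
    (hd_two_le_of_cyclic _ ⟨t, Subgroup.mem_zpowers t⟩ ?_)
  rintro ⟨_, n, rfl⟩
  exact ⟨n, rfl⟩

lemma exists_Bor_character : ∃ χ : Additive (Bor K) →+ F, χ ≠ 0 := by
  have hK : ringChar K ≠ 2 := fun h => by
    have := FiniteField.even_card_of_char_two h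
    rw [Nat.odd_iff] at hq
    omega
  have hχ : ∀ a b : Kˣ, (if IsSquare ((a * b : Kˣ) : K) then (0 : F) else 1) =
      (if IsSquare (a : K) then (0 : F) else 1) + (if IsSquare (b : K) then (0 : F) else 1) := by
    intro a b
    have h1 : ∀ a : Kˣ, IsSquare (a : K) ↔ quadraticChar K (a : K) = 1 := fun a =>
      (quadraticChar_one_iff_isSquare a.ne_zero).symm
    have h3 := h1 (a * b)
    rw [Units.val_mul, map_mul] at h3
    rw [Units.val_mul]
    simp only [h1, h3]
    rcases quadraticChar_dichotomy a.ne_zero with h | h <;>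
    rcases quadraticChar_dichotomy b.ne_zero with h' | h' <;> simp [h, h', one_add_one_eq_two, h2]
  refine ⟨{ toFun := fun b => if IsSquare (BorChar K b.toMul : K) then (0 : F) else 1
            map_zero' := ?_
            map_add' := fun x y => ?_ }, ?_⟩
  · rw [toMul_zero, map_one, if_pos (by simp)]
  · rw [toMul_add, map_mul]
    exact hχ _ _
  · obtain ⟨c, hc⟩ := FiniteField.exists_nonsquare hK
    have hc0 : c ≠ 0 := fun h => hc (by simp [h])
    intro h
    have hB := tor_mem_Bor (Units.mk0 c hc0)
    have h3 := DFunLike.congr_fun h (Additive.ofMul ⟨tor (Units.mk0 c hc0), hB⟩)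
    have h4 : BorChar K ⟨tor (Units.mk0 c hc0), hB⟩ = Units.mk0 c hc0 := by
      have := BorChar_apply 0 (Units.mk0 c hc0) (by rw [uni_zero, one_mul]; exact hB)
      simpa [uni_zero] using this
    change (if IsSquare (BorChar K ⟨tor (Units.mk0 c hc0), hB⟩ : K) then (0 : F) else 1) = 0 at h3
    rw [h4, if_neg (by simpa using hc)] at h3
    exact one_ne_zero h3

variable (htriv : ∀ g m, ρ g m = m) (hP : (Fintype.card (OnePoint K) : F) = 0)

variable {V : Type} [AddCommGroup V] [Module F V] (τ : Representation F (SL2 K) V)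
  (i : τ.IntertwiningMap (rangeRep (diffMap (P := OnePoint K) ρ))) (hi : Function.Injective i)
  (hex : ∀ v, diffSum ρ (∞ : OnePoint K) hP (i v) = 0)

include htriv hi hex

omit [FiniteDimensional F M] in
lemma ker_diffSum_eq_zero_of_uni
    (v : V) (hv : ∀ x, τ (uni x) v = v) : v = 0 := by
  have h1 : ∀ x : K, (i v).1 ((x : OnePoint K), ∞) = (i v).1 (((0 : K) : OnePoint K), ∞) := fun x => by
    have h3 := congrFun (congrArg (fun w => (i w).1) (hv x)) ((x : OnePoint K), ∞)
    rw [Representation.IntertwiningMap.isIntertwining] at h3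
    change ρ (uni x) ((i v).1 ((uni x)⁻¹ • ((x : OnePoint K), (∞ : OnePoint K)))) = _ at h3
    rw [htriv, Prod.smul_mk, inv_smul_eq_iff.2 (uni_smul_infty x).symm,
      inv_smul_eq_iff.2 (show (x : OnePoint K) = uni x • ((0 : K) : OnePoint K) by simp)] at h3
    exact h3.symm
  have h0 : (i v).1 ((∞ : OnePoint K), ∞) = 0 := by
    rw [range_diffMap_triangle ρ (i v).2 ∞ ∞ ∞, sub_self]
  have hs : ∑ x, (i v).1 (x, (∞ : OnePoint K)) = 0 := hex v
  rw [sum_onePoint, h0, zero_add, Finset.sum_congr rfl fun x _ => h1 x, Finset.sum_const,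
    Finset.card_univ, ← Nat.cast_smul_eq_nsmul F, card_cast_eq_one h2 hq, one_smul] at hs
  have h3 : ∀ x : OnePoint K, (i v).1 (x, ∞) = 0 := fun x => by
    induction x using OnePoint.rec with
    | infty => exact h0
    | coe x => rw [h1, hs]
  refine hi (Subtype.ext (funext fun z => ?_))
  rw [map_zero]
  exact (range_diffMap_triangle ρ (i v).2 z.1 z.2 ∞).trans (by rw [h3, h3, sub_self]; rfl)

omit h2 in
lemma finrank_tor_invariants_le :
    finrank F (res τ (tor (K := K)).range).invariants ≤ 2 * finrank F M := by
  have hK : ringChar K ≠ 2 := fun h => by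
    have := FiniteField.even_card_of_char_two h
    rw [Nat.odd_iff] at hq
    omega
  obtain ⟨c, hc⟩ := FiniteField.exists_nonsquare hK
  have hc0 : c ≠ 0 := fun h => hc (by simp [h])
  rw [two_mul, ← Module.finrank_prod (R := F)]
  refine LinearMap.finrank_le_finrank_of_injective (f :=
    ({ toFun := fun v => ((i v.1).1 (((1 : K) : OnePoint K), ∞), (i v.1).1 ((c : OnePoint K), ∞))
       map_add' := fun x y => by rw [Submodule.coe_add, map_add]; rfl
       map_smul' := fun c x => by rw [Submodule.coe_smul, _root_.map_smul]; rfl } :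
       (res τ (tor (K := K)).range).invariants →ₗ[F] M × M))
    ((injective_iff_map_eq_zero _).2 fun v hv => ?_)
  have hv1 : (i v.1).1 (((1 : K) : OnePoint K), ∞) = 0 := congrArg Prod.fst hv
  have hvc : (i v.1).1 ((c : OnePoint K), ∞) = 0 := congrArg Prod.snd hv
  have ht : ∀ (a : Kˣ) (x : K), (i v.1).1 (((a ^ 2 * x : K) : OnePoint K), ∞) =
      (i v.1).1 ((x : OnePoint K), ∞) := fun a x => by
    have h3 := congrFun (congrArg (fun w => (i w).1) (v.2 ⟨tor a, a, rfl⟩))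
      (((a ^ 2 * x : K) : OnePoint K), ∞)
    change (i (τ (tor a) v.1)).1 _ = _ at h3
    rw [Representation.IntertwiningMap.isIntertwining] at h3
    change ρ (tor a) ((i v.1).1 ((tor a)⁻¹ • (((a ^ 2 * x : K) : OnePoint K), (∞ : OnePoint K)))) = _
      at h3
    rw [htriv, Prod.smul_mk, inv_smul_eq_iff.2 (tor_smul_infty a).symm,
      inv_smul_eq_iff.2 (show _ = tor a • (x : OnePoint K) by simp)] at h3
    exact h3.symm
  have hne : ∀ x : K, x ≠ 0 → (i v.1).1 ((x : OnePoint K), ∞) = 0 := fun x hx => by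
    by_cases hsq : IsSquare x
    · obtain ⟨b, hb⟩ := hsq
      have hb0 : b ≠ 0 := fun h => hx (by rw [hb, h, zero_mul])
      have h3 := ht (Units.mk0 b hb0) 1
      rwa [Units.val_mk0, mul_one, pow_two, ← hb, hv1] at h3
    · have hsq' : IsSquare (x / c) := by
        refine (quadraticChar_one_iff_isSquare (div_ne_zero hx hc0)).1 ?_
        have h4 := quadraticChar_neg_one_iff_not_isSquare.2 hsq
        rw [← div_mul_cancel₀ x hc0, map_mul, quadraticChar_neg_one_iff_not_isSquare.2 hc] at h4
        linarith
      obtain ⟨b, hb⟩ := hsq'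
      have hb0 : b ≠ 0 := fun h => hx (by rw [h, zero_mul, div_eq_zero_iff] at hb; tauto)
      have h3 := ht (Units.mk0 b hb0) c
      rwa [Units.val_mk0, pow_two, ← hb, div_mul_cancel₀ x hc0, hvc] at h3
  have h0 : (i v.1).1 ((∞ : OnePoint K), ∞) = 0 := by
    rw [range_diffMap_triangle ρ (i v.1).2 ∞ ∞ ∞, sub_self]
  have hs : ∑ x, (i v.1).1 (x, (∞ : OnePoint K)) = 0 := hex v.1
  rw [sum_onePoint, h0, zero_add, Finset.sum_eq_single (0 : K) (fun x _ hx => hne x hx)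
    (fun h => (h (Finset.mem_univ _)).elim)] at hs
  have h3 : ∀ x : OnePoint K, (i v.1).1 (x, ∞) = 0 := fun x => by
    induction x using OnePoint.rec with
    | infty => exact h0
    | coe x =>
      rcases eq_or_ne x 0 with rfl | hx
      · exact hs
      · exact hne x hx
  refine Subtype.ext (hi (Subtype.ext (funext fun z => ?_)))
  rw [ZeroMemClass.coe_zero, map_zero]
  exact (range_diffMap_triangle ρ (i v.1).2 z.1 z.2 ∞).trans (by rw [h3, h3, sub_self]; rfl)

omit [Fintype K] htriv h2 hq hi hex in
lemma hd_range_diffMap_le {V : Type} [AddCommGroup V] [Module F V] [FiniteDimensional F V]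
    (τ : Representation F (SL2 K) V) : hd (rangeRep (diffMap (P := OnePoint K) τ)) 0 ≤
      finrank F (res τ (tor (K := K)).range).invariants := by
  rw [hd_zero]
  have key : ∀ x : (rangeRep (diffMap (P := OnePoint K) τ)).invariants,
      ∀ g, funRep τ (OnePoint K × OnePoint K) g x.1.1 = x.1.1 := fun x g =>
    congrArg Subtype.val (x.2 g)
  refine finrank_le_of_mem
    { toFun := fun x : (rangeRep (diffMap (P := OnePoint K) τ)).invariants =>
        x.1.1 ((basePair (K := K)).1.1, (basePair (K := K)).1.2)
      map_add' := fun _ _ => rfl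
      map_smul' := fun _ _ => rfl } _ (fun x => ?_) fun x hx => ?_
  · rintro ⟨_, a, rfl⟩
    change τ (tor a) (x.1.1 (∞, ((0 : K) : OnePoint K))) = x.1.1 (∞, ((0 : K) : OnePoint K))
    rw [← funRep_fixed (key x), Prod.smul_mk, tor_smul_infty, tor_smul_coe, mul_zero]
  · have h0 : x.1.1 ((basePair (K := K)).1.1, (basePair (K := K)).1.2) = 0 := hx
    refine Subtype.ext (Subtype.ext (funext fun z => ?_))
    change x.1.1 z = 0
    by_cases hz : z.1 = z.2
    · rw [← Prod.mk.eta (p := z), hz, range_diffMap_triangle τ x.1.2 z.2 z.2 z.2, sub_self]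
    · obtain ⟨g, hg⟩ := exists_smul_basePair ⟨z, hz⟩
      have h3 : z = g • ((basePair (K := K)).1.1, (basePair (K := K)).1.2) :=
        (congrArg Subtype.val hg).symm
      rw [h3, funRep_fixed (key x), h0, map_zero]

omit hex in
lemma hd_two_le_of_trivial_of_exact (hq5 : 4 ≤ Fintype.card K)
    (hex' : Function.Exact i (diffSum ρ (∞ : OnePoint K) hP)) : hd ρ 2 ≤ finrank F M := by
  have hex := hex'.apply_apply_eq_zero
  have : FiniteDimensional F V := Module.Finite.of_injective i.toLinearMap hi
  have hperf : commutator (SL2 K) = ⊤ := by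
    obtain ⟨a, ha0, ha⟩ : ∃ a : K, a ≠ 0 ∧ a ^ 2 ≠ 1 := by
      by_contra! h
      have h1 : (Finset.univ : Finset K) ⊆ {0, 1, -1} := fun a _ => by
        by_cases ha : a = 0
        · simp [ha]
        · rcases sq_eq_one_iff.1 (h a ha) with h | h <;> simp [h]
      have := (Finset.card_le_card h1).trans Finset.card_le_three
      rw [Finset.card_univ] at this
      omega
    exact Matrix.SL2.commutator_eq_top ha0 ha
  have : Nontrivial (OnePoint K) := ⟨∞, ((0 : K) : OnePoint K), infty_ne_coe 0⟩
  have h1 : hd ρ 1 = 0 := hd_one_of_trivial_of_perfect ρ htriv hperf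
  have h0 : hd ρ 0 = finrank F M := hd_zero_of_trivial ρ htriv
  have hB : ∀ g m, res ρ (Bor K) g m = m := fun g m => htriv g.1 m
  have hF0 : hd (funRep ρ (OnePoint K)) 0 = finrank F M := by
    rw [hd_onePoint, hd_zero_of_trivial _ hB]
  have hF1 : finrank F M ≤ hd (funRep ρ (OnePoint K)) 1 := by
    obtain ⟨χ, hχ⟩ := exists_Bor_character (K := K) h2 hq
    rw [hd_onePoint]
    exact le_hd_one_of_trivial _ hB χ hχ
  have hF2 : hd (funRep ρ (OnePoint K)) 2 ≤ finrank F M := by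
    rw [hd_onePoint]
    exact hd_Bor_two_le h2 hq _
  have e1 := hd_succ_le _ _ (constMap_injective ρ) (constMap_diffMap_exact (P := OnePoint K) ρ)
    (rangeMap_surjective _) 1
  have e2 := hd_range_add_le _ _ (constMap_injective ρ) (constMap_diffMap_exact (P := OnePoint K) ρ)
    (rangeMap_surjective _) 1
  have e3 := hd_zero_add_le _ _ (constMap_injective ρ) (constMap_diffMap_exact (P := OnePoint K) ρ)
    (rangeMap_surjective _)
  have e4 := hd_add_hd_succ_le _ _ hi hex'
    (diffSum_surjective ρ (∞ : OnePoint K) hP) 0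
  have e5 := hd_succ_le _ _ (constMap_injective τ) (constMap_diffMap_exact (P := OnePoint K) τ)
    (rangeMap_surjective _) 0
  have e6 : hd (funRep τ (OnePoint K)) 1 = 0 := by
    rw [hd_onePoint]
    refine hd_eq_zero_of_fixed (res τ (Bor K)) ((powMonoidHom 1).comp (BorChar K)).ker
      (cast_ne_zero_of_odd h2 (odd_ker_BorChar_pow hq 1 odd_one)) (fun v hv => ?_) 1
    refine ker_diffSum_eq_zero_of_uni ρ h2 hq htriv hP τ i hi hex v fun x => ?_
    refine hv ⟨uni x, uni_mem_Bor x⟩ ?_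
    have h3 := BorChar_apply x 1 (by simpa using uni_mem_Bor x)
    simp only [map_one, mul_one] at h3
    rw [MonoidHom.mem_ker, MonoidHom.comp_apply, h3, map_one]
  have e7 := hd_range_diffMap_le τ
  have e8 := finrank_tor_invariants_le ρ hq htriv hP τ i hi hex
  simp only [zero_add, Nat.reduceAdd] at *
  omega

omit hi hex in
/-- The bound for trivial modules in characteristic two and odd `q`. -/
lemma hd_two_le_of_trivial (hq5 : 4 ≤ Fintype.card K) : hd ρ 2 ≤ finrank F M := by
  have hP : (Fintype.card (OnePoint K) : F) = 0 := by
    rw [← Nat.card_eq_fintype_card, card_onePoint, Nat.cast_add, card_cast_eq_one h2 hq,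
      Nat.cast_one, one_add_one_eq_two, h2]
  exact hd_two_le_of_trivial_of_exact ρ h2 hq htriv hP _ _ (kerIncl_injective _) hq5
    (kerIncl_exact (diffSum ρ (∞ : OnePoint K) hP))

end Line

section CharTwo

/-- The bound in characteristic two for odd `q`. -/
theorem hd_two_le_of_two_eq_zero {K : Type} [Field K] [Fintype K] [DecidableEq K] {F : Type}
    [Field F] {M : Type} [AddCommGroup M] [Module F M] [FiniteDimensional F M]
    (ρ : Representation F (SL2 K) M) (h2 : (2 : F) = 0) (hq : Odd (Fintype.card K))
    (hq4 : 4 ≤ Fintype.card K) : hd ρ 2 ≤ finrank F M := by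
  refine hd_two_le_of_irreducible (fun M _ _ _ _ ρ hirr => ?_) ρ
  by_cases hnt : ∃ g m, ρ g m ≠ m
  · have : Fintype.card K % 4 = 1 ∨ Fintype.card K % 4 = 3 := by
      rw [Nat.odd_iff] at hq
      omega
    rcases this with h | h
    · exact hd_two_le_of_card_mod_four_eq_one ρ h2 hq hirr hnt h
    · exact hd_two_le_of_card_mod_four_eq_three ρ h2 h hirr hnt
  · push Not at hnt
    exact hd_two_le_of_trivial ρ h2 hq hnt hq4

end CharTwo

section Exponents

variable {p : ℕ}

lemma pow_add_pow_ne_pow (hp : 2 ≤ p) {k l m : ℕ} (hkl : k < l) : p ^ k + p ^ l ≠ p ^ m := fun h => by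
  have h1 : p ^ k < p ^ l := Nat.pow_lt_pow_right (by omega) hkl
  have h2 : 0 < p ^ k := pow_pos (by omega) k
  have h3 : l < m := (Nat.pow_lt_pow_iff_right (show 1 < p by omega)).1 (by omega)
  have h4 : p ^ (l + 1) ≤ p ^ m := Nat.pow_le_pow_right (by omega) h3
  have h5 : p ^ l * 2 ≤ p ^ l * p := Nat.mul_le_mul_left _ hp
  rw [pow_succ] at h4
  omega

lemma pow_add_pow_max_le (hp : 2 ≤ p) {k l m n : ℕ} (hkl : k ≤ l)
    (h : p ^ m + p ^ n = p ^ k + p ^ l) : n ≤ l := by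
  by_contra! hln
  have h1 : p ^ k ≤ p ^ l := Nat.pow_le_pow_right (by omega) hkl
  have h2 : 0 < p ^ m := pow_pos (by omega) m
  have h4 : p ^ (l + 1) ≤ p ^ n := Nat.pow_le_pow_right (by omega) hln
  have h5 : p ^ l * 2 ≤ p ^ l * p := Nat.mul_le_mul_left _ hp
  rw [pow_succ] at h4
  omega

lemma pow_add_pow_injective (hp : 2 ≤ p) {k l m n : ℕ} (hkl : k ≤ l) (hmn : m ≤ n)
    (h : p ^ m + p ^ n = p ^ k + p ^ l) : m = k ∧ n = l := by
  obtain rfl := le_antisymm (pow_add_pow_max_le hp hkl h) (pow_add_pow_max_le hp hmn h.symm)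
  exact ⟨Nat.pow_right_injective hp (Nat.add_right_cancel h), rfl⟩

variable {K : Type} [Field K] [Fintype K]

lemma dvd_sub_of_forall_pow_eq {n m : ℕ} (h : ∀ a : Kˣ, a ^ n = a ^ m) :
    ((Fintype.card K : ℤ) - 1) ∣ n - m := by
  obtain ⟨a, ha⟩ := IsCyclic.exists_generator (α := Kˣ)
  have h1 := (pow_eq_pow_iff_modEq.1 (h a)).dvd
  rw [orderOf_eq_card_of_forall_mem_zpowers ha, Nat.card_units, Nat.card_eq_fintype_card,
    Nat.cast_sub Fintype.card_pos, Nat.cast_one] at h1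
  rw [← neg_sub (m : ℤ), dvd_neg]
  exact h1

lemma eq_of_forall_pow_eq_of_le {n m : ℕ} (hn0 : 0 < n) (hm0 : 0 < m) (hn : 2 * n ≤ Fintype.card K) (hm : 2 * m ≤ Fintype.card K)
    (h : ∀ a : Kˣ, a ^ (2 * n) = a ^ (2 * m)) : n = m := by
  have h1 := Int.eq_zero_of_abs_lt_dvd (dvd_sub_of_forall_pow_eq h) (by
    rw [abs_lt]
    push_cast
    omega)
  omega

lemma eq_of_forall_pow_eq_of_even (hq : Even (Fintype.card K)) {n m : ℕ}
    (hnm : n < m + (Fintype.card K - 1)) (hmn : m < n + (Fintype.card K - 1))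
    (h : ∀ a : Kˣ, a ^ (2 * n) = a ^ (2 * m)) : n = m := by
  have h0 := two_le_card (K := K)
  have h2 := dvd_sub_of_forall_pow_eq h
  rw [Nat.cast_mul, Nat.cast_mul, ← mul_sub] at h2
  have h3 : IsCoprime ((Fintype.card K : ℤ) - 1) ((2 : ℕ) : ℤ) := by
    obtain ⟨k, hk⟩ := hq
    refine ⟨-1, k, ?_⟩
    rw [hk]
    push_cast
    ring
  have h1 := Int.eq_zero_of_abs_lt_dvd (h3.dvd_of_dvd_mul_left h2) (by
    rw [abs_lt]
    omega)
  omega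

variable [hpp : Fact p.Prime] {e : ℕ} (hK : Fintype.card K = p ^ e)

include hpp hK

lemma pow_add_pow_eq_of_forall {k l m n : ℕ} (hkl : k < l) (hl : l < e) (hmn : m ≤ n) (hn : n < e)
    (hmn' : m < n ∨ p = 2) (h : ∀ a : Kˣ, a ^ (2 * (p ^ k + p ^ l)) = a ^ (2 * (p ^ m + p ^ n))) :
    m = k ∧ n = l := by
  have hp := hpp.out.two_le
  refine pow_add_pow_injective hp hkl.le hmn (Eq.symm ?_)
  have hpos : ∀ k, 0 < p ^ k := fun k => pow_pos (by omega) k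
  have hle : ∀ {k l}, k ≤ l → p ^ k ≤ p ^ l := fun h => Nat.pow_le_pow_right (by omega) h
  obtain ⟨e, rfl⟩ : ∃ e', e = e' + 1 := ⟨e - 1, by omega⟩
  rcases hpp.out.eq_two_or_odd' with rfl | hodd
  · have h1 := hle (show l ≤ e by omega)
    have h2 := hle (show n ≤ e by omega)
    have h3 := hle hmn
    have h4 : 2 ^ k < 2 ^ l := Nat.pow_lt_pow_right (by omega) hkl
    have h5 := hpos m
    have h6 := hpos n
    have h7 := hpos k
    rw [pow_succ] at hK
    exact eq_of_forall_pow_eq_of_even ⟨2 ^ e, by omega⟩ (by omega) (by omega) h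
  · have hmn : m < n := hmn'.resolve_right (by rintro rfl; exact absurd hodd (by decide))
    have hb : ∀ {k l}, k < l → l < e + 1 → 2 * (p ^ k + p ^ l) ≤ Fintype.card K := by
      intro k l hkl hl
      obtain ⟨j, rfl⟩ : ∃ j, l = j + 1 := ⟨l - 1, by omega⟩
      have h1 := hle (show k ≤ j by omega)
      have h2 := hle (show j + 2 ≤ e + 1 by omega)
      have h3 : 3 ≤ p := by
        rcases hodd with ⟨r, hr⟩
        omega
      rw [hK]
      refine le_trans ?_ h2
      calc 2 * (p ^ k + p ^ (j + 1)) ≤ 2 * (p ^ j + p ^ (j + 1)) := by omega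
        _ = p ^ j * (2 + 2 * p) := by ring
        _ ≤ p ^ j * (p * p) := Nat.mul_le_mul_left _ (by nlinarith)
        _ = p ^ (j + 2) := by ring
    exact eq_of_forall_pow_eq_of_le (Nat.add_pos_left (hpos _) _)
      (Nat.add_pos_left (hpos _) _) (hb hkl hl) (hb hmn hn) h

lemma not_forall_pow_add_pow_eq {k l m : ℕ} (hkl : k < l) (hl : l < e) (hm : m < e)
    (h : ∀ a : Kˣ, a ^ (2 * (p ^ k + p ^ l)) = a ^ (2 * p ^ m)) : False := by
  have hp := hpp.out.two_le
  refine pow_add_pow_ne_pow hp hkl (m := m) ?_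
  have hpos : ∀ k, 0 < p ^ k := fun k => pow_pos (by omega) k
  have hle : ∀ {k l}, k ≤ l → p ^ k ≤ p ^ l := fun h => Nat.pow_le_pow_right (by omega) h
  obtain ⟨e, rfl⟩ : ∃ e', e = e' + 2 := ⟨e - 2, by omega⟩
  have h0 := hpos e
  rcases hpp.out.eq_two_or_odd' with rfl | hodd
  · have h1 := hle (show l ≤ e + 1 by omega)
    have h2 := hle (show m ≤ e + 1 by omega)
    have h4 : 2 ^ k < 2 ^ l := Nat.pow_lt_pow_right (by omega) hkl
    have h5 := hpos m
    have h7 := hpos k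
    rw [pow_succ] at hK
    have h8 := pow_succ 2 e
    exact eq_of_forall_pow_eq_of_even ⟨2 ^ (e + 1), by omega⟩ (by omega) (by omega) h
  · have h3 : 3 ≤ p := by
      rcases hodd with ⟨r, hr⟩
      omega
    have h1 := hle (show k ≤ e by omega)
    have h2 := hle (show l ≤ e + 1 by omega)
    have h4 := hle (show m ≤ e + 1 by omega)
    have h5 : p ^ (e + 1) * 3 ≤ p ^ (e + 1) * p := Nat.mul_le_mul_left _ h3
    have h6 : p ^ e * 3 ≤ p ^ e * p := Nat.mul_le_mul_left _ h3
    have h7 : p ^ (e + 2) = p ^ (e + 1) * p := pow_succ _ _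
    have h8 : p ^ (e + 1) = p ^ e * p := pow_succ _ _
    exact eq_of_forall_pow_eq_of_le (Nat.add_pos_left (hpos _) _) (hpos _)
      (by nlinarith) (by omega) h

lemma pow_injective_of_forall (hq : 2 < Fintype.card K) {k l : ℕ} (hk : k < e) (hl : l < e)
    (h : ∀ a : Kˣ, a ^ p ^ k = a ^ p ^ l) : k = l := by
  have hp := hpp.out.two_le
  obtain ⟨e, rfl⟩ : ∃ e', e = e' + 1 := ⟨e - 1, by omega⟩
  have hle : ∀ {k l}, k ≤ l → p ^ k ≤ p ^ l := fun h => Nat.pow_le_pow_right (by omega) h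
  refine Nat.pow_right_injective hp ?_
  have h1 := hle (show k ≤ e by omega)
  have h2 := hle (show l ≤ e by omega)
  have h5 : p ^ e * 2 ≤ p ^ e * p := Nat.mul_le_mul_left _ hp
  rw [← pow_succ, ← hK] at h5
  have h6 : 0 < p ^ k := pow_pos (by omega) k
  have h7 : 0 < p ^ l := pow_pos (by omega) l
  have h8 := Int.eq_zero_of_abs_lt_dvd (dvd_sub_of_forall_pow_eq h) (by
    rw [abs_lt]
    omega)
  change p ^ k = p ^ l
  zify
  rw [sub_eq_zero] at h8
  exact_mod_cast h8

end Exponents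

section Coefficients

variable {p : ℕ} [Fact p.Prime] {e : ℕ} {K : Type} [Field K] [Fintype K] [Algebra (ZMod p) K]
  (hK : Fintype.card K = p ^ e) (hq : 2 < Fintype.card K) {Ω : Type} [Field Ω]
  [Algebra (ZMod p) Ω] (τ : K →+* Ω)

/-- The additive polynomial function with given coefficients. -/
noncomputable def addPoly (c : Fin e → Ω) : K →ₗ[ZMod p] Ω :=
  AddMonoidHom.toZModLinearMap p
    { toFun := fun x => ∑ k, c k * τ (x ^ p ^ (k : ℕ))
      map_zero' := Finset.sum_eq_zero fun k _ => by
        rw [zero_pow (pow_ne_zero _ (Fact.out : p.Prime).ne_zero), map_zero, mul_zero]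
      map_add' := fun x y => by
        have : CharP K p := charP_of_injective_algebraMap (algebraMap (ZMod p) K).injective p
        rw [← Finset.sum_add_distrib]
        refine Finset.sum_congr rfl fun k _ => ?_
        rw [add_pow_char_pow, map_add, mul_add] }

omit [Fintype K] in
lemma addPoly_apply (c : Fin e → Ω) (x : K) :
    addPoly (p := p) τ c x = ∑ k, c k * τ (x ^ p ^ (k : ℕ)) := rfl

include hK hq

lemma eq_zero_of_addPoly {c : Fin e → Ω} (h : ∀ x, addPoly (p := p) τ c x = 0) : c = 0 := by
  let χ : Fin e → (K →* Ω) := fun k => (τ : K →* Ω).comp (powMonoidHom (p ^ (k : ℕ)))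
  have hχ : Function.Injective χ := fun k l hkl => by
    refine Fin.ext (pow_injective_of_forall hK hq k.2 l.2 fun a => Units.ext (τ.injective ?_))
    simpa [χ] using DFunLike.congr_fun hkl (a : K)
  have h1 := (linearIndependent_monoidHom K Ω).comp χ hχ
  funext k
  refine Fintype.linearIndependent_iff.1 h1 c ?_ k
  funext x
  rw [Finset.sum_apply]
  exact h x

/-- Every additive map between a finite field and an extension of it is given by a unique additive
polynomial. -/
lemma exists_addPoly_equiv : ∃ E : (Fin e → Ω) ≃ₗ[Ω] (K →ₗ[ZMod p] Ω),
    ∀ c, E c = addPoly (p := p) τ c := by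
  let Φ : (Fin e → Ω) →ₗ[Ω] (K →ₗ[ZMod p] Ω) :=
    { toFun := addPoly τ
      map_add' := fun c d => by
        ext x
        rw [LinearMap.add_apply, addPoly_apply, addPoly_apply, addPoly_apply,
          ← Finset.sum_add_distrib]
        exact Finset.sum_congr rfl fun k _ => add_mul _ _ _
      map_smul' := fun r c => by
        ext x
        rw [RingHom.id_apply, LinearMap.smul_apply, addPoly_apply, addPoly_apply, Finset.smul_sum]
        exact Finset.sum_congr rfl fun k _ => mul_assoc _ _ _ }
  have hinj : Function.Injective Φ := (injective_iff_map_eq_zero _).2 fun c hc =>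
    eq_zero_of_addPoly hK hq τ fun x => LinearMap.congr_fun hc x
  have hfin : finrank (ZMod p) K = e := by
    have h1 := Module.card_eq_pow_finrank (K := ZMod p) (V := K)
    rw [ZMod.card, hK] at h1
    exact (Nat.pow_right_injective (Fact.out : p.Prime).two_le h1).symm
  have hrank : finrank Ω (Fin e → Ω) = finrank Ω (K →ₗ[ZMod p] Ω) := by
    rw [Module.finrank_linearMap_self, finrank_fin_fun, hfin]
  exact ⟨LinearEquiv.ofBijective Φ
    ⟨hinj, (LinearMap.injective_iff_surjective_of_finrank_eq_finrank hrank).1 hinj⟩, fun _ => rfl⟩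

lemma exists_coeff {θ : K → Ω} (hθ : ∀ x y, θ (x + y) = θ x + θ y) :
    ∃ c : Fin e → Ω, ∀ x, θ x = ∑ k, c k * τ (x ^ p ^ (k : ℕ)) := by
  obtain ⟨E, hE⟩ := exists_addPoly_equiv hK hq τ
  let θ' : K →ₗ[ZMod p] Ω := AddMonoidHom.toZModLinearMap p (AddMonoidHom.mk' θ hθ)
  refine ⟨E.symm θ', fun x => ?_⟩
  rw [← addPoly_apply, ← hE, E.apply_symm_apply]
  rfl

lemma exists_bicoeff {α : K → K → Ω} (hl : ∀ x y z, α (x + y) z = α x z + α y z)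
    (hr : ∀ x y z, α x (y + z) = α x y + α x z) :
    ∃ c : Fin e → Fin e → Ω, ∀ x y, α x y =
      ∑ k, ∑ l, c k l * (τ (x ^ p ^ (k : ℕ)) * τ (y ^ p ^ (l : ℕ))) := by
  obtain ⟨E, hE⟩ := exists_addPoly_equiv hK hq τ
  let β : K → K →ₗ[ZMod p] Ω := fun y =>
    AddMonoidHom.toZModLinearMap p (AddMonoidHom.mk' (fun x => α x y) fun x z => hl x z y)
  have hβ : ∀ y z, β (y + z) = β y + β z := fun y z => LinearMap.ext fun x => hr x y z
  have h1 : ∀ k, ∃ c : Fin e → Ω, ∀ y, E.symm (β y) k = ∑ l, c l * τ (y ^ p ^ (l : ℕ)) := fun k =>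
    exists_coeff hK hq τ fun y z => by rw [hβ, map_add]; rfl
  choose c hc using h1
  refine ⟨c, fun x y => ?_⟩
  have h2 : α x y = E (E.symm (β y)) x := by
    rw [E.apply_symm_apply]
    rfl
  rw [h2, hE, addPoly_apply]
  refine Finset.sum_congr rfl fun k _ => ?_
  rw [hc, Finset.sum_mul]
  exact Finset.sum_congr rfl fun l _ => by ring

lemma bicoeff_eq_zero {c : Fin e → Fin e → Ω} (h : ∀ x y : K,
    ∑ k, ∑ l, c k l * (τ (x ^ p ^ (k : ℕ)) * τ (y ^ p ^ (l : ℕ))) = 0) (k l) : c k l = 0 := by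
  have h1 : ∀ y : K, (fun k => ∑ l, c k l * τ (y ^ p ^ (l : ℕ))) = 0 := fun y =>
    eq_zero_of_addPoly hK hq τ fun x => by
      rw [addPoly_apply, ← h x y]
      refine Finset.sum_congr rfl fun k _ => ?_
      rw [Finset.sum_mul]
      exact Finset.sum_congr rfl fun l _ => by ring
  exact congrFun (eq_zero_of_addPoly hK hq τ fun y => congrFun (h1 y) k) l

end Coefficients

lemma sum_sum_eq_sum_diag {ι A : Type} [Fintype ι] [DecidableEq ι] [AddCommMonoid A]
    (f : ι → ι → A) (h : ∀ i j, i ≠ j → f i j + f j i = 0) :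
    ∑ i, ∑ j, f i j = ∑ i, f i i := by
  rw [← Finset.sum_product', ← Finset.diag_union_offDiag,
    Finset.sum_union (Finset.disjoint_diag_offDiag _), Finset.sum_diag]
  have h1 : ∑ x ∈ (Finset.univ : Finset ι).offDiag, f x.1 x.2 = 0 :=
    Finset.sum_involution (fun x _ => x.swap) (fun x hx => h _ _ (Finset.mem_offDiag.1 hx).2.2)
      (fun x hx _ hs => (Finset.mem_offDiag.1 hx).2.2 (congrArg Prod.snd hs))
      (fun x hx => by
        rw [Finset.mem_offDiag] at hx ⊢
        exact ⟨hx.2.1, hx.1, hx.2.2.symm⟩)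
      (fun x _ => x.swap_swap)
  rw [h1, add_zero]

/-- Alternating biadditive maps which are equivariant for the squares of the units, with respect
to a character. -/
structure IsAltEquivariant {K Ω : Type} [Field K] [Field Ω] (lam : Kˣ → Ω) (α : K → K → Ω) :
    Prop where
  add_left : ∀ x y z, α (x + y) z = α x z + α y z
  add_right : ∀ x y z, α x (y + z) = α x y + α x z
  self_eq_zero : ∀ x, α x x = 0
  smul : ∀ (a : Kˣ) x y, α (a ^ 2 * x) (a ^ 2 * y) = lam a * α x y

section Alternating

variable {p : ℕ} [Fact p.Prime] {e : ℕ} {K : Type} [Field K] [Fintype K] [Algebra (ZMod p) K]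
  (hK : Fintype.card K = p ^ e) (hq : 2 < Fintype.card K) {Ω : Type} [Field Ω]
  [Algebra (ZMod p) Ω] (τ : K →+* Ω) {lam : Kˣ → Ω}

include hK hq

lemma IsAltEquivariant.exists_coeff {α : K → K → Ω} (hα : IsAltEquivariant lam α) :
    ∃ c : Fin e → Fin e → Ω, (∀ x y, α x y =
      ∑ k, ∑ l, c k l * (τ (x ^ p ^ (k : ℕ)) * τ (y ^ p ^ (l : ℕ)))) ∧
      (∀ k l, c l k = - c k l) ∧ (∀ k, c k k = 0) ∧
      ∀ k l, c k l ≠ 0 → ∀ a : Kˣ, lam a = τ (a ^ (2 * (p ^ (k : ℕ) + p ^ (l : ℕ)))) := by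
  obtain ⟨c, hc⟩ := exists_bicoeff hK hq τ hα.add_left hα.add_right
  have hanti : ∀ x y, α x y + α y x = 0 := fun x y => by
    have h1 := hα.self_eq_zero (x + y)
    rwa [hα.add_left, hα.add_right, hα.add_right, hα.self_eq_zero, hα.self_eq_zero, zero_add,
      add_zero] at h1
  have h1 : ∀ k l, c k l + c l k = 0 := bicoeff_eq_zero hK hq τ fun x y => by
    rw [← hanti x y, hc, hc, Finset.sum_comm (f := fun k l => c k l * (τ (y ^ _) * τ (x ^ _))),
      ← Finset.sum_add_distrib]
    refine Finset.sum_congr rfl fun k _ => ?_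
    rw [← Finset.sum_add_distrib]
    exact Finset.sum_congr rfl fun l _ => by ring
  refine ⟨c, hc, fun k l => eq_neg_of_add_eq_zero_right (h1 k l), ?_, ?_⟩
  · have : CharP Ω p := charP_of_injective_algebraMap (algebraMap (ZMod p) Ω).injective p
    have : CharP K p := charP_of_injective_algebraMap (algebraMap (ZMod p) K).injective p
    rcases (Fact.out : p.Prime).eq_two_or_odd' with rfl | hodd
    · refine congrFun (eq_zero_of_addPoly (c := fun k => c k k) hK hq τ fun y => ?_)
      obtain ⟨x, rfl⟩ := FiniteField.isSquare_of_char_two (ringChar.eq K 2) y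
      rw [addPoly_apply, ← hα.self_eq_zero x, hc, sum_sum_eq_sum_diag _ fun k l _ => by
        linear_combination (τ (x ^ 2 ^ (k : ℕ)) * τ (x ^ 2 ^ (l : ℕ))) * h1 k l]
      exact Finset.sum_congr rfl fun k _ => by rw [mul_pow, map_mul]
    · intro k
      have h2 : (2 : Ω) ≠ 0 := Ring.two_ne_zero (by
        rw [ringChar.eq Ω p]
        rintro rfl
        exact absurd hodd (by decide))
      have h3 := h1 k k
      rw [← two_mul] at h3
      exact (mul_eq_zero.1 h3).resolve_left h2
  · intro k l hkl a
    have h2 : ∀ k l, c k l * (τ (a ^ (2 * (p ^ (k : ℕ) + p ^ (l : ℕ)))) - lam a) = 0 :=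
      bicoeff_eq_zero hK hq τ fun x y => by
        rw [← sub_eq_zero.2 (hα.smul a x y), hc, hc, Finset.mul_sum, ← Finset.sum_sub_distrib]
        refine Finset.sum_congr rfl fun k _ => ?_
        rw [Finset.mul_sum, ← Finset.sum_sub_distrib]
        refine Finset.sum_congr rfl fun l _ => ?_
        rw [mul_pow, mul_pow, map_mul, map_mul, mul_add, pow_add, map_mul, pow_mul, pow_mul]
        ring
    exact (sub_eq_zero.1 ((mul_eq_zero.1 (h2 k l)).resolve_left hkl)).symm

lemma IsAltEquivariant.exists_lt {α : K → K → Ω} (hα : IsAltEquivariant lam α) {x₀ y₀ : K}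
    (h0 : α x₀ y₀ ≠ 0) : ∃ k l : Fin e, (k : ℕ) < l ∧
      ∀ a : Kˣ, lam a = τ (a ^ (2 * (p ^ (k : ℕ) + p ^ (l : ℕ)))) := by
  obtain ⟨c, hc, hanti, hdiag, hlam⟩ := hα.exists_coeff hK hq τ
  obtain ⟨k, l, hkl⟩ : ∃ k l, c k l ≠ 0 := by
    by_contra! h
    exact h0 (by rw [hc]; simp [h])
  rcases lt_trichotomy k l with h | rfl | h
  · exact ⟨k, l, h, hlam k l hkl⟩
  · exact (hkl (hdiag k)).elim
  · exact ⟨l, k, h, hlam l k (by rw [hanti]; exact neg_ne_zero.2 hkl)⟩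

include τ

/-- The space of equivariant alternating biadditive maps is at most one dimensional. -/
lemma IsAltEquivariant.eq_zero {α β : K → K → Ω} (hα : IsAltEquivariant lam α) {x₀ y₀ : K}
    (h0 : α x₀ y₀ ≠ 0) (hβ : IsAltEquivariant lam β) (hβ0 : β x₀ y₀ = 0) (x y : K) :
    β x y = 0 := by
  obtain ⟨k, l, hkl, hlam⟩ := hα.exists_lt hK hq τ h0
  have key : ∀ {β : K → K → Ω}, IsAltEquivariant lam β → ∃ d, ∀ x y, β x y = d *
      (τ (x ^ p ^ (k : ℕ)) * τ (y ^ p ^ (l : ℕ)) - τ (x ^ p ^ (l : ℕ)) * τ (y ^ p ^ (k : ℕ))) := by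
    intro β hβ
    obtain ⟨c, hc, hanti, hdiag, hlam'⟩ := hβ.exists_coeff hK hq τ
    have hne : k ≠ l := fun h => hkl.ne (congrArg Fin.val h)
    have h1 : ∀ m n : Fin e, m < n → c m n ≠ 0 → m = k ∧ n = l := fun m n hmn hc' => by
      have h2 := pow_add_pow_eq_of_forall hK hkl l.2 (show (m : ℕ) ≤ n from hmn.le) n.2
        (Or.inl hmn) fun a => Units.ext (τ.injective (by
          rw [Units.val_pow_eq_pow_val, Units.val_pow_eq_pow_val, ← hlam, ← hlam' m n hc']))
      exact ⟨Fin.ext h2.1, Fin.ext h2.2⟩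
    have h2 : ∀ m n : Fin e, (m, n) ≠ (k, l) → (m, n) ≠ (l, k) → c m n = 0 := fun m n h3 h4 => by
      by_contra h5
      rcases lt_trichotomy m n with h | rfl | h
      · exact h3 (by rw [(h1 m n h h5).1, (h1 m n h h5).2])
      · exact h5 (hdiag m)
      · have h6 := h1 n m h (by rw [hanti]; exact neg_ne_zero.2 h5)
        exact h4 (by rw [h6.1, h6.2])
    refine ⟨c k l, fun x y => ?_⟩
    rw [hc, ← Finset.sum_product', Finset.sum_eq_add (k, l) (l, k) (by simp [hne])
      (fun z _ hz => by rw [h2 z.1 z.2 hz.1 hz.2, zero_mul])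
      (fun h => (h (by simp)).elim) (fun h => (h (by simp)).elim), hanti k l]
    ring
  obtain ⟨d, hd⟩ := key hα
  obtain ⟨d', hd'⟩ := key hβ
  rw [hd] at h0
  rw [hd'] at hβ0
  rw [hd', (mul_eq_zero.1 hβ0).resolve_right (right_ne_zero_of_mul h0), zero_mul]

/-- An equivariant additive map vanishes if there is an equivariant alternating biadditive map. -/
lemma IsAltEquivariant.additive_eq_zero {α : K → K → Ω} (hα : IsAltEquivariant lam α) {x₀ y₀ : K}
    (h0 : α x₀ y₀ ≠ 0) {θ : K → Ω} (hθ : ∀ x y, θ (x + y) = θ x + θ y)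
    (hsmul : ∀ (a : Kˣ) x, θ (a ^ 2 * x) = lam a * θ x) (x : K) : θ x = 0 := by
  obtain ⟨k, l, hkl, hlam⟩ := hα.exists_lt hK hq τ h0
  obtain ⟨c, hc⟩ := CohomologyBound.exists_coeff hK hq τ hθ
  suffices h : ∀ m, c m = 0 by
    rw [hc]
    simp [h]
  intro m
  by_contra hm
  refine not_forall_pow_add_pow_eq hK hkl l.2 m.2 fun a => Units.ext (τ.injective ?_)
  rw [Units.val_pow_eq_pow_val, Units.val_pow_eq_pow_val, ← hlam]
  have h1 : (fun m : Fin e => c m * (lam a - τ (a ^ (2 * p ^ (m : ℕ))))) = 0 :=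
    eq_zero_of_addPoly hK hq τ fun x => by
      rw [addPoly_apply, ← sub_eq_zero.2 (hsmul a x).symm, hc, hc, Finset.mul_sum,
        ← Finset.sum_sub_distrib]
      refine Finset.sum_congr rfl fun m _ => ?_
      rw [mul_pow, map_mul, pow_mul]
      ring
  exact sub_eq_zero.1 ((mul_eq_zero.1 (congrFun h1 m)).resolve_left hm)

end Alternating

section Cocycles

variable {F G : Type} [Field F] [Group G] {M : Type} [AddCommGroup M] [Module F M]
  (ρ : Representation F G M)

/-- The second cohomology is bounded by the dimension of the target of a linear map on cocycles
whose kernel consists of coboundaries. -/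
lemma hd_two_le_of_linearMap {W : Type} [AddCommGroup W] [Module F W] [FiniteDimensional F W]
    (L : groupCohomology.cocycles₂ (Rep.of ρ) →ₗ[F] W)
    (hL : ∀ f, L f = 0 → ∃ σ : G → M, ∀ g h, f (g, h) = ρ g (σ h) - σ (g * h) + σ g) :
    hd ρ 2 ≤ finrank F W := by
  have h1 : Function.Surjective (groupCohomology.H2π (Rep.of ρ)) :=
    (ModuleCat.epi_iff_surjective _).1 inferInstance
  obtain ⟨s, hs⟩ := (groupCohomology.H2π (Rep.of ρ)).hom.exists_rightInverse_of_surjective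
    (LinearMap.range_eq_top.2 h1)
  refine LinearMap.finrank_le_finrank_of_injective (f := L ∘ₗ s)
    ((injective_iff_map_eq_zero _).2 fun x hx => ?_)
  obtain ⟨σ, hσ⟩ := hL (s x) hx
  have h2 : (groupCohomology.H2π (Rep.of ρ)).hom (s x) = x := LinearMap.congr_fun hs x
  rw [← h2]
  refine (groupCohomology.H2π_eq_zero_iff _).2 ⟨σ, ?_⟩
  funext z
  exact (hσ z.1 z.2).symm

variable {ρ} {f : G → G → M}
  (hf : ∀ g h j, f (g * h) j + f g h = ρ g (f h j) + f g (h * j))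

include hf

/-- A cocycle whose restriction to a subgroup of invertible index is a coboundary is a
coboundary. -/
lemma exists_coboundary_of_subgroup (S : Subgroup G) [Finite (G ⧸ S)] (hS : (S.index : F) ≠ 0)
    (σ : G → M)
    (hσ : ∀ s ∈ S, ∀ s' ∈ S, σ (s * s') = σ s + ρ s (σ s') + f s s') :
    ∃ φ : G → M, ∀ g h, f g h = ρ g (φ h) - φ (g * h) + φ g := by
  classical
  have := Fintype.ofFinite (G ⧸ S)
  let r : G ⧸ S → G := Quotient.out
  let s : G → G ⧸ S → G := fun g x => (r x)⁻¹ * (g * r (g⁻¹ • x))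
  have hs : ∀ g x, s g x ∈ S := fun g x => by
    refine QuotientGroup.eq.1 ?_
    change (r x : G ⧸ S) = g • (r (g⁻¹ • x) : G ⧸ S)
    rw [QuotientGroup.out_eq', QuotientGroup.out_eq', smul_inv_smul]
  have hrs : ∀ g x, r x * s g x = g * r (g⁻¹ • x) := fun g x => mul_inv_cancel_left _ _
  have hss : ∀ g h x, s (g * h) x = s g x * s h (g⁻¹ • x) := fun g h x => by
    simp only [s, mul_inv_rev, mul_smul]
    group
  let Φ : G → G ⧸ S → M := fun g x => f g (r (g⁻¹ • x)) - f (r x) (s g x) - ρ (r x) (σ (s g x))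
  have hΦ : ∀ g h x, f g h = ρ g (Φ h (g⁻¹ • x)) - Φ (g * h) x + Φ g x := fun g h x => by
    have e1 := hf (r x) (s g x) (s h (g⁻¹ • x))
    have e2 := hf g (r (g⁻¹ • x)) (s h (g⁻¹ • x))
    have e3 := hf g h (r (h⁻¹ • g⁻¹ • x))
    rw [hrs] at e1 e2
    have e4 := hσ _ (hs g x) _ (hs h (g⁻¹ • x))
    have e5 : ρ (r x) (ρ (s g x) (σ (s h (g⁻¹ • x)))) =
        ρ g (ρ (r (g⁻¹ • x)) (σ (s h (g⁻¹ • x)))) := by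
      rw [← Module.End.mul_apply, ← Module.End.mul_apply, ← map_mul, ← map_mul, hrs]
    simp only [Φ]
    rw [hss, e4, mul_inv_rev, mul_smul]
    simp only [map_add, map_sub, e5]
    linear_combination (norm := module) e1 - e2 + e3
  have hc : ∀ g h, (S.index : F) • f g h =
      ρ g (∑ x, Φ h x) - ∑ x, Φ (g * h) x + ∑ x, Φ g x := fun g h => by
    have h1 : ∑ x, ρ g (Φ h (g⁻¹ • x)) = ρ g (∑ x, Φ h x) := by
      rw [map_sum]
      exact Fintype.sum_bijective (g⁻¹ • ·) (MulAction.bijective _) _ _ fun _ => rfl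
    rw [← h1, ← Finset.sum_sub_distrib, ← Finset.sum_add_distrib,
      ← Finset.sum_congr rfl fun x _ => hΦ g h x, Finset.sum_const, Finset.card_univ,
      ← Nat.card_eq_fintype_card, Nat.cast_smul_eq_nsmul]
    rfl
  refine ⟨fun g => (S.index : F)⁻¹ • ∑ x, Φ g x, fun g h => ?_⟩
  simp only []
  rw [_root_.map_smul, ← smul_sub, ← smul_add, ← hc, inv_smul_smul₀ hS]

end Cocycles

/-- A surjective linear map of vector spaces over the prime field has an additive section. -/
lemma exists_addMonoidHom_section {A B : Type} [AddCommGroup A] [AddCommGroup B] {p : ℕ}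
    [Fact p.Prime] [Module (ZMod p) A] [Module (ZMod p) B] (π : A →ₗ[ZMod p] B)
    (hπ : Function.Surjective π) : ∃ s : B →+ A, ∀ x, π (s x) = x := by
  obtain ⟨s, hs⟩ := π.exists_rightInverse_of_surjective (LinearMap.range_eq_top.2 hπ)
  exact ⟨s.toAddMonoidHom, LinearMap.congr_fun hs⟩

section Abelian

variable {A M : Type} [AddCommGroup A] [AddCommGroup M] {f : A → A → M}
  (hf : ∀ x y z, f (x + y) z + f x y = f y z + f x (y + z))

include hf

lemma comm_add_left (x y z : A) :
    f (x + y) z - f z (x + y) = (f x z - f z x) + (f y z - f z y) := by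
  have h1 := hf x y z
  have h2 := hf z x y
  have h3 := hf x z y
  rw [add_comm z x] at h2
  rw [add_comm z y] at h3
  grind

lemma map_zero_left (x : A) : f 0 x = f 0 0 := by
  have := hf 0 0 x
  rw [add_zero, zero_add] at this
  grind

variable (hsymm : ∀ x y, f x y = f y x)

include hsymm

lemma sum_nsmul_add (n : ℕ) (x y : A) :
    ∑ i ∈ Finset.range n, f (i • (x + y)) (x + y) + n • f x y + f 0 0 =
      ∑ i ∈ Finset.range n, f (i • x) x + ∑ i ∈ Finset.range n, f (i • y) y + f (n • x) (n • y) := by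
  induction n with
  | zero => simp
  | succ n ih =>
    rw [Finset.sum_range_succ, Finset.sum_range_succ, Finset.sum_range_succ, succ_nsmul,
      succ_nsmul x n, succ_nsmul y n, smul_add n x y]
    generalize n • x = a at *
    generalize n • y = b at *
    have h1 := hf (a + b) x y
    have h2 := hf a b x
    have h3 := hf (a + x) b y
    have h4 := hf a x b
    have h5 := hsymm b x
    rw [add_comm b x] at h2
    rw [add_right_comm a x b] at h3
    grind

/-- The extension of an abelian group by a symmetric cocycle. -/
structure SymmExt (f : A → A → M) where
  /-- The component in the kernel. -/
  fst : M
  /-- The component in the quotient. -/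
  snd : A

omit [AddCommGroup A] [AddCommGroup M] hf hsymm in
lemma SymmExt.ext' {a b : SymmExt f} (h1 : a.fst = b.fst) (h2 : a.snd = b.snd) : a = b := by
  cases a
  cases b
  exact congrArg₂ SymmExt.mk h1 h2

omit hf hsymm in
instance : Add (SymmExt f) := ⟨fun a b => ⟨a.fst + b.fst + f a.snd b.snd, a.snd + b.snd⟩⟩

omit hf hsymm in
instance : Zero (SymmExt f) := ⟨⟨- f 0 0, 0⟩⟩

omit hf hsymm in
instance : Neg (SymmExt f) := ⟨fun a => ⟨- a.fst - f (-a.snd) a.snd - f 0 0, -a.snd⟩⟩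

/-- The group structure on the extension given by a symmetric cocycle. -/
abbrev SymmExt.addCommGroup : AddCommGroup (SymmExt f) :=
  { add_assoc := fun a b c => SymmExt.ext' (by
      have := hf a.snd b.snd c.snd
      change a.fst + b.fst + f a.snd b.snd + c.fst + f (a.snd + b.snd) c.snd =
        a.fst + (b.fst + c.fst + f b.snd c.snd) + f a.snd (b.snd + c.snd)
      grind) (add_assoc _ _ _)
    zero_add := fun a => SymmExt.ext' (by
      change - f 0 0 + a.fst + f 0 a.snd = a.fst
      rw [map_zero_left hf a.snd]
      abel) (zero_add _)
    add_zero := fun a => SymmExt.ext' (by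
      change a.fst + - f 0 0 + f a.snd 0 = a.fst
      rw [hsymm a.snd, map_zero_left hf a.snd]
      abel) (add_zero _)
    add_comm := fun a b => SymmExt.ext' (by
      change a.fst + b.fst + f a.snd b.snd = b.fst + a.fst + f b.snd a.snd
      rw [hsymm, add_comm a.fst]) (add_comm _ _)
    neg_add_cancel := fun a => SymmExt.ext' (by
      change - a.fst - f (-a.snd) a.snd - f 0 0 + a.fst + f (-a.snd) a.snd = - f 0 0
      abel) (neg_add_cancel _)
    nsmul := nsmulRec
    zsmul := zsmulRec }

/-- A symmetric cocycle on an elementary abelian group with trivial power map is a coboundary. -/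
lemma exists_symm_coboundary {p : ℕ} [Fact p.Prime] (hA : ∀ x : A, p • x = 0)
    (hM : ∀ m : M, p • m = 0) (hsum : ∀ x, ∑ i ∈ Finset.range p, f (i • x) x = 0) :
    ∃ σ : A → M, ∀ x y, σ (x + y) = σ x + σ y + f x y := by
  let inst : AddCommGroup (SymmExt f) := SymmExt.addCommGroup hf hsymm
  have hn : ∀ (n : ℕ) (a : SymmExt f), n • a =
      ⟨n • a.fst + ∑ i ∈ Finset.range n, f (i • a.snd) a.snd - f 0 0, n • a.snd⟩ := fun n a => by
    induction n with
    | zero =>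
      rw [zero_nsmul]
      exact SymmExt.ext' (by simp; rfl) (zero_nsmul _).symm
    | succ n ih =>
      rw [succ_nsmul, ih]
      refine SymmExt.ext' ?_ (succ_nsmul _ _).symm
      rw [Finset.sum_range_succ, succ_nsmul]
      change _ + _ + f (n • a.snd) a.snd = _
      simp only
      abel
  let mE : Module (ZMod p) (SymmExt f) := AddCommGroup.zmodModule fun a => by
    rw [hn, hM, hA, hsum]
    exact SymmExt.ext' (by simp; rfl) rfl
  let mA : Module (ZMod p) A := AddCommGroup.zmodModule hA
  let π : SymmExt f →+ A := AddMonoidHom.mk' SymmExt.snd fun _ _ => rfl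
  obtain ⟨s, hs⟩ := exists_addMonoidHom_section (π.toZModLinearMap p) fun x => ⟨⟨0, x⟩, rfl⟩
  have hs' : ∀ x, (s x).snd = x := hs
  refine ⟨fun x => (s x).fst, fun x y => ?_⟩
  change (s (x + y)).fst = _
  rw [map_add]
  change _ + _ + f (s x).snd (s y).snd = _
  rw [hs', hs']

end Abelian

section CharP

variable {p : ℕ} [Fact p.Prime] {e : ℕ} {K : Type} [Field K] [Fintype K] [DecidableEq K]
  {F : Type} [Field F] {V : Type} [AddCommGroup V] [Module F V]
  (ρ : Representation F (Bor K) V)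

/-- The unipotent matrices as elements of the Borel subgroup. -/
def uniB (x : K) : Bor K := ⟨uni x, uni_mem_Bor x⟩

/-- The diagonal matrices as elements of the Borel subgroup. -/
def torB (a : Kˣ) : Bor K := ⟨tor a, tor_mem_Bor a⟩

omit [Fintype K]

lemma uniB_add (x y : K) : uniB (x + y) = uniB x * uniB y := Subtype.ext (uni_add x y)

lemma uniB_zero : uniB (0 : K) = 1 := Subtype.ext uni_zero

lemma torB_mul_uniB (a : Kˣ) (x : K) : torB a * uniB x = uniB ((a : K) ^ 2 * x) * torB a :=
  Subtype.ext (tor_mul_uni a x)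

lemma torB_pow (a : Kˣ) (n : ℕ) : torB (a ^ n) = torB a ^ n := Subtype.ext (map_pow tor a n)

lemma exists_eq_uniB_mul_torB (g : Bor K) : ∃ x a, g = uniB x * torB a := by
  obtain ⟨x, a, h⟩ := exists_eq_of_mem_Bor g.2
  exact ⟨x, a, Subtype.ext h⟩

lemma uniB_nsmul (n : ℕ) (x : K) : uniB (n • x) = uniB x ^ n := by
  induction n with
  | zero => rw [zero_nsmul, pow_zero, uniB_zero]
  | succ n ih => rw [succ_nsmul, uniB_add, ih, pow_succ]

lemma mem_ker_BorChar (g : Bor K) : g ∈ (BorChar K).ker ↔ ∃ x, g = uniB x := by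
  obtain ⟨x, a, rfl⟩ := exists_eq_uniB_mul_torB g
  have h : BorChar K (uniB x * torB a) = a := BorChar_apply x a (uniB x * torB a).2
  rw [MonoidHom.mem_ker, h]
  constructor
  · rintro rfl
    exact ⟨x, by rw [show (torB 1 : Bor K) = 1 from Subtype.ext (map_one tor), mul_one]⟩
  · rintro ⟨y, hy⟩
    have h1 : BorChar K (uniB y * torB 1) = 1 := BorChar_apply y 1 (uniB y * torB 1).2
    rw [show (torB 1 : Bor K) = 1 from Subtype.ext (map_one tor), mul_one, ← hy, h] at h1
    exact h1

lemma BorChar_surjective : Function.Surjective (BorChar K) := fun a =>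
  ⟨uniB 0 * torB a, BorChar_apply 0 a (uniB 0 * torB a).2⟩

lemma index_ker_BorChar [Fintype K] : (BorChar K).ker.index = Fintype.card K - 1 := by
  rw [Subgroup.index_ker, MonoidHom.range_eq_top.2 BorChar_surjective, Subgroup.card_top,
    Nat.card_units, Nat.card_eq_fintype_card]

/-- In the defining characteristic the unipotent subgroup acts trivially on irreducible
representations. -/
lemma uniB_apply [CharP K p] [Fintype K] [Nontrivial V] (hp : (p : F) = 0)
    (hirr : ∀ W : Submodule F V, (∀ g, W ≤ W.comap (ρ g)) → W = ⊥ ∨ W = ⊤) (x : K) (v : V) :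
    ρ (uniB x) v = v := by
  have key : ∀ s : Finset K, ∃ v : V, v ≠ 0 ∧ ∀ x ∈ s, ρ (uniB x) v = v := fun s => by
    induction s using Finset.induction with
    | empty =>
      obtain ⟨v, hv⟩ := exists_ne (0 : V)
      exact ⟨v, hv, by simp⟩
    | insert a s _ ih =>
      let W : Submodule F V := ⨅ y ∈ s, LinearMap.ker (ρ (uniB y) - 1)
      have hW : ∀ v, v ∈ W ↔ ∀ y ∈ s, ρ (uniB y) v = v := fun v => by
        simp [W, Submodule.mem_iInf, sub_eq_zero]
      obtain ⟨v, hv0, hv⟩ := ih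
      obtain ⟨w, hwW, hw0, hw⟩ := exists_fixed_of_pow p hp (ρ (uniB a)) 1 W (fun w hw => by
          rw [Submodule.mem_comap, hW]
          intro y hy
          rw [← Module.End.mul_apply, ← map_mul, ← uniB_add, add_comm, uniB_add, map_mul,
            Module.End.mul_apply, (hW w).1 hw y hy]) (fun w _ => by
          rw [← map_pow, ← uniB_nsmul, pow_one, nsmul_eq_mul, CharP.cast_eq_zero, zero_mul,
            uniB_zero, map_one, Module.End.one_apply]) fun h => hv0 (by
          have : v ∈ W := (hW v).2 hv
          rwa [h, Submodule.mem_bot] at this)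
      refine ⟨w, hw0, fun y hy => ?_⟩
      rcases Finset.mem_insert.1 hy with rfl | hy
      · exact hw
      · exact (hW w).1 hwW y hy
  obtain ⟨w, hw0, hw⟩ := key Finset.univ
  rcases hirr (fixedSub ρ (BorChar K).ker) (fixedSub_le_comap ρ _) with h | h
  · have : w ∈ fixedSub ρ (BorChar K).ker := fun g hg => by
      obtain ⟨y, rfl⟩ := (mem_ker_BorChar g).1 hg
      exact hw y (Finset.mem_univ _)
    rw [h] at this
    exact (hw0 this).elim
  · have : v ∈ fixedSub ρ (BorChar K).ker := h ▸ Submodule.mem_top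
    exact this _ ((mem_ker_BorChar _).2 ⟨x, rfl⟩)

variable {ρ} (hU : ∀ x v, ρ (uniB x) v = v)

include hU

/-- An irreducible representation of the Borel subgroup with trivial action of the unipotent
subgroup is given by a character over an algebraically closed field. -/
lemma exists_eigenfunctional [Fintype K] [Nontrivial V] [FiniteDimensional F V] (Ω : Type)
    [Field Ω] [IsAlgClosed Ω] [Algebra F Ω]
    (hirr : ∀ W : Submodule F V, (∀ g, W ≤ W.comap (ρ g)) → W = ⊥ ∨ W = ⊤) :
    ∃ (j : V →ₗ[F] Ω) (lam : Kˣ → Ω), Function.Injective j ∧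
      ∀ a v, j (ρ (torB a) v) = lam a * j v := by
  obtain ⟨t, ht⟩ := IsCyclic.exists_generator (α := Kˣ)
  let T : Module.End Ω (V →ₗ[F] Ω) :=
    { toFun := fun j => j ∘ₗ ρ (torB t)
      map_add' := fun _ _ => rfl
      map_smul' := fun _ _ => rfl }
  have hnt : Nontrivial (V →ₗ[F] Ω) := by
    obtain ⟨v, hv⟩ := exists_ne (0 : V)
    obtain ⟨φ, hφ⟩ : ∃ φ : Dual F V, φ v ≠ 0 := by
      by_contra! h
      exact hv ((Module.forall_dual_apply_eq_zero_iff F v).1 h)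
    refine ⟨⟨Algebra.linearMap F Ω ∘ₗ φ, 0, fun h => hφ ?_⟩⟩
    exact (map_eq_zero (algebraMap F Ω)).1 (LinearMap.congr_fun h v)
  have hfin : Module.Finite Ω (V →ₗ[F] Ω) := Module.Finite.linearMap F Ω V Ω
  obtain ⟨μ, hμ⟩ := Module.End.exists_eigenvalue T
  obtain ⟨j, hj⟩ := hμ.exists_hasEigenvector
  have h1 : ∀ v, j (ρ (torB t) v) = μ * j v := fun v => LinearMap.congr_fun hj.apply_eq_smul v
  have h2 : ∀ (n : ℕ) v, j (ρ (torB (t ^ n)) v) = μ ^ n * j v := fun n => by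
    induction n with
    | zero => intro v; simp [show (torB 1 : Bor K) = 1 from Subtype.ext (map_one tor)]
    | succ n ih =>
      intro v
      rw [torB_pow, pow_succ', map_mul, Module.End.mul_apply, h1, ← torB_pow, ih, pow_succ']
      ring
  have h3 : ∀ a : Kˣ, ∃ c : Ω, ∀ v, j (ρ (torB a) v) = c * j v := fun a => by
    obtain ⟨n, rfl⟩ := mem_powers_iff_mem_zpowers.2 (ht a)
    exact ⟨_, h2 n⟩
  choose lam hlam using h3
  refine ⟨j, lam, ?_, hlam⟩
  rw [← LinearMap.ker_eq_bot]
  refine (hirr (LinearMap.ker j) fun g v hv => ?_).resolve_right fun h =>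
    hj.2 (LinearMap.ker_eq_top.1 h)
  obtain ⟨x, a, rfl⟩ := exists_eq_uniB_mul_torB g
  rw [Submodule.mem_comap, map_mul, Module.End.mul_apply, hU, LinearMap.mem_ker, hlam,
    LinearMap.mem_ker.1 hv, mul_zero]

variable {f : Bor K → Bor K → V}
  (hf : ∀ g h j, f (g * h) j + f g h = ρ g (f h j) + f g (h * j))

include hf

lemma uniB_cocycle (x y z : K) :
    f (uniB (x + y)) (uniB z) + f (uniB x) (uniB y) =
      f (uniB y) (uniB z) + f (uniB x) (uniB (y + z)) := by
  rw [uniB_add, hf, hU, uniB_add]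

/-- Conjugation by a diagonal matrix changes a cocycle by a coboundary. -/
lemma uniB_conj (a : Kˣ) (x y : K) :
    f (uniB (a ^ 2 * x)) (uniB (a ^ 2 * y)) = ρ (torB a) (f (uniB x) (uniB y)) +
      (f (uniB (a ^ 2 * x)) (torB a) - f (torB a) (uniB x)) +
      (f (uniB (a ^ 2 * y)) (torB a) - f (torB a) (uniB y)) -
      (f (uniB (a ^ 2 * (x + y))) (torB a) - f (torB a) (uniB (x + y))) := by
  have h1 := hf (uniB (a ^ 2 * x)) (uniB (a ^ 2 * y)) (torB a)
  have h2 := hf (uniB (a ^ 2 * x)) (torB a) (uniB y)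
  have h3 := hf (torB a) (uniB x) (uniB y)
  rw [← torB_mul_uniB, ← uniB_add, ← mul_add, hU] at h1
  rw [← torB_mul_uniB, hU] at h2
  rw [← uniB_add] at h3
  linear_combination (norm := module) h1 - h2 + h3

/-- The alternating part of a cocycle. -/
lemma isAltEquivariant_of_cocycle {Ω : Type} [Field Ω] [Algebra F Ω] {j : V →ₗ[F] Ω}
    {lam : Kˣ → Ω} (hj : ∀ a v, j (ρ (torB a) v) = lam a * j v) :
    IsAltEquivariant lam fun x y => j (f (uniB x) (uniB y) - f (uniB y) (uniB x)) := by
  have hl := comm_add_left (f := fun x y => f (uniB x) (uniB y)) (uniB_cocycle hU hf)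
  refine ⟨fun x y z => ?_, fun x y z => ?_, fun x => ?_, fun a x y => ?_⟩
  · rw [hl, map_add]
  · have := hl y z x
    rw [← map_add]
    congr 1
    linear_combination (norm := module) -this
  · rw [sub_self, map_zero]
  · rw [← hj]
    congr 1
    rw [uniB_conj hU hf a x y, uniB_conj hU hf a y x, add_comm y x, map_sub]
    abel

omit [Fact p.Prime] in
lemma sum_uniB_smul [CharP K p] (hV : ∀ v : V, p • v = 0) (a : Kˣ) (x : K) :
    ∑ i ∈ Finset.range p, f (uniB (i • ((a : K) ^ 2 * x))) (uniB ((a : K) ^ 2 * x)) =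
      ρ (torB a) (∑ i ∈ Finset.range p, f (uniB (i • x)) (uniB x)) := by
  let h : K → V := fun x => f (uniB (a ^ 2 * x)) (torB a) - f (torB a) (uniB x)
  have h1 : ∀ i : ℕ, f (uniB (i • ((a : K) ^ 2 * x))) (uniB ((a : K) ^ 2 * x)) =
      ρ (torB a) (f (uniB (i • x)) (uniB x)) + (h (i • x) - h ((i + 1) • x)) + h x := fun i => by
    rw [← mul_smul_comm, uniB_conj hU hf, succ_nsmul]
    simp only [h]
    abel
  rw [Finset.sum_congr rfl fun i _ => h1 i, Finset.sum_add_distrib, Finset.sum_add_distrib,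
    Finset.sum_range_sub' (fun i => h (i • x)), Finset.sum_const, Finset.card_range, hV, map_sum,
    zero_nsmul, nsmul_eq_mul, CharP.cast_eq_zero, zero_mul, sub_self, add_zero, add_zero]

omit [Fact p.Prime] in
lemma sum_uniB_add [CharP K p] (hV : ∀ v : V, p • v = 0)
    (hsymm : ∀ x y, f (uniB x) (uniB y) = f (uniB y) (uniB x)) (x y : K) :
    ∑ i ∈ Finset.range p, f (uniB (i • (x + y))) (uniB (x + y)) =
      ∑ i ∈ Finset.range p, f (uniB (i • x)) (uniB x) +
      ∑ i ∈ Finset.range p, f (uniB (i • y)) (uniB y) := by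
  have := sum_nsmul_add (uniB_cocycle hU hf) hsymm p x y
  simp only [hV, nsmul_eq_mul (p : ℕ) x, nsmul_eq_mul (p : ℕ) y, CharP.cast_eq_zero, zero_mul,
    add_zero] at this
  exact add_right_cancel this

/-- A cocycle on the Borel subgroup without alternating part and without power map is a
coboundary. -/
lemma exists_coboundary_of_symm [CharP K p] [Fintype K] (hp : (p : F) = 0)
    (hV : ∀ v : V, p • v = 0) (hsymm : ∀ x y, f (uniB x) (uniB y) = f (uniB y) (uniB x))
    (hsum : ∀ x, ∑ i ∈ Finset.range p, f (uniB (i • x)) (uniB x) = 0) :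
    ∃ φ : Bor K → V, ∀ g h, f g h = ρ g (φ h) - φ (g * h) + φ g := by
  obtain ⟨σ, hσ⟩ := exists_symm_coboundary (p := p) (uniB_cocycle hU hf) hsymm
    (fun x => by rw [nsmul_eq_mul, CharP.cast_eq_zero, zero_mul]) hV hsum
  refine exists_coboundary_of_subgroup hf (BorChar K).ker ?_ (fun g => σ (g.1.1 0 1)) ?_
  · obtain ⟨n, _, hn⟩ := FiniteField.card K p
    rw [index_ker_BorChar, Nat.cast_sub (by have := two_le_card (K := K); omega), hn, Nat.cast_pow,
      hp, zero_pow n.ne_zero, Nat.cast_one, zero_sub]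
    exact neg_ne_zero.2 one_ne_zero
  · intro s hs s' hs'
    obtain ⟨x, rfl⟩ := (mem_ker_BorChar s).1 hs
    obtain ⟨y, rfl⟩ := (mem_ker_BorChar s').1 hs'
    rw [hU, ← uniB_add]
    simpa [uniB, coe_uni] using hσ x y

omit hU hf in
lemma hd_two_le_of_Bor_irreducible [CharP K p] [Fintype K] (hK : 2 < Fintype.card K)
    [Nontrivial V] [FiniteDimensional F V] (ρ : Representation F (Bor K) V) (hp : (p : F) = 0)
    (hirr : ∀ W : Submodule F V, (∀ g, W ≤ W.comap (ρ g)) → W = ⊥ ∨ W = ⊤) :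
    hd ρ 2 ≤ finrank F V := by
  have hU := uniB_apply ρ hp hirr
  have hV : ∀ v : V, p • v = 0 := fun v => by rw [← Nat.cast_smul_eq_nsmul F, hp, zero_smul]
  have hcoc : ∀ f : groupCohomology.cocycles₂ (Rep.of ρ), ∀ g h j,
      f (g * h, j) + f (g, h) = ρ g (f (h, j)) + f (g, h * j) :=
    fun f => (groupCohomology.mem_cocycles₂_iff _).1 f.2
  let ev : Bor K → Bor K → groupCohomology.cocycles₂ (Rep.of ρ) →ₗ[F] V := fun g h =>
    { toFun := fun f => f (g, h)
      map_add' := fun _ _ => rfl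
      map_smul' := fun _ _ => rfl }
  by_cases hA : ∃ (f : groupCohomology.cocycles₂ (Rep.of ρ)) (x y : K),
      f (uniB x, uniB y) ≠ f (uniB y, uniB x)
  · obtain ⟨f₀, x₀, y₀, h₀⟩ := hA
    refine hd_two_le_of_linearMap ρ (ev (uniB x₀) (uniB y₀) - ev (uniB y₀) (uniB x₀)) fun f hf => ?_
    have : CharP F p := (CharP.charP_iff_prime_eq_zero Fact.out).2 hp
    let Ω := AlgebraicClosure F
    have : CharP Ω p := charP_of_injective_algebraMap (algebraMap F Ω).injective p
    let _ : Algebra (ZMod p) K := ZMod.algebra K p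
    let _ : Algebra (ZMod p) Ω := ZMod.algebra Ω p
    let τ : K →ₐ[ZMod p] Ω := IsAlgClosed.lift
    obtain ⟨j, lam, hj, hlam⟩ := exists_eigenfunctional hU Ω hirr
    obtain ⟨n, _, hn⟩ := FiniteField.card K p
    have hα₀ := isAltEquivariant_of_cocycle (f := fun g h => f₀ (g, h)) hU (hcoc f₀) hlam
    have hα := isAltEquivariant_of_cocycle (f := fun g h => f (g, h)) hU (hcoc f) hlam
    have hne : j (f₀ (uniB x₀, uniB y₀) - f₀ (uniB y₀, uniB x₀)) ≠ 0 := fun h =>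
      h₀ (sub_eq_zero.1 (hj (h.trans (map_zero j).symm)))
    have hsymm : ∀ x y, f (uniB x, uniB y) = f (uniB y, uniB x) := fun x y => by
      refine sub_eq_zero.1 (hj ((hα₀.eq_zero hn hK τ hne hα ?_ x y).trans (map_zero j).symm))
      exact (congrArg j hf).trans (map_zero j)
    refine exists_coboundary_of_symm (f := fun g h => f (g, h)) hU (hcoc f) hp hV hsymm fun x => ?_
    refine hj (Eq.trans ?_ (map_zero j).symm)
    refine hα₀.additive_eq_zero hn hK τ hne
      (θ := fun x => j (∑ i ∈ Finset.range p, f (uniB (i • x), uniB x))) (fun x y => ?_)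
      (fun a x => ?_) x
    · rw [← map_add]
      exact congrArg j (sum_uniB_add (f := fun g h => f (g, h)) hU (hcoc f) hV hsymm x y)
    · rw [← hlam]
      exact congrArg j (sum_uniB_smul (f := fun g h => f (g, h)) hU (hcoc f) hV a x)
  · push Not at hA
    refine hd_two_le_of_linearMap ρ
      (∑ i ∈ Finset.range p, ev (uniB (i • 1)) (uniB 1)) fun f hf => ?_
    have h1 : ∑ i ∈ Finset.range p, f (uniB (i • (1 : K)), uniB 1) = 0 := by
      simpa [ev] using hf
    let P : K →+ V := AddMonoidHom.mk' (fun x => ∑ i ∈ Finset.range p, f (uniB (i • x), uniB x))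
      (sum_uniB_add (f := fun g h => f (g, h)) hU (hcoc f) hV (hA f))
    have hsq : ∀ x : K, P (x ^ 2) = 0 := fun x => by
      rcases eq_or_ne x 0 with rfl | hx
      · rw [zero_pow two_ne_zero, map_zero]
      · have := sum_uniB_smul (f := fun g h => f (g, h)) hU (hcoc f) hV (Units.mk0 x hx) 1
        rw [h1, map_zero] at this
        simpa [P] using this
    have hP : ∀ x, P x = 0 := fun x => by
      by_cases h2 : (2 : K) = 0
      · have : CharP K 2 := CharTwo.of_one_ne_zero_of_two_eq_zero one_ne_zero h2
        obtain ⟨y, rfl⟩ := FiniteField.isSquare_of_char_two (ringChar.eq K 2) x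
        rw [← sq, hsq]
      · have : x = ((x + 1) / 2) ^ 2 - ((x - 1) / 2) ^ 2 := by field_simp; ring
        rw [this, map_sub, hsq, hsq, sub_zero]
    exact exists_coboundary_of_symm (f := fun g h => f (g, h)) hU (hcoc f) hp hV (hA f) hP

end CharP

section Main

variable {p : ℕ} [Fact p.Prime] {K : Type} [Field K] [Fintype K] [CharP K p]
  {F : Type} [Field F] {M : Type} [AddCommGroup M] [Module F M] [FiniteDimensional F M]
  (ρ : Representation F (SL2 K) M)

/-- The bound in the defining characteristic. -/
lemma hd_two_le_of_char_eq_zero (hK : 2 < Fintype.card K) (hp : (p : F) = 0) :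
    hd ρ 2 ≤ finrank F M := by
  classical
  have hq : (Fintype.card K : F) = 0 := by
    obtain ⟨n, _, hn⟩ := FiniteField.card K p
    rw [hn, Nat.cast_pow, hp, zero_pow n.ne_zero]
  refine (hd_le_of_stabilizer ρ (Bor K) (∞ : OnePoint K) (fun _ => Iff.rfl) ?_ 2).trans
    (hd_two_le_of_irreducible (fun V _ _ _ _ ρ hirr =>
      hd_two_le_of_Bor_irreducible hK ρ hp hirr) _)
  rw [card_onePoint, Nat.cast_add, hq, Nat.cast_one, zero_add]
  exact one_ne_zero

end Main
end CohomologyBound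

/-- Let `q ≥ 4` be a prime power and `G = SL(2,q)`.  Then for every field `F` and every
finite-dimensional `FG`-module `M`, `dim H²(G,M) ≤ dim M`. -/
theorem stmt_14 (p e q : ℕ) (hp : p.Prime) (he : 0 < e) (hq : q = p ^ e) (hq4 : 4 ≤ q)
    (K : Type) [Field K] [Fintype K] (hK : Fintype.card K = q)
    (F : Type) [Field F]
    (M : Type) [AddCommGroup M] [Module F M] [FiniteDimensional F M]
    (ρ : Representation F (Matrix.SpecialLinearGroup (Fin 2) K) M) :
    Module.finrank F (groupCohomology (Rep.of ρ) 2) ≤ Module.finrank F M := by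
  classical
  change CohomologyBound.hd ρ 2 ≤ _
  subst hK
  have : Fact p.Prime := ⟨hp⟩
  by_cases hpF : (p : F) = 0
  · have : CharP K p := charP_of_card_eq_prime_pow hq
    exact CohomologyBound.hd_two_le_of_char_eq_zero ρ (by omega) hpF
  by_cases h2 : (2 : F) = 0
  · refine CohomologyBound.hd_two_le_of_two_eq_zero ρ h2 ?_ hq4
    rw [hq]
    exact (hp.odd_of_ne_two fun h => hpF (by rw [h]; exact_mod_cast h2)).pow
  · refine CohomologyBound.hd_two_le_of_ne_zero ρ ?_ h2
    rw [hq, Nat.cast_pow]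
    exact pow_ne_zero _ hpF
end

section
/- Let G be a finite group, F a field, and M a finite-dimensional irreducible FG-module on which G acts faithfully. If H^k(G,M) ≠ 0 for some integer k > 0, then G has at most k minimal normal subgroups. -/
universe u

namespace Representation

variable {k G V W : Type*} [CommRing k] [Group G] [AddCommGroup V] [Module k V]
  [AddCommGroup W] [Module k W]

/-- Some element of the augmentation ideal of `k[N]` acts on the representation `ρ` as the
identity. -/
def AugmentationActsAsOne (ρ : Representation k G V) (N : Subgroup G) : Prop :=
  ∃ a : N →₀ k, (a.sum fun _ c ↦ c) = 0 ∧ ∀ v : V, (a.sum fun n c ↦ c • ρ n v) = v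

lemma AugmentationActsAsOne.of_surjective {ρ : Representation k G V} {σ : Representation k G W}
    {N : Subgroup G} (h : ρ.AugmentationActsAsOne N) (f : ρ.IntertwiningMap σ)
    (hf : Function.Surjective f) : σ.AugmentationActsAsOne N := by
  obtain ⟨a, ha, hρ⟩ := h
  refine ⟨a, ha, fun w ↦ ?_⟩
  obtain ⟨v, rfl⟩ := hf w
  conv_rhs => rw [← hρ v]
  simp [Finsupp.sum, map_sum, f.isIntertwining]

lemma AugmentationActsAsOne.coind {ρ : Representation k G V} {N C : Subgroup G} [N.Normal]
    (h : ρ.AugmentationActsAsOne N) (hNC : N ≤ C) :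
    (coind C.subtype (ρ.comp C.subtype)).AugmentationActsAsOne N := by
  obtain ⟨a, ha, hρ⟩ := h
  refine ⟨a, ha, fun f ↦ Subtype.ext <| funext fun g ↦ ?_⟩
  have key (n : N) : f.1 (g * n) = ρ g (ρ n (ρ g⁻¹ (f.1 g))) := by
    have hc : g * n * g⁻¹ ∈ C := hNC (Subgroup.Normal.conj_mem ‹_› _ n.2 g)
    have := f.2 ⟨_, hc⟩ g
    simp only [Subgroup.coe_subtype, inv_mul_cancel_right] at this
    rw [this]
    simp
  calc
    _ = a.sum fun n c ↦ c • f.1 (g * n) := by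
      simp only [Finsupp.sum, Submodule.coe_sum, Finset.sum_apply]
      rfl
    _ = ρ g (a.sum fun n c ↦ c • ρ n (ρ g⁻¹ (f.1 g))) := by
      simp [Finsupp.sum, key]
    _ = f.1 g := by rw [hρ]; simp

/-- For a subgroup `N` centralizing `C`, an element of `k[N]` acts on a representation coinduced
from `C` by left translation of functions. -/
def coindLeftTranslation {N C : Subgroup G} (hNC : C ≤ Subgroup.centralizer N)
    (σ : Representation k C V) (a : N →₀ k) :
    (coind C.subtype σ).IntertwiningMap (coind C.subtype σ) where
  toFun f := ⟨fun g ↦ a.sum fun n c ↦ c • f.1 (n * g), fun c g ↦ by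
    have (n : N) : (n : G) * (c * g) = c * (n * g) := by
      rw [← mul_assoc, ← mul_assoc, hNC c.2 n n.2]
    have hf (n : N) := f.2 c (n * g)
    simp only [Subgroup.coe_subtype] at hf
    simp [Finsupp.sum, this, hf]⟩
  map_add' f f' := by ext; simp [Finsupp.sum, Finset.sum_add_distrib]
  map_smul' c f := by ext; simp [Finsupp.sum, Finset.smul_sum, smul_comm c]
  isIntertwining' h := by
    ext f g
    change (a.sum fun n c ↦ c • f.1 (n * g * h)) = a.sum fun n c ↦ c • f.1 (n * (g * h))
    simp only [mul_assoc]

section Clifford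

variable {F G M : Type*} [Field F] [Group G] [AddCommGroup M] [Module F M]

/-- Translation of subrepresentations of the restriction to a normal subgroup `N` by an element
of the ambient group. -/
def conjSubrepresentation (ρ : Representation F G M) (N : Subgroup G) [N.Normal] (g : G) :
    Subrepresentation (ρ.comp N.subtype) ≃o Subrepresentation (ρ.comp N.subtype) :=
  have conj (g : G) (S : Subrepresentation (ρ.comp N.subtype)) (n : N) {v : M}
      (hv : ρ g v ∈ S) : ρ g (ρ n v) ∈ S := by
    have := S.apply_mem_toSubmodule ⟨g * n * g⁻¹, Subgroup.Normal.conj_mem ‹_› _ n.2 g⟩ hv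
    change ρ g (ρ n v) ∈ S.toSubmodule
    simpa [← Module.End.mul_apply, ← map_mul] using this
  { toFun S := ⟨S.toSubmodule.comap (ρ g⁻¹), fun n _ hv ↦ conj g⁻¹ S n hv⟩
    invFun S := ⟨S.toSubmodule.comap (ρ g), fun n _ hv ↦ conj g S n hv⟩
    left_inv S := Subrepresentation.toSubmodule_injective <| by ext; simp
    right_inv S := Subrepresentation.toSubmodule_injective <| by ext; simp
    map_rel_iff' {S T} := by
      refine ⟨fun h v hv ↦ ?_, fun h v hv ↦ h hv⟩
      have : v ∈ T.toSubmodule.comap (ρ g⁻¹ ∘ₗ ρ g) :=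
        h (show ρ g⁻¹ (ρ g v) ∈ S by simpa using hv)
      change v ∈ T.toSubmodule
      simpa using this }

/-- **Clifford's theorem**: the restriction of an irreducible representation to a normal subgroup
is semisimple. -/
theorem isSemisimpleModule_comp_subtype [FiniteDimensional F M]
    (ρ : Representation F G M) (hM : Nontrivial M)
    (hirred : ∀ p : Submodule F M, (∀ (g : G) (x : M), x ∈ p → ρ g x ∈ p) → p = ⊥ ∨ p = ⊤)
    (N : Subgroup G) [N.Normal] :
    IsSemisimpleModule (MonoidAlgebra F N)
      (Representation.asModule (ρ.comp N.subtype)) := by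
  set σ : Representation F N M := ρ.comp N.subtype
  let e := Subrepresentation.subrepresentationSubmoduleOrderIso (ρ := σ)
  have : Module.Finite F σ.asModule := inferInstance
  have : IsArtinian (MonoidAlgebra F N) σ.asModule := isArtinian_of_tower F inferInstance
  have hNT : Nontrivial σ.asModule := hM
  set T := sSup {S : Submodule (MonoidAlgebra F N) σ.asModule | IsAtom S}
  let c (g : G) := (e.symm.trans (ρ.conjSubrepresentation N g)).trans e
  have hT (g : G) : c g T = T := by
    rw [OrderIso.map_sSup_eq_sSup_symm_preimage]
    congr 1
    ext S
    exact (c g).symm.isAtom_iff S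
  have hstable (g : G) (x : M) (hx : x ∈ (e.symm T).toSubmodule) :
      ρ g x ∈ (e.symm T).toSubmodule := by
    have : ρ g x ∈ c g T := show ρ g⁻¹ (ρ g x) ∈ (e.symm T).toSubmodule by simpa using hx
    rwa [hT] at this
  refine (isSemisimpleModule_iff _ _).2 (complementedLattice_of_sSup_atoms_eq_top ?_)
  rcases hirred _ hstable with h | h
  · obtain ⟨S, hS⟩ := IsAtomic.exists_atom (Submodule (MonoidAlgebra F N) σ.asModule)
    refine absurd ?_ hS.1
    rw [eq_bot_iff]
    intro x hx
    have : x ∈ T := le_sSup (a := S) hS hx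
    have : x ∈ (e.symm T).toSubmodule := this
    rw [h] at this
    exact this
  · rw [eq_top_iff]
    intro x _
    have : x ∈ (e.symm T).toSubmodule := by rw [h]; trivial
    exact this

theorem augmentationActsAsOne_of_irreducible [FiniteDimensional F M]
    (ρ : Representation F G M) (hM : Nontrivial M)
    (hirred : ∀ p : Submodule F M, (∀ (g : G) (x : M), x ∈ p → ρ g x ∈ p) → p = ⊥ ∨ p = ⊤)
    (N : Subgroup G) [hN : N.Normal] (hρ : ∃ n ∈ N, ∃ x, ρ n x ≠ x) :
    ρ.AugmentationActsAsOne N := by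
  have hinv : ∀ x : M, (∀ n : N, ρ n x = x) → x = 0 := by
    let p : Submodule F M := ⨅ n : N, LinearMap.ker (ρ n - 1)
    have hp (x : M) : x ∈ p ↔ ∀ n : N, ρ n x = x := by simp [p, sub_eq_zero]
    have hstable (g : G) (x : M) (hx : x ∈ p) : ρ g x ∈ p := by
      rw [hp] at hx ⊢
      intro n
      have := congr_arg (ρ g) (hx ⟨g⁻¹ * n * g, by simpa using hN.conj_mem _ n.2 g⁻¹⟩)
      simpa [← Module.End.mul_apply, ← map_mul, ← mul_assoc] using this
    intro x hx
    rcases hirred p hstable with h | h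
    · simpa [h] using (hp x).2 hx
    · obtain ⟨n, hn, y, hy⟩ := hρ
      exact absurd ((hp y).1 (h ▸ Submodule.mem_top) ⟨n, hn⟩) hy
  set σ : Representation F N M := ρ.comp N.subtype
  have hss : IsSemisimpleModule (MonoidAlgebra F N) σ.asModule :=
    ρ.isSemisimpleModule_comp_subtype hM hirred N
  let b := Module.finBasis F M
  let v : Fin (Module.finrank F M) →₀ σ.asModule := Finsupp.equivFunOnFinite.symm b
  let ε : MonoidAlgebra F N →ₐ[F] F := MonoidAlgebra.lift F F N 1
  let L : Submodule (MonoidAlgebra F N) (Fin (Module.finrank F M) →₀ σ.asModule) :=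
    Submodule.map (LinearMap.toSpanSingleton _ _ v) (RingHom.ker ε)
  obtain ⟨K, hK⟩ := exists_isCompl L
  obtain ⟨l, hl, w, hw, hlw⟩ := Submodule.mem_sup.1
    (show v ∈ L ⊔ K from hK.sup_eq_top ▸ Submodule.mem_top)
  obtain ⟨a, ha, rfl⟩ := Submodule.mem_map.1 hl
  have hw' : w = (1 - a) • v := by
    rw [sub_smul, one_smul, eq_sub_iff_add_eq']
    exact hlw
  have hw0 : w = 0 := by
    ext i
    refine hinv _ fun n ↦ ?_
    have hnw : (MonoidAlgebra.of F N n - 1) • w = 0 := by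
      refine (Submodule.disjoint_def.1 hK.disjoint) _ ?_ (K.smul_mem _ hw)
      refine Submodule.mem_map.2 ⟨(MonoidAlgebra.of F N n - 1) * (1 - a), ?_, ?_⟩
      · simp [ε, RingHom.mem_ker]
      · simp [hw', mul_smul]
    have := DFunLike.congr_fun hnw i
    rw [sub_smul, one_smul, Finsupp.sub_apply, Finsupp.zero_apply, sub_eq_zero] at this
    exact (LinearMap.congr_fun (σ.asAlgebraHom_of n) (w i)).symm.trans this
  have hav : σ.asAlgebraHom a = 1 := by
    refine b.ext fun i ↦ ?_
    have := DFunLike.congr_fun hlw i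
    rw [hw0, add_zero] at this
    exact this
  refine ⟨a.coeff, ?_, fun x ↦ ?_⟩
  · have : ε a = 0 := ha
    simpa [ε, MonoidAlgebra.lift_apply] using this
  · have := LinearMap.congr_fun hav x
    rw [asAlgebraHom_def, MonoidAlgebra.lift_apply] at this
    simpa [Finsupp.sum, σ] using this

end Clifford

end Representation

namespace groupCohomology
open CategoryTheory Rep Limits

variable {k G : Type u} [CommRing k] [Group G]

lemma shortExact_cokernel {A B : Rep.{u} k G} (f : A ⟶ B) [Mono f] :
    (ShortComplex.mk f (cokernel.π f) (cokernel.condition f)).ShortExact where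
  exact := ShortComplex.exact_cokernel f

lemma shortExact_map_coindFunctor {C : Subgroup G} {X : ShortComplex (Rep.{u} k C)}
    (hX : X.ShortExact) : (X.map (coindFunctor.{u} k C.subtype)).ShortExact := by
  have := hX.mono_f
  have := hX.epi_g
  have := (resCoindAdjunction.{u} k C.subtype).rightAdjoint_preservesLimits.{0, 0}
  have := Functor.preservesMonomorphisms_of_adjunction (resCoindAdjunction.{u} k C.subtype)
  exact
  { exact := hX.exact.map_of_mono_of_preservesKernel _ inferInstance inferInstance
    mono_f := (coindFunctor.{u} k C.subtype).map_mono X.f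
    epi_g := (coindFunctor.{u} k C.subtype).map_epi X.g }

/-- The unit of the adjunction between restriction to a subgroup and coinduction. -/
noncomputable abbrev toCoind (C : Subgroup G) (A : Rep.{u} k G) :
    A ⟶ coind C.subtype (res C.subtype A) :=
  resCoindToHom C.subtype A (res C.subtype A) (𝟙 _)

instance (C : Subgroup G) (A : Rep.{u} k G) : Mono (toCoind C A) := by
  rw [Rep.mono_iff_injective]
  intro x y h
  have := congr_fun (congr_arg Subtype.val h) 1
  simpa [resCoindToHom] using this

/-- The endomorphism of a coinduced representation given by left translation by an element of
`k[N]`, for a subgroup `N` centralizing the subgroup from which one coinduces. -/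
noncomputable abbrev coindLeftTranslation {N C : Subgroup G} (hNC : C ≤ Subgroup.centralizer N)
    (a : N →₀ k) (A : Rep.{u} k C) : coind C.subtype A ⟶ coind C.subtype A :=
  ofHom (Representation.coindLeftTranslation hNC A.ρ a)

lemma coindLeftTranslation_naturality {N C : Subgroup G} (hNC : C ≤ Subgroup.centralizer N)
    (a : N →₀ k) {A B : Rep.{u} k C} (f : A ⟶ B) :
    coindLeftTranslation hNC a A ≫ coindMap C.subtype f =
      coindMap C.subtype f ≫ coindLeftTranslation hNC a B := by
  ext x g
  change f.hom (a.sum fun n c ↦ c • x.1 (n * g)) = a.sum fun n c ↦ c • f.hom (x.1 (n * g))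
  simp [Finsupp.sum]

lemma map_τ₁_eq_zero {X : ShortComplex (Rep.{u} k G)} (hX : X.ShortExact) (φ : X ⟶ X) (j : ℕ)
    (hzero : IsZero (groupCohomology X.X₂ (j + 1))) (h : map (.id G) φ.τ₃ j = 0) :
    map (.id G) φ.τ₁ (j + 1) = 0 := by
  have := epi_δ_of_isZero hX j hzero
  rw [← cancel_epi (δ hX j (j + 1) rfl), δ_naturality hX hX φ j (j + 1) rfl, h, zero_comp,
    comp_zero]

lemma map_coindLeftTranslation_succ_eq_zero {N C : Subgroup G}
    (hNC : C ≤ Subgroup.centralizer N) (a : N →₀ k) {X : ShortComplex (Rep.{u} k C)}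
    (hX : X.ShortExact) (j : ℕ)
    (hzero : IsZero (groupCohomology (coind C.subtype X.X₂) (j + 1)))
    (h : map (A := coind C.subtype X.X₃) (B := coind C.subtype X.X₃) (.id G)
      (coindLeftTranslation hNC a X.X₃) j = 0) :
    map (A := coind C.subtype X.X₁) (B := coind C.subtype X.X₁) (.id G)
      (coindLeftTranslation hNC a X.X₁) (j + 1) = 0 :=
  map_τ₁_eq_zero (shortExact_map_coindFunctor hX)
    { τ₁ := coindLeftTranslation hNC a X.X₁
      τ₂ := coindLeftTranslation hNC a X.X₂
      τ₃ := coindLeftTranslation hNC a X.X₃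
      comm₁₂ := coindLeftTranslation_naturality hNC a X.f
      comm₂₃ := coindLeftTranslation_naturality hNC a X.g } j hzero h

lemma map_coindLeftTranslation_eq_zero {N C : Subgroup G} (hNC : C ≤ Subgroup.centralizer N)
    (a : N →₀ k) (ha : (a.sum fun _ c ↦ c) = 0) (j : ℕ) (A : Rep.{u} k C) :
    map (A := coind C.subtype A) (B := coind C.subtype A) (.id G)
      (coindLeftTranslation hNC a A) j = 0 := by
  induction j generalizing A with
  | zero =>
    rw [← cancel_mono (H0Iso _).hom, map_id_comp_H0Iso_hom, zero_comp]
    suffices h : (invariantsFunctor k G).map (coindLeftTranslation hNC a A) = 0 by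
      rw [h, comp_zero]
    ext f
    refine Subtype.ext <| Subtype.ext <| funext fun g ↦ ?_
    have hf (x : G) : f.1.1 x = f.1.1 1 := by
      have : f.1.1 (1 * x) = f.1.1 1 := congr_fun (congr_arg Subtype.val (f.2 x)) 1
      rwa [one_mul] at this
    change (a.sum fun n c ↦ c • f.1.1 (n * g)) = 0
    simp only [hf]
    rw [Finsupp.sum, ← Finset.sum_smul]
    exact (congr_arg (· • _) ha).trans (zero_smul _ _)
  | succ j ih =>
    have hX := shortExact_cokernel (toCoind (⊥ : Subgroup C) A)
    have hzero : IsZero (groupCohomology (coind C.subtype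
        (coind (⊥ : Subgroup C).subtype (res (⊥ : Subgroup C).subtype A))) (j + 1)) :=
      ((isZero_groupCohomology_succ_of_subsingleton _ j).of_iso
        (coindIso (S := (⊥ : Subgroup C)) _ _)).of_iso (coindIso (S := C) _ _)
    exact map_coindLeftTranslation_succ_eq_zero hNC a hX j hzero (ih _)

lemma toCoind_comp_coindLeftTranslation {N C : Subgroup G} (hNC : C ≤ Subgroup.centralizer N)
    (a : N →₀ k) (A : Rep.{u} k G) (ha : ∀ v : A, (a.sum fun n c ↦ c • A.ρ n v) = v) :
    toCoind C A ≫ coindLeftTranslation hNC a (res C.subtype A) = toCoind C A := by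
  ext v g
  change (a.sum fun n c ↦ c • A.ρ (n * g) v) = A.ρ g v
  simpa using ha (A.ρ g v)

theorem isZero_of_augmentationActsAsOne (s : Finset (Subgroup G)) (hnormal : ∀ N ∈ s, N.Normal)
    (hcomm : ∀ N ∈ s, ∀ K ∈ s, N ≠ K → K ≤ Subgroup.centralizer N) (A : Rep.{u} k G)
    (hA : ∀ N ∈ s, A.ρ.AugmentationActsAsOne N) (j : ℕ) (hj : j < s.card) :
    IsZero (groupCohomology A j) := by
  classical
  induction s using Finset.induction_on generalizing A j with
  | empty => simp at hj
  | insert N s hNs ih =>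
    simp only [Finset.mem_insert, forall_eq_or_imp] at hnormal hcomm hA
    set C := Subgroup.centralizer (N : Set G)
    have hsC : ∀ K ∈ s, K ≤ C := fun K hK ↦ hcomm.1.2 K hK (by rintro rfl; exact hNs hK)
    obtain ⟨⟨a, ha, hav⟩, hA⟩ := hA
    have hX := shortExact_cokernel (toCoind C A)
    have hmono : Mono (map (A := A) (B := coind C.subtype (res C.subtype A)) (.id G)
        (toCoind C A) j) := by
      cases j with
      | zero => exact mono_map_0_of_mono _
      | succ j =>
        refine (mapShortComplex₁_exact hX (i := j) rfl).mono_g (IsZero.eq_of_src ?_ _ _)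
        refine ih hnormal.2 (fun N hN ↦ (hcomm.2 N hN).2) _ (fun K hK ↦ ?_) j ?_
        · have := hnormal.2 K hK
          exact ((hA K hK).coind (hsC K hK)).of_surjective (cokernel.π (toCoind C A)).hom
            ((Rep.epi_iff_surjective _).1 inferInstance)
        · grind
    have h := congr_arg (fun f ↦ map (A := A) (B := coind C.subtype (res C.subtype A)) (.id G) f j)
      (toCoind_comp_coindLeftTranslation le_rfl a A hav)
    rw [map_id_comp, map_coindLeftTranslation_eq_zero _ _ ha, comp_zero] at h
    exact IsZero.of_mono_eq_zero _ h.symm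

end groupCohomology

/-- Let `G` be a finite group, `F` a field and `M` a finite-dimensional irreducible
faithful `FG`-module.  If `Hᵏ(G,M) ≠ 0` for some `k > 0`, then `G` has at most `k`
minimal normal subgroups. -/
theorem stmt_16 (G : Type u) [Group G] [Finite G]
    (F : Type u) [Field F]
    (M : Type u) [AddCommGroup M] [Module F M] [FiniteDimensional F M]
    (ρ : Representation F G M)
    (hfaithful : ∀ g : G, (∀ x : M, ρ g x = x) → g = 1)
    (hnontrivial : Nontrivial M)
    (hirred : ∀ p : Submodule F M, (∀ (g : G) (x : M), x ∈ p → ρ g x ∈ p) → p = ⊥ ∨ p = ⊤)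
    (k : ℕ) (hk : 0 < k)
    (hH : Nontrivial (groupCohomology (Rep.of ρ) k)) :
    {N : Subgroup G | N.Normal ∧ N ≠ ⊥ ∧
      ∀ K : Subgroup G, K.Normal → K ≤ N → K = ⊥ ∨ K = N}.ncard ≤ k := by
  set S := {N : Subgroup G | N.Normal ∧ N ≠ ⊥ ∧
    ∀ K : Subgroup G, K.Normal → K ≤ N → K = ⊥ ∨ K = N}
  have hS : S.Finite := S.toFinite
  by_contra! hlt
  rw [Set.ncard_eq_toFinset_card S hS] at hlt
  refine not_nontrivial_iff_subsingleton.2 (ModuleCat.isZero_iff_subsingleton.1 <|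
    groupCohomology.isZero_of_augmentationActsAsOne hS.toFinset ?_ ?_ (Rep.of ρ) ?_ k hlt) hH
  · exact fun N hN ↦ ((hS.mem_toFinset).1 hN).1
  · intro N hN K hK hNK x hx y hy
    rw [hS.mem_toFinset] at hN hK
    obtain ⟨hN, -, hNmin⟩ := hN
    obtain ⟨hK, -, hKmin⟩ := hK
    refine Subgroup.commute_of_normal_of_disjoint N K hN hK (disjoint_iff.2 ?_) y x hy hx
    rcases hNmin (N ⊓ K) inferInstance inf_le_left with h | h
    · exact h
    · rcases hKmin (N ⊓ K) inferInstance inf_le_right with h' | h'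
      · exact h'
      · exact absurd (h.symm.trans h') hNK
  · intro N hN
    obtain ⟨hN, hNbot, -⟩ := (hS.mem_toFinset).1 hN
    refine ρ.augmentationActsAsOne_of_irreducible hnontrivial hirred N ?_
    obtain ⟨n, hn⟩ := N.ne_bot_iff_exists_ne_one.1 hNbot
    by_contra! h
    exact hn (Subtype.ext (hfaithful n (h n n.2)))
end
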